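/- arXiv:1906.07173 — 2 statements merged into one kernel-verified Lean document; each statement's English description precedes it below -/
import Mathlib

section
/- For any t∈(0,τ], x,y,v∈ℝ^d one has |p_y(t,x+v) + p_y(t,x−v) − 2p_y(t,x)| ≤ c·(1 ∧ t^{−2/α}|v|²)·max_{ξ∈D(x,v)} r_y(t,ξ), where D(x,v)=[x₁−|v₁|,x₁+|v₁|]×…×[x_d−|v_d|,x_d+|v_d|] and c is a constant independent of t, x, y, v. -/
open Filter MeasureTheory

/-- The majorant `tilde-g_t^{(ε)}(x)`: equal to `(1/h^{-1}(1/t)) ∧ (t h(|x|)/|x|)` for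
`|x| < ε` (with `h(0)/0 = ∞`) and to `c_ε t^p e^{-|x|}` for `|x| ≥ ε`, where
`p = (d+β-1)/α` and `c_ε = ((1/h^{-1}(1/τ)) ∧ (τ h(ε)/ε)) e^ε τ^{-p}`. -/
noncomputable def tg (h hinv : ℝ → ℝ) (τ ε p t x : ℝ) : ℝ :=
  if x = 0 then 1 / hinv (1 / t)
  else if |x| < ε then min (1 / hinv (1 / t)) (t * h |x| / |x|)
  else min (1 / hinv (1 / τ)) (τ * h ε / ε) * Real.exp ε / τ ^ p *
    (t ^ p * Real.exp (-|x|))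


lemma kl_cosh_bd (z : ℂ) : ‖Complex.cosh z - 1‖ ≤ ‖z‖ ^ 2 * Real.exp ‖z‖ := by
  have h1 := Complex.norm_exp_sub_sum_le_norm_mul_exp z 2
  have h2 := Complex.norm_exp_sub_sum_le_norm_mul_exp (-z) 2
  simp only [Finset.sum_range_succ, Finset.sum_range_zero, pow_zero, pow_one, Nat.factorial,
    Nat.cast_one, div_one, zero_add, norm_neg, Nat.succ_eq_add_one, Nat.reduceAdd, mul_one] at h1 h2
  have : Complex.cosh z - 1 = ((Complex.exp z - (1 + z)) + (Complex.exp (-z) - (1 + -z))) / 2 := by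
    rw [Complex.cosh]; ring
  rw [this, norm_div]
  have h3 := norm_add_le (Complex.exp z - (1 + z)) (Complex.exp (-z) - (1 + -z))
  simp only [Complex.norm_ofNat]
  rw [div_le_iff₀ (by norm_num)]
  linarith

lemma kl_sinh_bd (z : ℂ) : ‖Complex.sinh z‖ ≤ ‖z‖ * Real.exp ‖z‖ := by
  have h1 := Complex.norm_exp_sub_sum_le_norm_mul_exp z 1
  have h2 := Complex.norm_exp_sub_sum_le_norm_mul_exp (-z) 1
  simp only [Finset.sum_range_succ, Finset.sum_range_zero, pow_zero, pow_one, Nat.factorial,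
    Nat.cast_one, div_one, zero_add, norm_neg] at h1 h2
  have : Complex.sinh z = ((Complex.exp z - 1) - (Complex.exp (-z) - 1)) / 2 := by
    rw [Complex.sinh]; ring
  rw [this, norm_div]
  have h3 := norm_sub_le (Complex.exp z - 1) (Complex.exp (-z) - 1)
  simp only [Complex.norm_ofNat]
  rw [div_le_iff₀ (by norm_num)]
  linarith

noncomputable def klLam (m : ℝ → ℝ) (z : ℂ) : ℂ := ∫ y : ℝ, (Complex.cosh (z * y) - 1) * (m y : ℂ)

noncomputable def klPsi (m : ℝ → ℝ) (ξ : ℝ) : ℝ := ∫ y : ℝ, (1 - Real.cos (ξ * y)) * m y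

lemma kl_cosh_m_bd {m : ℝ → ℝ} {R : ℝ} (hm0 : ∀ y, 0 ≤ m y) (hR : ∀ y, R < |y| → m y = 0)
    (z : ℂ) (y : ℝ) :
    ‖(Complex.cosh (z * y) - 1) * (m y : ℂ)‖ ≤ ‖z‖ ^ 2 * Real.exp (‖z‖ * R) * (y ^ 2 * m y) := by
  by_cases hy : R < |y|
  · simp [hR y hy]
  · push Not at hy
    have h1 := kl_cosh_bd (z * y)
    rw [norm_mul, Complex.norm_real, Real.norm_of_nonneg (hm0 y)]
    have h2 : ‖z * (y:ℂ)‖ = ‖z‖ * |y| := by rw [norm_mul, Complex.norm_real, Real.norm_eq_abs]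
    rw [h2, mul_pow, sq_abs] at h1
    have h3 : Real.exp (‖z‖ * |y|) ≤ Real.exp (‖z‖ * R) :=
      Real.exp_le_exp.2 (mul_le_mul_of_nonneg_left hy (norm_nonneg _))
    calc _ ≤ ‖z‖ ^ 2 * y ^ 2 * Real.exp (‖z‖ * |y|) * m y :=
          mul_le_mul_of_nonneg_right h1 (hm0 y)
      _ ≤ ‖z‖ ^ 2 * y ^ 2 * Real.exp (‖z‖ * R) * m y := by
          have := hm0 y
          gcongr
      _ = _ := by ring

lemma kl_cosh_m_int {m : ℝ → ℝ} {R : ℝ} (hm : Measurable m) (hm0 : ∀ y, 0 ≤ m y)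
    (hR : ∀ y, R < |y| → m y = 0) (hM : Integrable (fun y => y ^ 2 * m y)) (z : ℂ) :
    Integrable (fun y : ℝ => (Complex.cosh (z * y) - 1) * (m y : ℂ)) := by
  refine Integrable.mono' (hM.const_mul (‖z‖ ^ 2 * Real.exp (‖z‖ * R))) ?_
    (ae_of_all _ fun y => kl_cosh_m_bd hm0 hR z y)
  apply Measurable.aestronglyMeasurable
  have : Continuous fun y : ℝ => Complex.cosh (z * y) - 1 := by fun_prop
  exact this.measurable.mul (Complex.measurable_ofReal.comp hm)

lemma kl_Lam_diff {m : ℝ → ℝ} {R : ℝ} (hm : Measurable m) (hm0 : ∀ y, 0 ≤ m y)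
    (hR : ∀ y, R < |y| → m y = 0) (hM : Integrable (fun y => y ^ 2 * m y)) :
    Differentiable ℂ (klLam m) := by
  intro z0
  have key := hasDerivAt_integral_of_dominated_loc_of_deriv_le (𝕜 := ℂ) (μ := volume)
    (F := fun z (y : ℝ) => (Complex.cosh (z * y) - 1) * (m y : ℂ))
    (F' := fun z (y : ℝ) => (Complex.sinh (z * y) * y) * (m y : ℂ))
    (x₀ := z0) (s := Metric.ball z0 1)
    (bound := fun y => ((‖z0‖ + 1) * Real.exp ((‖z0‖ + 1) * R)) * (y ^ 2 * m y))
    (Metric.ball_mem_nhds _ one_pos)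
    (Eventually.of_forall fun z => (kl_cosh_m_int hm hm0 hR hM z).aestronglyMeasurable)
    (kl_cosh_m_int hm hm0 hR hM z0) ?_ ?_ (hM.const_mul _) ?_
  · exact key.2.differentiableAt
  · apply Measurable.aestronglyMeasurable
    have : Continuous fun y : ℝ => Complex.sinh (z0 * y) * y := by fun_prop
    exact this.measurable.mul (Complex.measurable_ofReal.comp hm)
  · refine ae_of_all _ fun y z hz => ?_
    by_cases hy : R < |y|
    · simp [hR y hy]
    · push Not at hy
      have hz' : ‖z‖ ≤ ‖z0‖ + 1 := by
        have : ‖z - z0‖ < 1 := by simpa [dist_eq_norm] using hz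
        have h2 := norm_add_le (z - z0) z0
        simp only [sub_add_cancel] at h2
        linarith
      have h1 := kl_sinh_bd (z * y)
      have h2 : ‖z * (y:ℂ)‖ = ‖z‖ * |y| := by rw [norm_mul, Complex.norm_real, Real.norm_eq_abs]
      rw [h2] at h1
      rw [norm_mul, norm_mul, Complex.norm_real, Complex.norm_real, Real.norm_of_nonneg (hm0 y),
        Real.norm_eq_abs]
      have h3 : Real.exp (‖z‖ * |y|) ≤ Real.exp ((‖z0‖ + 1) * R) := by
        apply Real.exp_le_exp.2
        have := abs_nonneg y
        gcongr
      have := hm0 y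
      calc ‖Complex.sinh (z * y)‖ * |y| * m y
          ≤ (‖z‖ * |y| * Real.exp (‖z‖ * |y|)) * |y| * m y := by gcongr
        _ ≤ ((‖z0‖ + 1) * |y| * Real.exp ((‖z0‖ + 1) * R)) * |y| * m y := by gcongr
        _ = _ := by rw [← sq_abs y]; ring
  · refine ae_of_all _ fun y z _ => ?_
    have h1 : HasDerivAt (fun z : ℂ => z * (y:ℂ)) (y:ℂ) z := by
      simpa using (hasDerivAt_id z).mul_const (y:ℂ)
    exact ((h1.ccosh).sub_const 1).mul_const _

lemma kl_cos_m_int {m : ℝ → ℝ} (hm : Measurable m) (hm0 : ∀ y, 0 ≤ m y)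
    (hM : Integrable (fun y => y ^ 2 * m y)) (ξ : ℝ) :
    Integrable (fun y : ℝ => (1 - Real.cos (ξ * y)) * m y) := by
  refine Integrable.mono' (hM.const_mul (ξ ^ 2 / 2)) ?_ (ae_of_all _ fun y => ?_)
  · apply Measurable.aestronglyMeasurable
    have : Continuous fun y : ℝ => 1 - Real.cos (ξ * y) := by fun_prop
    exact this.measurable.mul hm
  · have h1 := Real.one_sub_sq_div_two_le_cos (x := ξ * y)
    have h2 := Real.cos_le_one (ξ * y)
    rw [Real.norm_of_nonneg (mul_nonneg (by linarith) (hm0 y))]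
    have := mul_le_mul_of_nonneg_right (show 1 - Real.cos (ξ * y) ≤ ξ ^ 2 / 2 * y ^ 2 by nlinarith)
      (hm0 y)
    linarith

lemma kl_Lam_I {m : ℝ → ℝ} (ξ : ℝ) : klLam m (ξ * Complex.I) = ((- klPsi m ξ : ℝ) : ℂ) := by
  unfold klLam klPsi
  rw [← integral_neg, ← integral_complex_ofReal]
  congr 1
  ext y
  have : (ξ : ℂ) * Complex.I * y = ((ξ * y : ℝ) : ℂ) * Complex.I := by push_cast; ring
  rw [this, Complex.cosh_mul_I, ← Complex.ofReal_cos]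
  push_cast
  ring

lemma kl_Lam_re {m : ℝ → ℝ} {R : ℝ} (hm : Measurable m) (hm0 : ∀ y, 0 ≤ m y)
    (hR : ∀ y, R < |y| → m y = 0) (hM : Integrable (fun y => y ^ 2 * m y)) (κ ξ : ℝ) :
    (klLam m (κ + ξ * Complex.I)).re ≤
      κ ^ 2 * Real.exp (|κ| * R) * (∫ y, y ^ 2 * m y) - klPsi m ξ := by
  unfold klLam klPsi
  rw [← integral_const_mul, ← integral_sub (hM.const_mul _) (kl_cos_m_int hm hm0 hM ξ)]
  have hre := Complex.reCLM.integral_comp_comm (kl_cosh_m_int hm hm0 hR hM (κ + ξ * Complex.I))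
  simp only [Complex.reCLM_apply] at hre
  rw [← hre]
  refine integral_mono (kl_cosh_m_int hm hm0 hR hM (κ + ξ * Complex.I)).re
    ((hM.const_mul _).sub (kl_cos_m_int hm hm0 hM ξ)) fun y => ?_
  have e1 : ((Complex.cosh ((κ + ξ * Complex.I) * y) - 1) * (m y : ℂ)).re
      = (Real.cosh (κ * y) * Real.cos (ξ * y) - 1) * m y := by
    rw [Complex.re_mul_ofReal]
    congr 1
    have : ((κ:ℂ) + ξ * Complex.I) * y = ((κ * y : ℝ) : ℂ) + ((ξ * y : ℝ) : ℂ) * Complex.I := by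
      push_cast; ring
    rw [this, Complex.cosh_add, Complex.cosh_mul_I, Complex.sinh_mul_I, ← Complex.ofReal_cos,
      ← Complex.ofReal_cosh, ← Complex.ofReal_sinh, ← Complex.ofReal_sin]
    simp [← Complex.ofReal_mul, -Complex.ofReal_cos,
      -Complex.ofReal_cosh, -Complex.ofReal_sinh, -Complex.ofReal_sin]
  have e2 := kl_cosh_m_bd hm0 hR (κ : ℂ) y
  have e3 : (Complex.cosh ((κ:ℂ) * y) - 1) * (m y : ℂ) = (((Real.cosh (κ * y) - 1) * m y : ℝ) : ℂ) := by
    push_cast; rfl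
  rw [e3, Complex.norm_real, Complex.norm_real, Real.norm_eq_abs, Real.norm_eq_abs, sq_abs] at e2
  have e4 := (le_abs_self _).trans e2
  show ((Complex.cosh ((κ + ξ * Complex.I) * y) - 1) * (m y : ℂ)).re ≤ _
  rw [e1]
  have c1 := Real.one_le_cosh (κ * y)
  have c2 := Real.cos_le_one (ξ * y)
  have c3 := hm0 y
  have : (Real.cosh (κ * y) * Real.cos (ξ * y) - 1) * m y ≤
      (Real.cosh (κ * y) - 1) * m y - (1 - Real.cos (ξ * y)) * m y := by
    rw [← sub_mul]
    apply mul_le_mul_of_nonneg_right _ c3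
    nlinarith
  linarith

/-- contour shift -/
lemma kl_shift {H : ℂ → ℂ} (hH : Differentiable ℂ H) (κ : ℝ) {B : ℝ → ℝ} (hB : Integrable B)
    (hB1 : Tendsto B atTop (nhds 0)) (hB2 : Tendsto B atBot (nhds 0))
    (hbd : ∀ s ξ : ℝ, |s| ≤ |κ| → ‖H (s + ξ * Complex.I)‖ ≤ B ξ) :
    ∫ ξ : ℝ, H (ξ * Complex.I) = ∫ ξ : ℝ, H (κ + ξ * Complex.I) := by
  have hcont : Continuous H := hH.continuous
  have hint : ∀ s : ℝ, |s| ≤ |κ| → Integrable fun ξ : ℝ => H (s + ξ * Complex.I) := fun s hs =>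
    hB.mono' (by apply Continuous.aestronglyMeasurable; fun_prop) (ae_of_all _ fun ξ => hbd s ξ hs)
  have hs : ∀ x ∈ Set.uIoc 0 κ, |x| ≤ |κ| := by
    intro x hx
    have := Set.abs_sub_left_of_mem_uIcc (Set.uIoc_subset_uIcc hx)
    simpa using this
  have rect : ∀ T : ℝ, (∫ x in (0:ℝ)..κ, H (x + (-T : ℝ) * Complex.I)) -
      (∫ x in (0:ℝ)..κ, H (x + T * Complex.I)) +
      Complex.I • (∫ y in (-T)..T, H (κ + y * Complex.I)) -
      Complex.I • (∫ y in (-T)..T, H ((0:ℝ) + y * Complex.I)) = 0 := by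
    intro T
    have := Complex.integral_boundary_rect_eq_zero_of_differentiableOn H ⟨0, -T⟩ ⟨κ, T⟩
      hH.differentiableOn
    simpa using this
  have t1 : Tendsto (fun T : ℝ => ∫ x in (0:ℝ)..κ, H (x + (-T : ℝ) * Complex.I)) atTop (nhds 0) := by
    have : Tendsto (fun T : ℝ => B (-T) * |κ - 0|) atTop (nhds 0) := by
      simpa using (hB2.comp tendsto_neg_atTop_atBot).mul_const (|κ - 0|)
    refine squeeze_zero_norm (fun T => ?_) this
    exact intervalIntegral.norm_integral_le_of_norm_le_const fun x hx => hbd x (-T) (hs x hx)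
  have t2 : Tendsto (fun T : ℝ => ∫ x in (0:ℝ)..κ, H (x + T * Complex.I)) atTop (nhds 0) := by
    have : Tendsto (fun T : ℝ => B T * |κ - 0|) atTop (nhds 0) := by
      simpa using hB1.mul_const (|κ - 0|)
    refine squeeze_zero_norm (fun T => ?_) this
    exact intervalIntegral.norm_integral_le_of_norm_le_const fun x hx => hbd x T (hs x hx)
  have t3 := intervalIntegral_tendsto_integral (hint κ le_rfl) tendsto_neg_atTop_atBot tendsto_id
  have t4 := intervalIntegral_tendsto_integral (hint 0 (by simp)) tendsto_neg_atTop_atBot tendsto_id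
  have t5 := ((t1.sub t2).add (t3.const_smul Complex.I)).sub (t4.const_smul Complex.I)
  simp only [id] at t5
  have t6 := tendsto_nhds_unique t5 ((tendsto_congr rect).2 tendsto_const_nhds)
  simp only [sub_self, zero_add, smul_eq_mul] at t6
  rw [← mul_sub, mul_eq_zero, or_iff_right Complex.I_ne_zero, sub_eq_zero] at t6
  rw [t6]
  simp

noncomputable def klG (Φ : ℝ → ℂ) (k : ℕ) (x : ℝ) : ℂ :=
  ∫ ξ : ℝ, (ξ * Complex.I) ^ k * Complex.exp (x * (ξ * Complex.I)) * Φ ξ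

lemma kl_poly_bd {a κ ξ : ℝ} (ha : 0 < a) {k : ℕ} (hk : k ≤ 2) :
    (|κ| + |ξ|) ^ k * (1 / (1 + a * |ξ|) ^ 6) ≤
      (1 / a) ^ k * (1 + a * |κ|) ^ k * (1 + (a * ξ) ^ 2)⁻¹ := by
  have h0 : 0 ≤ a * |ξ| := by positivity
  have h1 : |κ| + |ξ| ≤ (1 / a) * (1 + a * |κ|) * (1 + a * |ξ|) := by
    rw [div_mul_eq_mul_div, div_mul_eq_mul_div, le_div_iff₀ ha]
    have : 0 ≤ a * |κ| * (a * |ξ|) := by positivity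
    nlinarith
  have h2 : (1 + a * |ξ|) ^ k ≤ (1 + a * |ξ|) ^ 2 := pow_le_pow_right₀ (by linarith) hk
  have h3 : (1 + a * |ξ|) ^ 2 * (1 / (1 + a * |ξ|) ^ 6) ≤ (1 + (a * ξ) ^ 2)⁻¹ := by
    rw [mul_one_div, ← one_div, div_le_div_iff₀ (by positivity) (by positivity)]
    have e : (a * ξ) ^ 2 = (a * |ξ|) ^ 2 := by rw [mul_pow, mul_pow, sq_abs]
    rw [e, one_mul, show (1 + a * |ξ|) ^ 6 = (1 + a * |ξ|) ^ 2 * (1 + a * |ξ|) ^ 4 by ring]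
    apply mul_le_mul_of_nonneg_left _ (by positivity)
    have : (1 + a * |ξ|) ^ 2 ≤ (1 + a * |ξ|) ^ 4 := pow_le_pow_right₀ (by linarith) (by norm_num)
    nlinarith
  calc _ ≤ ((1 / a) * (1 + a * |κ|) * (1 + a * |ξ|)) ^ k * (1 / (1 + a * |ξ|) ^ 6) := by gcongr
    _ = (1 / a) ^ k * (1 + a * |κ|) ^ k * ((1 + a * |ξ|) ^ k * (1 / (1 + a * |ξ|) ^ 6)) := by
        rw [mul_pow, mul_pow]; ring
    _ ≤ (1 / a) ^ k * (1 + a * |κ|) ^ k * ((1 + a * |ξ|) ^ 2 * (1 / (1 + a * |ξ|) ^ 6)) := by gcongr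
    _ ≤ _ := by gcongr

lemma kl_int_inv {a : ℝ} (ha : 0 < a) : Integrable (fun ξ : ℝ => (1 + (a * ξ) ^ 2)⁻¹) :=
  integrable_inv_one_add_sq.comp_mul_left' ha.ne'

lemma kl_int_inv_eq {a : ℝ} (ha : 0 < a) : ∫ ξ : ℝ, (1 + (a * ξ) ^ 2)⁻¹ = Real.pi / a := by
  have := MeasureTheory.Measure.integral_comp_mul_left (fun u : ℝ => (1 + u ^ 2)⁻¹) a
  rw [this, integral_univ_inv_one_add_sq, abs_of_pos (by positivity), smul_eq_mul]
  field_simp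

/-- Esscher bound -/
lemma kl_esscher {m : ℝ → ℝ} {R : ℝ} (hm : Measurable m) (hm0 : ∀ y, 0 ≤ m y)
    (hR : ∀ y, R < |y| → m y = 0) (hR0 : 0 ≤ R) (hM : Integrable (fun y => y ^ 2 * m y))
    {t a D : ℝ} (ht : 0 < t) (ha : 0 < a) (hD : 0 ≤ D)
    (hdec : ∀ ξ, Real.exp (-t * klPsi m ξ) ≤ D * (1 / (1 + a * |ξ|) ^ 6))
    (κ x : ℝ) {k : ℕ} (hk : k ≤ 2) :
    ‖klG (fun ξ => (Real.exp (-t * klPsi m ξ) : ℂ)) k x‖ ≤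
      Real.exp (κ * x) * Real.exp (t * (κ ^ 2 * Real.exp (|κ| * R) * (∫ y, y ^ 2 * m y))) *
       (D * Real.pi * (1 / a) ^ (k + 1) * (1 + a * |κ|) ^ k) := by
  set M := ∫ y, y ^ 2 * m y with hMdef
  have hMnn : 0 ≤ M := integral_nonneg fun y => mul_nonneg (sq_nonneg _) (hm0 y)
  set H : ℂ → ℂ := fun z => z ^ k * Complex.exp (x * z) * Complex.exp (t * klLam m z) with hHdef
  have hHd : Differentiable ℂ H := by
    have := kl_Lam_diff hm hm0 hR hM
    fun_prop
  have hnorm : ∀ s ξ : ℝ, ‖H (s + ξ * Complex.I)‖ ≤ (|s| + |ξ|) ^ k * Real.exp (s * x) *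
      (Real.exp (t * (s ^ 2 * Real.exp (|s| * R) * M)) * (D * (1 / (1 + a * |ξ|) ^ 6))) := by
    intro s ξ
    rw [hHdef]
    simp only [norm_mul, norm_pow, Complex.norm_exp]
    have b1 : ‖(s:ℂ) + ξ * Complex.I‖ ≤ |s| + |ξ| := by
      refine (norm_add_le _ _).trans ?_
      simp
    have b2 : ((x:ℂ) * (s + ξ * Complex.I)).re = s * x := by simp; ring
    have b3 : ((t:ℂ) * klLam m (s + ξ * Complex.I)).re = t * (klLam m (s + ξ * Complex.I)).re := by
      simp
    rw [b2, b3]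
    have b4 := kl_Lam_re hm hm0 hR hM s ξ
    have b5 : Real.exp (t * (klLam m (s + ξ * Complex.I)).re) ≤
        Real.exp (t * (s ^ 2 * Real.exp (|s| * R) * M)) * Real.exp (-t * klPsi m ξ) := by
      rw [← Real.exp_add]
      apply Real.exp_le_exp.2
      have := mul_le_mul_of_nonneg_left b4 ht.le
      rw [mul_sub] at this
      linarith
    have b6 := hdec ξ
    gcongr
    exact b5.trans (by gcongr)
  set K0 := Real.exp (|κ| * |x|) * (Real.exp (t * (κ ^ 2 * Real.exp (|κ| * R) * M)) * D) *
    ((1 / a) ^ k * (1 + a * |κ|) ^ k) with hK0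
  have hsh : ∫ ξ : ℝ, H (ξ * Complex.I) = ∫ ξ : ℝ, H (κ + ξ * Complex.I) := by
    refine kl_shift hHd κ (B := fun ξ => K0 * (1 + (a * ξ) ^ 2)⁻¹)
      ((kl_int_inv ha).const_mul _) ?_ ?_ ?_
    · have : Tendsto (fun ξ : ℝ => (1 + (a * ξ) ^ 2)⁻¹) atTop (nhds 0) := by
        apply Tendsto.inv_tendsto_atTop
        apply tendsto_atTop_add_const_left
        exact (tendsto_pow_atTop (by norm_num)).comp (tendsto_id.const_mul_atTop ha)
      simpa using this.const_mul K0
    · have : Tendsto (fun ξ : ℝ => (1 + (a * ξ) ^ 2)⁻¹) atBot (nhds 0) := by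
        apply Tendsto.inv_tendsto_atTop
        apply tendsto_atTop_add_const_left
        have := (tendsto_pow_atTop (α := ℝ) (n := 2) (by norm_num)).comp
          ((tendsto_neg_atBot_atTop (G := ℝ)).const_mul_atTop ha)
        refine this.congr fun u => ?_
        simp
      simpa using this.const_mul K0
    · intro s ξ hs
      refine (hnorm s ξ).trans ?_
      have c1 : s * x ≤ |κ| * |x| := (le_abs_self _).trans (by rw [abs_mul]; gcongr)
      have c2 : s ^ 2 ≤ κ ^ 2 := sq_le_sq.2 hs
      calc _ ≤ (|κ| + |ξ|) ^ k * Real.exp (|κ| * |x|) *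
            (Real.exp (t * (κ ^ 2 * Real.exp (|κ| * R) * M)) * (D * (1 / (1 + a * |ξ|) ^ 6))) := by
            gcongr
        _ = Real.exp (|κ| * |x|) * (Real.exp (t * (κ ^ 2 * Real.exp (|κ| * R) * M)) * D) *
            ((|κ| + |ξ|) ^ k * (1 / (1 + a * |ξ|) ^ 6)) := by ring
        _ ≤ Real.exp (|κ| * |x|) * (Real.exp (t * (κ ^ 2 * Real.exp (|κ| * R) * M)) * D) *
            ((1 / a) ^ k * (1 + a * |κ|) ^ k * (1 + (a * ξ) ^ 2)⁻¹) := by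
            gcongr ?_ * ?_
            exact kl_poly_bd ha hk
        _ = _ := by rw [hK0]; ring
  have hG : klG (fun ξ => (Real.exp (-t * klPsi m ξ) : ℂ)) k x = ∫ ξ : ℝ, H (ξ * Complex.I) := by
    unfold klG
    congr 1
    ext ξ
    rw [hHdef]
    simp only [kl_Lam_I]
    congr 1
    push_cast
    congr 1
    ring
  rw [hG, hsh]
  set K1 := Real.exp (κ * x) * (Real.exp (t * (κ ^ 2 * Real.exp (|κ| * R) * M)) * D) *
    ((1 / a) ^ k * (1 + a * |κ|) ^ k) with hK1
  calc _ ≤ ∫ ξ : ℝ, K1 * (1 + (a * ξ) ^ 2)⁻¹ := by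
        refine norm_integral_le_of_norm_le ((kl_int_inv ha).const_mul _) (ae_of_all _ fun ξ => ?_)
        refine (hnorm κ ξ).trans ?_
        calc _ = Real.exp (κ * x) * (Real.exp (t * (κ ^ 2 * Real.exp (|κ| * R) * M)) * D) *
            ((|κ| + |ξ|) ^ k * (1 / (1 + a * |ξ|) ^ 6)) := by ring
          _ ≤ Real.exp (κ * x) * (Real.exp (t * (κ ^ 2 * Real.exp (|κ| * R) * M)) * D) *
            ((1 / a) ^ k * (1 + a * |κ|) ^ k * (1 + (a * ξ) ^ 2)⁻¹) := by
            gcongr ?_ * ?_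
            exact kl_poly_bd ha hk
          _ = _ := by rw [hK1]; ring
    _ = K1 * (Real.pi / a) := by rw [integral_const_mul, kl_int_inv_eq ha]
    _ = _ := by rw [hK1, pow_succ]; ring

structure KlD (ν μ h : ℝ → ℝ) (α C₁ δ : ℝ) : Prop where
  hα : 0 < α
  hC₁ : 0 < C₁
  hδ : 0 < δ
  νmeas : Measurable ν
  ν0 : ∀ x, 0 ≤ ν x
  νsymm : ∀ x, ν (-x) = ν x
  νint : Integrable (fun x : ℝ => min (x ^ 2) 1 * ν x)
  hdef : ∀ r : ℝ, 0 < r → h r = ∫ x : ℝ, min 1 (x ^ 2 / r ^ 2) * ν x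
  hpos : ∀ r : ℝ, 0 < r → 0 < h r
  hanti : ∀ r s : ℝ, 0 < r → r ≤ s → h s ≤ h r
  lsc : ∀ θ : ℝ, 0 < θ → ∀ l : ℝ, 1 ≤ l → C₁ * l ^ α * h (l * θ) ≤ h θ
  μmeas : Measurable μ
  μsymm : ∀ x, μ (-x) = μ x
  μeq : ∀ x : ℝ, 0 < x → x ≤ δ → μ x = ν x
  μbd : ∀ x : ℝ, 0 < x → 0 ≤ μ x ∧ μ x ≤ ν x
  μzero : ∀ x : ℝ, 2 * δ ≤ x → μ x = 0
  μanti : ∀ x y : ℝ, 0 < x → x ≤ y → μ y ≤ μ x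

open Classical in
noncomputable def klms (μ : ℝ → ℝ) (a y : ℝ) : ℝ := if 0 < |y| ∧ |y| < a then μ y else 0

open Classical in
noncomputable def klml (μ : ℝ → ℝ) (a y : ℝ) : ℝ := if a ≤ |y| then μ y else 0

open Classical in
noncomputable def klmf (μ : ℝ → ℝ) (y : ℝ) : ℝ := if 0 < |y| then μ y else 0

section
variable {ν μ h : ℝ → ℝ} {α C₁ δ : ℝ}

lemma KlD.μabs (D : KlD ν μ h α C₁ δ) (y : ℝ) : μ |y| = μ y := by
  rcases abs_choice y with h | h <;> rw [h]; exact D.μsymm y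

lemma KlD.νabs (D : KlD ν μ h α C₁ δ) (y : ℝ) : ν |y| = ν y := by
  rcases abs_choice y with h | h <;> rw [h]; exact D.νsymm y

lemma KlD.μbd' (D : KlD ν μ h α C₁ δ) (y : ℝ) (hy : 0 < |y|) : 0 ≤ μ y ∧ μ y ≤ ν y := by
  rw [← D.μabs, ← D.νabs]; exact D.μbd _ hy

lemma KlD.ms_meas (D : KlD ν μ h α C₁ δ) (a : ℝ) : Measurable (klms μ a) := by
  apply Measurable.ite _ D.μmeas measurable_const
  exact (measurableSet_lt measurable_const measurable_abs).inter
    (measurableSet_lt measurable_abs measurable_const)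

lemma KlD.ml_meas (D : KlD ν μ h α C₁ δ) (a : ℝ) : Measurable (klml μ a) := by
  apply Measurable.ite _ D.μmeas measurable_const
  exact (measurableSet_le measurable_const measurable_abs)

lemma KlD.mf_meas (D : KlD ν μ h α C₁ δ) : Measurable (klmf μ) := by
  apply Measurable.ite _ D.μmeas measurable_const
  exact (measurableSet_lt measurable_const measurable_abs)

lemma KlD.ms_bd (D : KlD ν μ h α C₁ δ) (a y : ℝ) : 0 ≤ klms μ a y ∧ klms μ a y ≤ ν y := by
  unfold klms; split_ifs with hh
  · exact D.μbd' y hh.1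
  · exact ⟨le_rfl, D.ν0 y⟩

lemma KlD.ml_bd (D : KlD ν μ h α C₁ δ) {a : ℝ} (ha : 0 < a) (y : ℝ) :
    0 ≤ klml μ a y ∧ klml μ a y ≤ ν y := by
  unfold klml; split_ifs with hh
  · exact D.μbd' y (ha.trans_le hh)
  · exact ⟨le_rfl, D.ν0 y⟩

lemma KlD.mf_bd (D : KlD ν μ h α C₁ δ) (y : ℝ) : 0 ≤ klmf μ y ∧ klmf μ y ≤ ν y := by
  unfold klmf; split_ifs with hh
  · exact D.μbd' y hh
  · exact ⟨le_rfl, D.ν0 y⟩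

lemma kl_mf_eq {a : ℝ} (ha : 0 < a) (y : ℝ) : klmf μ y = klms μ a y + klml μ a y := by
  unfold klmf klms klml
  by_cases h1 : 0 < |y|
  · by_cases h2 : a ≤ |y|
    · simp [h1, h2, not_lt.2 h2]
    · simp only [h1, h2, true_and, if_true, if_false, not_le.1 h2, add_zero]
  · have : |y| < a := by linarith
    simp [h1, not_le.2 this]

lemma KlD.h_int (D : KlD ν μ h α C₁ δ) {r : ℝ} (hr : 0 < r) :
    Integrable (fun y : ℝ => min 1 (y ^ 2 / r ^ 2) * ν y) := by
  refine Integrable.mono' (D.νint.const_mul (1 + 1 / r ^ 2)) ?_ (ae_of_all _ fun y => ?_)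
  · apply Measurable.aestronglyMeasurable
    have : Continuous fun y : ℝ => min 1 (y ^ 2 / r ^ 2) := by fun_prop
    exact this.measurable.mul D.νmeas
  · have h0 : 0 ≤ min 1 (y ^ 2 / r ^ 2) := le_min zero_le_one (by positivity)
    rw [Real.norm_of_nonneg (mul_nonneg h0 (D.ν0 y)), ← mul_assoc]
    apply mul_le_mul_of_nonneg_right _ (D.ν0 y)
    have hi : 0 ≤ 1 / r ^ 2 := by positivity
    rcases le_total (y ^ 2) 1 with hh | hh
    · rw [min_eq_left hh]
      refine (min_le_right _ _).trans ?_
      rw [div_eq_mul_one_div]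
      nlinarith [sq_nonneg y]
    · rw [min_eq_right hh]
      refine (min_le_left _ _).trans ?_
      linarith

lemma KlD.h_scale (D : KlD ν μ h α C₁ δ) {r l : ℝ} (hr : 0 < r) (hl : 1 ≤ l) :
    h r ≤ l ^ 2 * h (l * r) := by
  have hl0 : 0 < l := by linarith
  rw [D.hdef r hr, D.hdef (l * r) (by positivity), ← integral_const_mul]
  refine integral_mono (D.h_int hr) ((D.h_int (by positivity)).const_mul _) fun y => ?_
  show min 1 (y ^ 2 / r ^ 2) * ν y ≤ l ^ 2 * (min 1 (y ^ 2 / (l * r) ^ 2) * ν y)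
  rw [← mul_assoc]
  apply mul_le_mul_of_nonneg_right _ (D.ν0 y)
  rw [mul_min_of_nonneg _ _ (by positivity)]
  apply min_le_min
  · nlinarith
  · apply le_of_eq; field_simp

lemma KlD.sq_int (D : KlD ν μ h α C₁ δ) {m : ℝ → ℝ} {R : ℝ} (hR0 : 0 < R) (hm : Measurable m)
    (hb : ∀ y, 0 ≤ m y ∧ m y ≤ ν y) (hR : ∀ y, R < |y| → m y = 0) :
    Integrable (fun y => y ^ 2 * m y) ∧ ∫ y, y ^ 2 * m y ≤ R ^ 2 * h R := by
  have hpt : ∀ y, y ^ 2 * m y ≤ R ^ 2 * (min 1 (y ^ 2 / R ^ 2) * ν y) := by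
    intro y
    by_cases hy : R < |y|
    · rw [hR y hy, mul_zero]
      have h0 : 0 ≤ min 1 (y ^ 2 / R ^ 2) := le_min zero_le_one (by positivity)
      have := D.ν0 y
      positivity
    · push Not at hy
      have h2 : y ^ 2 ≤ R ^ 2 := by rw [← sq_abs y]; gcongr
      rw [min_eq_right (by rw [div_le_one (by positivity)]; exact h2)]
      have : R ^ 2 * (y ^ 2 / R ^ 2 * ν y) = y ^ 2 * ν y := by field_simp
      rw [this]
      exact mul_le_mul_of_nonneg_left (hb y).2 (sq_nonneg _)
  have hi : Integrable (fun y => y ^ 2 * m y) := by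
    refine Integrable.mono' ((D.h_int hR0).const_mul (R ^ 2)) ?_ (ae_of_all _ fun y => ?_)
    · exact ((measurable_id.pow_const 2).mul hm).aestronglyMeasurable
    · rw [Real.norm_of_nonneg (mul_nonneg (sq_nonneg _) (hb y).1)]
      exact hpt y
  refine ⟨hi, ?_⟩
  rw [D.hdef R hR0, ← integral_const_mul]
  exact integral_mono hi ((D.h_int hR0).const_mul _) hpt

lemma KlD.ml_int (D : KlD ν μ h α C₁ δ) {a : ℝ} (ha : 0 < a) :
    Integrable (klml μ a) ∧ ∫ y, klml μ a y ≤ h a := by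
  have hpt : ∀ y, klml μ a y ≤ min 1 (y ^ 2 / a ^ 2) * ν y := by
    intro y
    by_cases hy : a ≤ |y|
    · have : (1:ℝ) ≤ y ^ 2 / a ^ 2 := by
        rw [le_div_iff₀ (by positivity), ← sq_abs y, one_mul]; gcongr
      rw [min_eq_left this, one_mul]
      exact (D.ml_bd ha y).2
    · have h0 : 0 ≤ min 1 (y ^ 2 / a ^ 2) := le_min zero_le_one (by positivity)
      have := mul_nonneg h0 (D.ν0 y)
      simpa [klml, hy] using this
  have hi : Integrable (klml μ a) := by
    refine Integrable.mono' (D.h_int ha) (D.ml_meas a).aestronglyMeasurable (ae_of_all _ fun y => ?_)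
    rw [Real.norm_of_nonneg (D.ml_bd ha y).1]
    exact hpt y
  refine ⟨hi, ?_⟩
  rw [D.hdef a ha]
  exact integral_mono hi (D.h_int ha) hpt

lemma kl_ms_supp (a y : ℝ) (hy : a < |y|) : klms μ a y = 0 := by
  unfold klms; rw [if_neg]; push Not; intro _; exact hy.le

lemma KlD.mf_supp (D : KlD ν μ h α C₁ δ) (y : ℝ) (hy : 2 * δ < |y|) : klmf μ y = 0 := by
  unfold klmf; split_ifs
  · rw [← D.μabs]; exact D.μzero _ hy.le
  · rfl

lemma KlD.K_bd (D : KlD ν μ h α C₁ δ) : ∃ cK > 0, ∀ s, 0 < s → s ≤ δ →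
    cK * s ^ 2 * h s ≤ ∫ y, y ^ 2 * klms μ s y := by
  obtain ⟨l, hl1, hl2⟩ : ∃ l : ℝ, 1 ≤ l ∧ 2 ≤ C₁ * l ^ α := by
    have := (tendsto_rpow_atTop D.hα).const_mul_atTop D.hC₁
    obtain ⟨l, h1, h2⟩ := ((this.eventually_ge_atTop 2).and (eventually_ge_atTop 1)).exists
    exact ⟨l, h2, h1⟩
  have hl0 : 0 < l := by linarith
  refine ⟨1 / l ^ 2, by positivity, fun s hs hsδ => ?_⟩
  set θ := s / l with hθ
  have hθ0 : 0 < θ := by positivity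
  have e1 : l * θ = s := by rw [hθ]; field_simp
  have h1 := D.lsc θ hθ0 l hl1
  rw [e1] at h1
  have h2 : 2 * h s ≤ h θ := le_trans (mul_le_mul_of_nonneg_right hl2 (D.hpos s hs).le) h1
  have h3 : h θ - h s ≤ (1 / θ ^ 2) * ∫ y, y ^ 2 * klms μ s y := by
    rw [D.hdef θ hθ0, D.hdef s hs, ← integral_sub (D.h_int hθ0) (D.h_int hs), ← integral_const_mul]
    refine integral_mono ((D.h_int hθ0).sub (D.h_int hs))
      ((D.sq_int hs (D.ms_meas s) (D.ms_bd s) (kl_ms_supp s)).1.const_mul _) fun y => ?_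
    show min 1 (y ^ 2 / θ ^ 2) * ν y - min 1 (y ^ 2 / s ^ 2) * ν y ≤ (1 / θ ^ 2) * (y ^ 2 * klms μ s y)
    have hn := D.ν0 y
    by_cases hy : |y| < s
    · by_cases hy0 : 0 < |y|
      · have : klms μ s y = ν y := by
          unfold klms; rw [if_pos ⟨hy0, hy⟩, ← D.μabs, ← D.νabs]; exact D.μeq _ hy0 (by linarith)
        rw [this]
        have h0 : 0 ≤ min 1 (y ^ 2 / s ^ 2) := le_min zero_le_one (by positivity)
        have h0' : min 1 (y ^ 2 / θ ^ 2) ≤ y ^ 2 / θ ^ 2 := min_le_right _ _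
        have q1 := mul_le_mul_of_nonneg_right h0' hn
        have q2 := mul_nonneg h0 hn
        have q3 : 1 / θ ^ 2 * (y ^ 2 * ν y) = y ^ 2 / θ ^ 2 * ν y := by ring
        linarith
      · have : y = 0 := by simpa using hy0
        subst this; simp
    · push Not at hy
      have : (1:ℝ) ≤ y ^ 2 / s ^ 2 := by
        rw [le_div_iff₀ (by positivity), ← sq_abs y, one_mul]; gcongr
      rw [min_eq_left this]
      have q0 := mul_le_mul_of_nonneg_right (min_le_left 1 (y ^ 2 / θ ^ 2)) hn
      have q1 := (D.ms_bd s y).1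
      have : 0 ≤ 1 / θ ^ 2 * (y ^ 2 * klms μ s y) := by positivity
      linarith
  have h4 : h s ≤ (1 / θ ^ 2) * ∫ y, y ^ 2 * klms μ s y := by linarith
  rw [hθ] at h4
  have : (1 / (s / l) ^ 2) * (∫ y, y ^ 2 * klms μ s y) = (l ^ 2 / s ^ 2) * ∫ y, y ^ 2 * klms μ s y := by
    field_simp
  rw [this] at h4
  calc 1 / l ^ 2 * s ^ 2 * h s ≤ 1 / l ^ 2 * s ^ 2 * ((l ^ 2 / s ^ 2) * ∫ y, y ^ 2 * klms μ s y) := by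
        gcongr
    _ = _ := by field_simp

lemma kl_cos_le {u : ℝ} (hu : |u| ≤ 1) : u ^ 2 / 4 ≤ 1 - Real.cos u := by
  have h := Real.cos_bound hu
  have h1 := (abs_le.1 h).2
  have h2 : |u| ^ 4 ≤ u ^ 2 := by
    have : |u| ^ 4 = u ^ 2 * u ^ 2 := by rw [← sq_abs u]; ring
    rw [this]
    have : u ^ 2 ≤ 1 := by rw [← sq_abs]; exact pow_le_one₀ (abs_nonneg _) hu
    nlinarith [sq_nonneg u]
  nlinarith

lemma kl_poly_exp {c α : ℝ} (hc : 0 < c) (hα : 0 < α) :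
    ∃ D > 0, ∀ u : ℝ, 1 ≤ u → Real.exp (-(c * u ^ α)) ≤ D * (1 / (1 + u) ^ 6) := by
  obtain ⟨n, hn⟩ := exists_nat_ge (6 / α)
  refine ⟨64 * (n.factorial / c ^ n), by positivity, fun u hu => ?_⟩
  have hu0 : 0 < u := by linarith
  have h1 := Real.pow_div_factorial_le_exp (c * u ^ α) (by positivity) n
  have h2 : u ^ 6 ≤ (u ^ α) ^ n := by
    rw [← Real.rpow_natCast (u ^ α), ← Real.rpow_mul hu0.le, ← Real.rpow_natCast u]
    apply Real.rpow_le_rpow_of_exponent_le hu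
    rw [div_le_iff₀ hα] at hn
    push_cast; linarith
  have h3 : (1 + u) ^ 6 ≤ 64 * u ^ 6 := by
    have : (1 + u) ^ 6 ≤ (2 * u) ^ 6 := by gcongr; linarith
    linarith [show (2 * u) ^ 6 = 64 * u ^ 6 by ring]
  rw [mul_one_div, le_div_iff₀ (by positivity), Real.exp_neg, inv_mul_le_iff₀ (Real.exp_pos _)]
  calc (1 + u) ^ 6 ≤ 64 * (u ^ α) ^ n := h3.trans (by gcongr)
    _ = (c * u ^ α) ^ n / n.factorial * (64 * (n.factorial / c ^ n)) := by
        rw [mul_pow]; field_simp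
    _ ≤ _ := by gcongr

lemma KlD.psi_nonneg {m : ℝ → ℝ} (hm0 : ∀ y, 0 ≤ m y) (ξ : ℝ) : 0 ≤ klPsi m ξ :=
  integral_nonneg fun y => mul_nonneg (by linarith [Real.cos_le_one (ξ * y)]) (hm0 y)

lemma KlD.decay (D : KlD ν μ h α C₁ δ) : ∃ D0 > 0, ∀ t a, 0 < t → 0 < a → a ≤ δ → 1 ≤ t * h a →
    ∀ ξ, Real.exp (-t * klPsi (klms μ a) ξ) ≤ D0 * (1 / (1 + a * |ξ|) ^ 6) := by
  obtain ⟨cK, hcK, hK⟩ := D.K_bd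
  have hC₁ := D.hC₁
  obtain ⟨D1, hD1, hexp⟩ := kl_poly_exp (c := cK * C₁ / 4) (α := α) (by positivity) D.hα
  refine ⟨D1 + 64, by positivity, fun t a ht ha haδ hta ξ => ?_⟩
  have hsI := D.sq_int ha (D.ms_meas a) (D.ms_bd a) (kl_ms_supp a)
  have hpos : 0 ≤ 1 / (1 + a * |ξ|) ^ 6 := by positivity
  by_cases hξ : 1 ≤ a * |ξ|
  · have hξ0 : 0 < |ξ| := by
      by_contra hh
      have : |ξ| = 0 := le_antisymm (not_lt.1 hh) (abs_nonneg _)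
      rw [this] at hξ; norm_num at hξ
    have hs0 : 0 < 1 / |ξ| := by positivity
    have hsa : 1 / |ξ| ≤ a := by rw [div_le_iff₀ hξ0]; exact hξ
    have k1 := hK (1 / |ξ|) hs0 (hsa.trans haδ)
    have hsI' := D.sq_int hs0 (D.ms_meas (1 / |ξ|)) (D.ms_bd _) (kl_ms_supp _)
    have k2 : ξ ^ 2 / 4 * ∫ y, y ^ 2 * klms μ (1 / |ξ|) y ≤ klPsi (klms μ a) ξ := by
      unfold klPsi
      rw [← integral_const_mul]
      refine integral_mono (hsI'.1.const_mul _)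
        (kl_cos_m_int (D.ms_meas a) (fun y => (D.ms_bd a y).1) hsI.1 ξ) fun y => ?_
      show ξ ^ 2 / 4 * (y ^ 2 * klms μ (1 / |ξ|) y) ≤ (1 - Real.cos (ξ * y)) * klms μ a y
      have q0 : 0 ≤ (1 - Real.cos (ξ * y)) * klms μ a y :=
        mul_nonneg (by linarith [Real.cos_le_one (ξ * y)]) (D.ms_bd a y).1
      by_cases hy : 0 < |y| ∧ |y| < 1 / |ξ|
      · have e1 : klms μ (1 / |ξ|) y = μ y := if_pos hy
        have e2 : klms μ a y = μ y := if_pos ⟨hy.1, hy.2.trans_le hsa⟩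
        rw [e1, e2]
        have hu : |ξ * y| ≤ 1 := by
          rw [abs_mul, mul_comm]
          exact ((lt_div_iff₀ hξ0).1 hy.2).le
        have := kl_cos_le hu
        have := mul_le_mul_of_nonneg_right this (D.μbd' y hy.1).1
        linarith [show ξ ^ 2 / 4 * (y ^ 2 * μ y) = (ξ * y) ^ 2 / 4 * μ y by ring]
      · have e1 : klms μ (1 / |ξ|) y = 0 := if_neg hy
        rw [e1]; simpa using q0
    have k3 := D.lsc (1 / |ξ|) hs0 (a * |ξ|) hξ
    have e3 : a * |ξ| * (1 / |ξ|) = a := by field_simp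
    rw [e3] at k3
    have k4 : cK / 4 * h (1 / |ξ|) ≤ klPsi (klms μ a) ξ := by
      refine le_trans ?_ k2
      calc cK / 4 * h (1 / |ξ|) = ξ ^ 2 / 4 * (cK * (1 / |ξ|) ^ 2 * h (1 / |ξ|)) := by
            rw [← sq_abs ξ]; field_simp
        _ ≤ _ := by gcongr
    have k5 : cK * C₁ / 4 * (a * |ξ|) ^ α ≤ t * klPsi (klms μ a) ξ := by
      calc cK * C₁ / 4 * (a * |ξ|) ^ α ≤ cK * C₁ / 4 * (a * |ξ|) ^ α * (t * h a) := by
            apply le_mul_of_one_le_right _ hta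
            positivity
        _ = t * (cK / 4 * (C₁ * (a * |ξ|) ^ α * h a)) := by ring
        _ ≤ t * (cK / 4 * h (1 / |ξ|)) := by gcongr
        _ ≤ _ := by gcongr
    calc _ ≤ Real.exp (-(cK * C₁ / 4 * (a * |ξ|) ^ α)) := Real.exp_le_exp.2 (by linarith)
      _ ≤ _ := hexp _ hξ
      _ ≤ _ := by gcongr; linarith
  · push Not at hξ
    have p0 := KlD.psi_nonneg (fun y => (D.ms_bd a y).1) ξ
    have p1 : Real.exp (-t * klPsi (klms μ a) ξ) ≤ 1 := by
      rw [Real.exp_le_one_iff]; nlinarith [mul_nonneg ht.le p0]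
    refine p1.trans ?_
    rw [mul_one_div, le_div_iff₀ (by positivity), one_mul]
    have : (1 + a * |ξ|) ^ 6 ≤ 2 ^ 6 := by gcongr; linarith
    linarith

lemma KlD.psi_split (D : KlD ν μ h α C₁ δ) {a : ℝ} (ha : 0 < a) (ξ : ℝ) :
    klPsi (klmf μ) ξ = klPsi (klms μ a) ξ + klPsi (klml μ a) ξ := by
  unfold klPsi
  have hsI := D.sq_int ha (D.ms_meas a) (D.ms_bd a) (kl_ms_supp a)
  rw [← integral_add (kl_cos_m_int (D.ms_meas a) (fun y => (D.ms_bd a y).1) hsI.1 ξ)]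
  · congr 1; ext y; rw [kl_mf_eq ha y]; ring
  · refine ((D.ml_int ha).1.const_mul 2).mono' ?_ (ae_of_all _ fun y => ?_)
    · apply Measurable.aestronglyMeasurable
      have : Continuous fun y : ℝ => 1 - Real.cos (ξ * y) := by fun_prop
      exact this.measurable.mul (D.ml_meas a)
    · have h1 := Real.cos_le_one (ξ * y)
      have h2 := Real.neg_one_le_cos (ξ * y)
      have h3 := (D.ml_bd ha y).1
      rw [Real.norm_of_nonneg (mul_nonneg (by linarith) h3)]
      gcongr; linarith

lemma KlD.mu_le (D : KlD ν μ h α C₁ δ) {x : ℝ} (hx : 0 < x) : μ x ≤ 8 * h x / x := by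
  have h1 : ∫ y in Set.Ioc (x / 2) x, (1 / 4 * μ x) ≤ h x := by
    rw [D.hdef x hx]
    refine le_trans ?_ (setIntegral_le_integral (s := Set.Ioc (x / 2) x) (D.h_int hx)
      (ae_of_all _ fun y => ?_))
    · refine setIntegral_mono_on ?_ (D.h_int hx).integrableOn measurableSet_Ioc fun y hy => ?_
      · exact integrableOn_const (by simp)
      · have hy0 : 0 < y := by linarith [hy.1]
        have e1 : 1 / 4 ≤ y ^ 2 / x ^ 2 := by
          rw [le_div_iff₀ (by positivity)]; nlinarith [hy.1]
        have e2 : μ x ≤ ν y := (D.μanti y x hy0 hy.2).trans (D.μbd y hy0).2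
        exact mul_le_mul (le_min (by norm_num) e1) e2 (D.μbd x hx).1
          (le_min zero_le_one (by positivity))
    · exact mul_nonneg (le_min zero_le_one (by positivity)) (D.ν0 y)
  rw [setIntegral_const] at h1
  simp only [Real.volume_real_Ioc, smul_eq_mul] at h1
  rw [max_eq_left (by linarith)] at h1
  rw [le_div_iff₀ hx]
  linarith

end

open Classical in
noncomputable def klf (h : ℝ → ℝ) (t a x : ℝ) : ℝ :=
  if x = 0 then 1 / a else min (1 / a) (t * h |x| / |x|)

section
variable {ν μ h : ℝ → ℝ} {α C₁ δ : ℝ}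

lemma KlD.f_nonneg (D : KlD ν μ h α C₁ δ) {t a : ℝ} (ht : 0 < t) (ha : 0 < a) (x : ℝ) :
    0 ≤ klf h t a x := by
  unfold klf; split_ifs with hx
  · positivity
  · have := D.hpos |x| (abs_pos.2 hx)
    exact le_min (by positivity) (by positivity)

lemma kl_f_le {t a : ℝ} (x : ℝ) : klf h t a x ≤ 1 / a := by
  unfold klf; split_ifs with hx
  · exact le_rfl
  · exact min_le_left _ _

lemma KlD.f_half (D : KlD ν μ h α C₁ δ) {t a : ℝ} (ht : 0 < t) (ha : 0 < a) {x z : ℝ}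
    (hz : |x| / 2 ≤ |z|) : klf h t a z ≤ 8 * klf h t a x := by
  have h1 : klf h t a z ≤ 8 * (1 / a) := (kl_f_le z).trans (by
    have : 0 < 1 / a := by positivity
    linarith)
  by_cases hx : x = 0
  · have : klf h t a x = 1 / a := if_pos hx
    rw [this]; exact h1
  · have hx0 : 0 < |x| := abs_pos.2 hx
    have hz0 : 0 < |z| := by linarith
    have e1 : klf h t a x = min (1 / a) (t * h |x| / |x|) := if_neg hx
    have e2 : klf h t a z ≤ t * h |z| / |z| := by
      rw [klf, if_neg (abs_pos.1 hz0)]; exact min_le_right _ _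
    rw [e1, mul_min_of_nonneg _ _ (by norm_num)]
    refine le_min h1 (e2.trans ?_)
    have h2 := D.hanti (|x| / 2) |z| (by positivity) hz
    have h3 := D.h_scale (r := |x| / 2) (l := 2) (by positivity) (by norm_num)
    rw [show 2 * (|x| / 2) = |x| by ring] at h3
    have hp := D.hpos |x| hx0
    calc t * h |z| / |z| ≤ t * (2 ^ 2 * h |x|) / (|x| / 2) := by
          gcongr; exact h2.trans h3
      _ = _ := by field_simp; ring

lemma KlD.f_exp (D : KlD ν μ h α C₁ δ) {t a : ℝ} (ht : 0 < t) (ha : 0 < a) (hta : 1 ≤ t * h a)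
    (x : ℝ) : Real.exp (-(|x| / a)) * (1 / a) ≤ 6 * klf h t a x := by
  have h1 : Real.exp (-(|x| / a)) * (1 / a) ≤ 6 * (1 / a) := by
    gcongr
    have : Real.exp (-(|x| / a)) ≤ 1 := by
      rw [Real.exp_le_one_iff, neg_nonpos]; positivity
    linarith
  by_cases hx : x = 0
  · have : klf h t a x = 1 / a := if_pos hx
    rw [this]; exact h1
  · have hx0 : 0 < |x| := abs_pos.2 hx
    have e1 : klf h t a x = min (1 / a) (t * h |x| / |x|) := if_neg hx
    rw [e1, mul_min_of_nonneg _ _ (by norm_num)]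
    refine le_min h1 ?_
    set u := |x| / a with hu
    have hu0 : 0 < u := by positivity
    have ex : |x| = u * a := by rw [hu]; field_simp
    have key : Real.exp (-u) * u ≤ 6 * (t * h |x|) := by
      rw [Real.exp_neg, inv_mul_le_iff₀ (Real.exp_pos _)]
      rcases le_total u 1 with h2 | h2
      · have : h a ≤ h |x| := D.hanti _ _ hx0 (by rw [ex]; nlinarith)
        have h3 : 1 ≤ t * h |x| := hta.trans (by gcongr)
        have h4 : 1 ≤ Real.exp u := Real.one_le_exp hu0.le
        nlinarith
      · have h3 := D.h_scale ha h2
        rw [← ex] at h3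
        have h4 : 1 ≤ u ^ 2 * (t * h |x|) := by
          calc 1 ≤ t * h a := hta
            _ ≤ t * (u ^ 2 * h |x|) := by gcongr
            _ = _ := by ring
        have h5 := Real.pow_div_factorial_le_exp u hu0.le 3
        have h6 : u ^ 3 ≤ 6 * Real.exp u := by
          have e : ((Nat.factorial 3 : ℕ) : ℝ) = 6 := by norm_num [Nat.factorial]
          rw [e] at h5; linarith
        have hp := mul_pos ht (D.hpos |x| hx0)
        calc u ≤ u * (u ^ 2 * (t * h |x|)) := le_mul_of_one_le_right hu0.le h4
          _ = u ^ 3 * (t * h |x|) := by ring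
          _ ≤ 6 * Real.exp u * (t * h |x|) := by gcongr
          _ = _ := by ring
    calc Real.exp (-u) * (1 / a) = Real.exp (-u) * u / |x| := by rw [ex]; field_simp
      _ ≤ 6 * (t * h |x|) / |x| := by gcongr
      _ = _ := by ring

lemma KlD.f_mu (D : KlD ν μ h α C₁ δ) {t a L : ℝ} (ht : 0 < t) (ha : 0 < a) (hL : 1 ≤ L)
    (hta : t * h a ≤ L) {y : ℝ} (hy : a ≤ |y|) : t * μ y ≤ 8 * L * klf h t a y := by
  have hy0 : 0 < |y| := by linarith
  have e1 : klf h t a y = min (1 / a) (t * h |y| / |y|) := if_neg (abs_pos.1 hy0)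
  have h1 := D.mu_le hy0
  rw [D.μabs] at h1
  have hp := D.hpos _ hy0
  have h2 : t * μ y ≤ 8 * (t * h |y| / |y|) := by
    calc t * μ y ≤ t * (8 * h |y| / |y|) := by gcongr
      _ = _ := by ring
  have h4 : 0 ≤ t * h |y| / |y| := by positivity
  rw [e1, mul_min_of_nonneg _ _ (by positivity)]
  refine le_min (h2.trans ?_) (h2.trans (by nlinarith))
  have h3 : t * h |y| / |y| ≤ L / a := by
    have : t * h |y| ≤ L := le_trans (by gcongr; exact D.hanti _ _ ha hy) hta
    gcongr
  calc _ ≤ 8 * (L / a) := by gcongr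
    _ = _ := by ring

lemma KlD.f_jap (D : KlD ν μ h α C₁ δ) {t a L : ℝ} (ht : 0 < t) (ha : 0 < a) (hL : 1 ≤ L)
    (hta : t * h a ≤ L) (x : ℝ) :
    klf h t a x ≤ ((1 + L / C₁) * 2 ^ (1 + α)) * (1 / a * (1 + ‖x / a‖) ^ (-(1 + α))) := by
  have hC := D.hC₁
  have hα := D.hα
  set u := ‖x / a‖ with hu
  have hu0 : 0 ≤ u := norm_nonneg _
  have eu : u = |x| / a := by rw [hu, norm_div, Real.norm_eq_abs, Real.norm_of_nonneg ha.le]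
  have h2p : (0:ℝ) < 2 ^ (1 + α) := by positivity
  have hLC : 0 < L / C₁ := by positivity
  rcases le_total u 1 with h1 | h1
  · refine (kl_f_le x).trans ?_
    have : (1 + u) ^ (1 + α) ≤ 2 ^ (1 + α) :=
      Real.rpow_le_rpow (by positivity) (by linarith) (by positivity)
    have h3 : 1 ≤ 2 ^ (1 + α) * (1 + u) ^ (-(1 + α)) := by
      rw [Real.rpow_neg (by positivity), ← div_eq_mul_inv, le_div_iff₀ (by positivity), one_mul]
      exact this
    have h4 : 1 ≤ (1 + L / C₁) * (2 ^ (1 + α) * (1 + u) ^ (-(1 + α))) := by nlinarith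
    calc 1 / a ≤ 1 / a * ((1 + L / C₁) * (2 ^ (1 + α) * (1 + u) ^ (-(1 + α)))) :=
          le_mul_of_one_le_right (by positivity) h4
      _ = _ := by ring
  · have hup : 0 < u := by linarith
    have ex : |x| = u * a := by rw [eu]; field_simp
    have hx0 : 0 < |x| := by rw [ex]; positivity
    have e2 : klf h t a x ≤ t * h |x| / |x| := by
      rw [klf, if_neg (abs_pos.1 hx0)]; exact min_le_right _ _
    refine e2.trans ?_
    have h2 := D.lsc a ha u h1
    rw [← ex] at h2
    have h3 : t * h |x| ≤ L / C₁ * u ^ (-α) := by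
      rw [Real.rpow_neg hup.le, ← div_eq_mul_inv, div_div, le_div_iff₀ (by positivity)]
      calc t * h |x| * (C₁ * u ^ α) = t * (C₁ * u ^ α * h |x|) := by ring
        _ ≤ t * h a := by gcongr
        _ ≤ L := hta
    have h4 : u ^ (-(1 + α)) ≤ 2 ^ (1 + α) * (1 + u) ^ (-(1 + α)) := by
      rw [Real.rpow_neg hup.le, Real.rpow_neg (by positivity), ← div_eq_mul_inv,
        le_div_iff₀ (by positivity), inv_mul_le_iff₀ (by positivity), ← Real.mul_rpow hup.le (by norm_num)]
      exact Real.rpow_le_rpow (by positivity) (by linarith) (by positivity)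
    have h5 : u ^ (-α) / u = u ^ (-(1 + α)) := by
      rw [show -(1 + α) = -α - 1 by ring, Real.rpow_sub_one hup.ne']
    calc t * h |x| / |x| ≤ L / C₁ * u ^ (-α) / (u * a) := by rw [← ex]; gcongr
      _ = L / C₁ * (1 / a) * (u ^ (-α) / u) := by field_simp
      _ = L / C₁ * (1 / a) * u ^ (-(1 + α)) := by rw [h5]
      _ ≤ (1 + L / C₁) * (1 / a) * (2 ^ (1 + α) * (1 + u) ^ (-(1 + α))) := by gcongr; linarith
      _ = _ := by ring

lemma kl_jap_int {α a : ℝ} (hα : 0 < α) (ha : 0 < a) :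
    Integrable (fun x : ℝ => 1 / a * (1 + ‖x / a‖) ^ (-(1 + α))) ∧
    ∫ x : ℝ, 1 / a * (1 + ‖x / a‖) ^ (-(1 + α)) = ∫ u : ℝ, (1 + ‖u‖) ^ (-(1 + α)) := by
  have h1 : Integrable (fun u : ℝ => (1 + ‖u‖) ^ (-(1 + α))) :=
    integrable_one_add_norm (by simp [hα])
  refine ⟨(h1.comp_div ha.ne').const_mul _, ?_⟩
  rw [integral_const_mul, MeasureTheory.Measure.integral_comp_div (fun u : ℝ => (1 + ‖u‖) ^ (-(1 + α))) a,
    abs_of_pos ha, smul_eq_mul]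
  field_simp

lemma kl_G_cont {Φ : ℝ → ℂ} (hΦ : Measurable Φ) {k : ℕ} (hI : Integrable fun ξ => |ξ| ^ k * ‖Φ ξ‖) :
    Continuous (klG Φ k) := by
  unfold klG
  refine continuous_of_dominated (bound := fun ξ => |ξ| ^ k * ‖Φ ξ‖) (fun x => ?_)
    (fun x => ae_of_all _ fun ξ => ?_) hI (ae_of_all _ fun ξ => ?_)
  · apply Measurable.aestronglyMeasurable
    have : Continuous fun ξ : ℝ => (ξ * Complex.I) ^ k * Complex.exp (x * (ξ * Complex.I)) := by fun_prop
    exact this.measurable.mul hΦ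
  · have : (x:ℂ) * (ξ * Complex.I) = ((x * ξ : ℝ) : ℂ) * Complex.I := by push_cast; ring
    rw [norm_mul, norm_mul, this, Complex.norm_exp_ofReal_mul_I]
    simp
  · fun_prop

lemma kl_G_conv {Φ : ℝ → ℂ} (hΦ : Measurable Φ) {k : ℕ} (hI : Integrable fun ξ => |ξ| ^ k * ‖Φ ξ‖)
    {m : ℝ → ℝ} (hm : Integrable m) {mc : ℝ → ℝ}
    (hmc : ∀ ξ : ℝ, (mc ξ : ℂ) = ∫ y : ℝ, (m y : ℂ) * Complex.exp (-(y * (ξ * Complex.I)))) (x : ℝ) :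
    klG (fun ξ => mc ξ * Φ ξ) k x = ∫ y : ℝ, (m y : ℂ) * klG Φ k (x - y) := by
  unfold klG
  have hI' : Integrable (fun ξ : ℝ => (ξ * Complex.I) ^ k * Complex.exp (x * (ξ * Complex.I)) * Φ ξ) := by
    refine hI.mono' ?_ (ae_of_all _ fun ξ => ?_)
    · apply Measurable.aestronglyMeasurable
      have : Continuous fun ξ : ℝ => (ξ * Complex.I) ^ k * Complex.exp (x * (ξ * Complex.I)) := by fun_prop
      exact this.measurable.mul hΦ
    · have : (x:ℂ) * (ξ * Complex.I) = ((x * ξ : ℝ) : ℂ) * Complex.I := by push_cast; ring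
      rw [norm_mul, norm_mul, this, Complex.norm_exp_ofReal_mul_I]
      simp
  have hprod := (hm.ofReal (𝕜 := ℂ)).mul_prod hI'
  have hprod2 : Integrable (Function.uncurry fun (y ξ : ℝ) =>
      (m y : ℂ) * ((ξ * Complex.I) ^ k * Complex.exp ((x - y : ℝ) * (ξ * Complex.I)) * Φ ξ))
      (volume.prod volume) := by
    have hb := hprod.bdd_mul (c := 1)
      (f := fun p : ℝ × ℝ => Complex.exp (((-(p.1 * p.2) : ℝ) : ℂ) * Complex.I)) ?_ ?_
    · refine hb.congr (ae_of_all _ fun p => ?_)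
      rcases p with ⟨y, ξ⟩
      simp only [Function.uncurry_apply_pair]
      have : Complex.exp ((x - y : ℝ) * (ξ * Complex.I)) =
          Complex.exp (((-(y * ξ) : ℝ) : ℂ) * Complex.I) * Complex.exp (x * (ξ * Complex.I)) := by
        rw [← Complex.exp_add]; congr 1; push_cast; ring
      rw [this]
      simp only [RCLike.ofReal, Complex.coe_algebraMap]
      ring
    · apply Continuous.aestronglyMeasurable; fun_prop
    · exact ae_of_all _ fun p => by rw [Complex.norm_exp_ofReal_mul_I]
  have sw := integral_integral_swap hprod2
  simp only [integral_const_mul] at sw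
  rw [sw]
  congr 1
  ext ξ
  beta_reduce
  rw [hmc ξ]
  have : ∀ y : ℝ, (m y : ℂ) * ((ξ * Complex.I) ^ k * Complex.exp ((x - y : ℝ) * (ξ * Complex.I)) * Φ ξ)
      = ((m y : ℂ) * Complex.exp (-(y * (ξ * Complex.I)))) *
        ((ξ * Complex.I) ^ k * Complex.exp (x * (ξ * Complex.I)) * Φ ξ) := by
    intro y
    have : Complex.exp ((x - y : ℝ) * (ξ * Complex.I)) =
          Complex.exp (-(y * (ξ * Complex.I))) * Complex.exp (x * (ξ * Complex.I)) := by
        rw [← Complex.exp_add]; congr 1; push_cast; ring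
    rw [this]; ring
  simp only [this]
  rw [integral_mul_const]
  ring

lemma kl_psi_meas {m : ℝ → ℝ} (hm : Measurable m) : Measurable (klPsi m) := by
  have : StronglyMeasurable (Function.uncurry fun ξ y : ℝ => (1 - Real.cos (ξ * y)) * m y) := by
    apply Measurable.stronglyMeasurable
    have h1 : Continuous fun p : ℝ × ℝ => 1 - Real.cos (p.1 * p.2) := by fun_prop
    exact h1.measurable.mul (hm.comp measurable_snd)
  exact this.integral_prod_right.measurable

lemma kl_mc_eq {m : ℝ → ℝ} (hm : Integrable m) (hsymm : ∀ y, m (-y) = m y) (ξ : ℝ) :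
    (((∫ y, m y) - klPsi m ξ : ℝ) : ℂ) = ∫ y : ℝ, (m y : ℂ) * Complex.exp (-(y * (ξ * Complex.I))) := by
  have hcos : Integrable fun y => Real.cos (ξ * y) * m y := by
    refine hm.bdd_mul (c := 1) ?_ (ae_of_all _ fun y => ?_)
    · apply Continuous.aestronglyMeasurable; fun_prop
    · exact Real.abs_cos_le_one _
  have hsin : Integrable fun y => Real.sin (ξ * y) * m y := by
    refine hm.bdd_mul (c := 1) ?_ (ae_of_all _ fun y => ?_)
    · apply Continuous.aestronglyMeasurable; fun_prop
    · exact Real.abs_sin_le_one _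
  have h1 : (∫ y, m y) - klPsi m ξ = ∫ y, Real.cos (ξ * y) * m y := by
    unfold klPsi
    have : (fun y => (1 - Real.cos (ξ * y)) * m y) = fun y => m y - Real.cos (ξ * y) * m y := by
      ext y; ring
    rw [this, integral_sub hm hcos]; ring
  have h2 : ∫ y, Real.sin (ξ * y) * m y = 0 := by
    have h3 := integral_neg_eq_self (fun y => Real.sin (ξ * y) * m y) volume
    simp only [mul_neg, Real.sin_neg, hsymm, neg_mul] at h3
    rw [integral_neg] at h3
    linarith
  rw [h1]
  have h4 : ∀ y : ℝ, (m y : ℂ) * Complex.exp (-(y * (ξ * Complex.I))) =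
      ((Real.cos (ξ * y) * m y : ℝ) : ℂ) - ((Real.sin (ξ * y) * m y : ℝ) : ℂ) * Complex.I := by
    intro y
    have : -((y:ℂ) * (ξ * Complex.I)) = ((-(ξ * y) : ℝ) : ℂ) * Complex.I := by push_cast; ring
    rw [this, Complex.exp_mul_I, ← Complex.ofReal_cos, ← Complex.ofReal_sin, Real.cos_neg, Real.sin_neg]
    push_cast; ring
  simp only [h4]
  rw [integral_sub hcos.ofReal (hsin.ofReal.mul_const _), integral_mul_const, integral_complex_ofReal,
    integral_complex_ofReal, h2]
  simp

lemma KlD.conv_bd (D : KlD ν μ h α C₁ δ) {t a L A : ℝ} (ht : 0 < t) (ha : 0 < a) (hL : 1 ≤ L)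
    (hta : t * h a ≤ L) (hA : 0 ≤ A) {F : ℝ → ℂ} (hF : Continuous F)
    (hFb : ∀ z, ‖F z‖ ≤ A * klf h t a z) (x : ℝ) :
    ‖∫ y : ℝ, (klml μ a y : ℂ) * F (x - y)‖ ≤
      A * ((64 * L * (((1 + L / C₁) * 2 ^ (1 + α)) * ∫ u : ℝ, (1 + ‖u‖) ^ (-(1 + α))) + 8 * L) / t)
        * klf h t a x := by
  have hC := D.hC₁
  set CJ := (1 + L / C₁) * 2 ^ (1 + α) with hCJ
  set J := ∫ u : ℝ, (1 + ‖u‖) ^ (-(1 + α)) with hJ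
  have hj := kl_jap_int D.hα ha
  have hFj : ∀ z, ‖F z‖ ≤ A * CJ * (1 / a * (1 + ‖z / a‖) ^ (-(1 + α))) := fun z => by
    refine (hFb z).trans ?_
    rw [mul_assoc]
    exact mul_le_mul_of_nonneg_left (D.f_jap ht ha hL hta z) hA
  have hFI : Integrable F :=
    (hj.1.const_mul (A * CJ)).mono' hF.aestronglyMeasurable (ae_of_all _ hFj)
  have hFn : ∫ z, ‖F z‖ ≤ A * CJ * J := by
    rw [hJ, ← hj.2, ← integral_const_mul]
    exact integral_mono hFI.norm (hj.1.const_mul _) hFj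
  have hFx : Integrable fun y => ‖F (x - y)‖ := (hFI.comp_sub_left x).norm
  have hFxe : ∫ y, ‖F (x - y)‖ = ∫ y, ‖F y‖ := integral_sub_left_eq_self (fun y => ‖F y‖) volume x
  have hml := D.ml_int ha
  have hfx := D.f_nonneg ht ha x
  calc _ ≤ ∫ y, (64 * L / t * klf h t a x * ‖F (x - y)‖ + 8 * A * klf h t a x * klml μ a y) := by
        refine norm_integral_le_of_norm_le ((hFx.const_mul _).add (hml.1.const_mul _))
          (ae_of_all _ fun y => ?_)
        have m0 := (D.ml_bd ha y).1
        rw [norm_mul, Complex.norm_real, Real.norm_of_nonneg m0]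
        by_cases hy : a ≤ |y|
        · by_cases hxy : |x| / 2 ≤ |y|
          · have e1 : klml μ a y = μ y := if_pos hy
            have q1 := D.f_mu ht ha hL hta hy
            have q2 := D.f_half ht ha hxy
            have q3 : klml μ a y ≤ 64 * L / t * klf h t a x := by
              rw [e1, div_mul_eq_mul_div, le_div_iff₀ ht]
              nlinarith
            have q4 : 0 ≤ 8 * A * klf h t a x * klml μ a y := by positivity
            have := mul_le_mul_of_nonneg_right q3 (norm_nonneg (F (x - y)))
            linarith
          · have hxy' : |x| / 2 ≤ |x - y| := by
              have := abs_sub_abs_le_abs_sub x y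
              linarith
            have q2 := D.f_half (t := t) ht ha hxy'
            have q3 : ‖F (x - y)‖ ≤ 8 * A * klf h t a x := by
              refine (hFb _).trans ?_
              nlinarith
            have q4 : 0 ≤ 64 * L / t * klf h t a x * ‖F (x - y)‖ := by positivity
            have := mul_le_mul_of_nonneg_left q3 m0
            linarith
        · have e1 : klml μ a y = 0 := if_neg hy
          rw [e1]
          have q4 : 0 ≤ 64 * L / t * klf h t a x * ‖F (x - y)‖ := by positivity
          linarith
    _ = 64 * L / t * klf h t a x * (∫ y, ‖F y‖) + 8 * A * klf h t a x * ∫ y, klml μ a y := by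
        rw [integral_add (hFx.const_mul _) (hml.1.const_mul _), integral_const_mul,
          integral_const_mul, hFxe]
    _ ≤ 64 * L / t * klf h t a x * (A * CJ * J) + 8 * A * klf h t a x * (L / t) := by
        have : ∫ y, klml μ a y ≤ L / t := by
          rw [le_div_iff₀ ht]; nlinarith [hml.2]
        gcongr
    _ = _ := by ring

lemma kl_phi_int {m : ℝ → ℝ} (hm : Measurable m)
    {t a D : ℝ} (ha : 0 < a) (hD : 0 ≤ D)
    (hdec : ∀ ξ, Real.exp (-t * klPsi m ξ) ≤ D * (1 / (1 + a * |ξ|) ^ 6)) {k : ℕ} (hk : k ≤ 2) :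
    Integrable fun ξ : ℝ => |ξ| ^ k * ‖(Real.exp (-t * klPsi m ξ) : ℂ)‖ := by
  refine ((kl_int_inv ha).const_mul (D * (1 / a) ^ k)).mono' ?_ (ae_of_all _ fun ξ => ?_)
  · apply Measurable.aestronglyMeasurable
    have := kl_psi_meas hm
    fun_prop
  · rw [Real.norm_of_nonneg (by positivity), Complex.norm_real, Real.norm_of_nonneg (Real.exp_pos _).le]
    have := kl_poly_bd (κ := 0) (ξ := ξ) ha hk
    simp only [abs_zero, zero_add, mul_zero, add_zero, one_pow, mul_one] at this
    calc _ ≤ |ξ| ^ k * (D * (1 / (1 + a * |ξ|) ^ 6)) := by gcongr; exact hdec ξ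
      _ = D * (|ξ| ^ k * (1 / (1 + a * |ξ|) ^ 6)) := by ring
      _ ≤ D * ((1 / a) ^ k * (1 + (a * ξ) ^ 2)⁻¹) := by gcongr
      _ = _ := by ring

lemma KlD.middle (D : KlD ν μ h α C₁ δ) {L : ℝ} (hL : 1 ≤ L) : ∃ C > 0, ∀ t a, 0 < t → 0 < a →
    a ≤ δ → 1 ≤ t * h a → t * h a ≤ L → ∀ k ≤ 2, ∀ x : ℝ,
    ‖klG (fun ξ => (Real.exp (-t * klPsi (klmf μ) ξ) : ℂ)) k x‖ ≤ C * (1 / a) ^ k * klf h t a x := by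
  obtain ⟨D0, hD0, hdec0⟩ := D.decay
  have hC := D.hC₁
  have hJ : 0 ≤ ∫ u : ℝ, (1 + ‖u‖) ^ (-(1 + α)) := integral_nonneg fun u => by positivity
  set K := 64 * L * (((1 + L / C₁) * 2 ^ (1 + α)) * ∫ u : ℝ, (1 + ‖u‖) ^ (-(1 + α))) + 8 * L with hK
  have hK0 : 0 ≤ K := by positivity
  refine ⟨6 * Real.exp (Real.exp 1 * L) * (D0 * Real.pi * 4) * Real.exp K, by positivity, ?_⟩
  intro t a ht ha haδ hta1 hta k hk x
  have hdec := hdec0 t a ht ha haδ hta1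
  set Φ : ℝ → ℂ := fun ξ => (Real.exp (-t * klPsi (klms μ a) ξ) : ℂ) with hΦ
  have hpm := kl_psi_meas (D.ms_meas a)
  have hΦm : Measurable Φ := by rw [hΦ]; fun_prop
  have hΦI : Integrable fun ξ => |ξ| ^ k * ‖Φ ξ‖ := kl_phi_int (D.ms_meas a) ha hD0.le hdec hk
  set lam := ∫ y, klml μ a y with hlam
  have hml := D.ml_int ha
  have hlam0 : 0 ≤ lam := integral_nonneg fun y => (D.ml_bd ha y).1
  set mc : ℝ → ℝ := fun ξ => lam - klPsi (klml μ a) ξ with hmc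
  have hmcm : Measurable mc := measurable_const.sub (kl_psi_meas (D.ml_meas a))
  have hsymm : ∀ y, klml μ a (-y) = klml μ a y := by
    intro y; unfold klml; rw [abs_neg, D.μsymm]
  have hmce := fun ξ => kl_mc_eq hml.1 hsymm ξ
  have hmcb : ∀ ξ, |mc ξ| ≤ lam := by
    intro ξ
    have e := hmce ξ
    have : ‖((mc ξ : ℝ) : ℂ)‖ ≤ ∫ y, klml μ a y := by
      rw [hmc]; simp only
      rw [e]
      refine norm_integral_le_of_norm_le hml.1 (ae_of_all _ fun y => ?_)
      have e2 : -((y:ℂ) * (ξ * Complex.I)) = ((-(ξ * y) : ℝ) : ℂ) * Complex.I := by push_cast; ring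
      rw [norm_mul, e2, Complex.norm_exp_ofReal_mul_I, Complex.norm_real,
        Real.norm_of_nonneg (D.ml_bd ha y).1, mul_one]
    simpa [Complex.norm_real] using this
  set A := 6 * Real.exp (Real.exp 1 * L) * (D0 * Real.pi * 4) * (1 / a) ^ k with hA
  have hA0 : 0 ≤ A := by positivity
  -- base estimate
  have base : ∀ x, ‖klG Φ k x‖ ≤ A * klf h t a x := by
    intro x
    have hsI := D.sq_int ha (D.ms_meas a) (D.ms_bd a) (kl_ms_supp a)
    obtain ⟨κ, hκ1, hκ2⟩ : ∃ κ : ℝ, |κ| = 1 / a ∧ κ * x = -(|x| / a) := by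
      rcases le_total 0 x with hx | hx
      · refine ⟨-(1 / a), by rw [abs_neg, abs_of_pos (by positivity)], by rw [abs_of_nonneg hx]; ring⟩
      · refine ⟨1 / a, by rw [abs_of_pos (by positivity)], by rw [abs_of_nonpos hx]; ring⟩
    have es := kl_esscher (D.ms_meas a) (fun y => (D.ms_bd a y).1) (kl_ms_supp a) ha.le hsI.1 ht ha
      hD0.le hdec κ x hk
    rw [hκ2, ← sq_abs κ, hκ1] at es
    refine es.trans ?_
    have e1 : 1 / a * a = 1 := by field_simp
    have e2 : a * (1 / a) = 1 := by field_simp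
    rw [e1, e2]
    have b1 : t * ((1 / a) ^ 2 * Real.exp 1 * ∫ y, y ^ 2 * klms μ a y) ≤ Real.exp 1 * L := by
      calc _ ≤ t * ((1 / a) ^ 2 * Real.exp 1 * (a ^ 2 * h a)) := by gcongr; exact hsI.2
        _ = Real.exp 1 * (t * h a) := by field_simp
        _ ≤ _ := by gcongr
    have b2 : ((1:ℝ) + 1) ^ k ≤ 4 := by
      calc ((1:ℝ) + 1) ^ k ≤ (1 + 1) ^ 2 := pow_le_pow_right₀ (by norm_num) hk
        _ = 4 := by norm_num
    have b3 := D.f_exp ht ha hta1 x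
    calc _ ≤ Real.exp (-(|x| / a)) * Real.exp (Real.exp 1 * L) *
          (D0 * Real.pi * (1 / a) ^ (k + 1) * 4) := by gcongr
      _ = (Real.exp (-(|x| / a)) * (1 / a)) * (Real.exp (Real.exp 1 * L) *
          (D0 * Real.pi * (1 / a) ^ k * 4)) := by rw [pow_succ]; ring
      _ ≤ (6 * klf h t a x) * (Real.exp (Real.exp 1 * L) *
          (D0 * Real.pi * (1 / a) ^ k * 4)) := by gcongr
      _ = _ := by rw [hA]; ring
  -- iteration
  have hnm : ∀ n : ℕ, Measurable fun ξ => (mc ξ : ℂ) ^ n * Φ ξ := fun n => by fun_prop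
  have hnI : ∀ n : ℕ, Integrable fun ξ => |ξ| ^ k * ‖(mc ξ : ℂ) ^ n * Φ ξ‖ := fun n => by
    refine (hΦI.const_mul (lam ^ n)).mono' ?_ (ae_of_all _ fun ξ => ?_)
    · apply Measurable.aestronglyMeasurable; fun_prop
    · rw [Real.norm_of_nonneg (by positivity), norm_mul, norm_pow, Complex.norm_real, Real.norm_eq_abs]
      calc _ ≤ |ξ| ^ k * (lam ^ n * ‖Φ ξ‖) := by gcongr; exact hmcb ξ
        _ = _ := by ring
  have iter : ∀ n : ℕ, ∀ x, ‖klG (fun ξ => (mc ξ : ℂ) ^ n * Φ ξ) k x‖ ≤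
      A * (K / t) ^ n * klf h t a x := by
    intro n
    induction n with
    | zero => intro x; simpa using base x
    | succ n ih =>
      intro x
      have e : (fun ξ => (mc ξ : ℂ) ^ (n + 1) * Φ ξ) = fun ξ => (mc ξ : ℂ) * ((mc ξ : ℂ) ^ n * Φ ξ) := by
        ext ξ; ring
      rw [e, kl_G_conv (hnm n) (hnI n) hml.1 hmce x]
      refine (D.conv_bd ht ha hL hta (by positivity) (kl_G_cont (hnm n) (hnI n)) ih x).trans ?_
      rw [← hK, pow_succ]
      apply le_of_eq; ring
  -- summation
  have hexp : ∀ ξ, (Real.exp (-t * klPsi (klmf μ) ξ) : ℂ) =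
      (Real.exp (-(t * lam)) : ℂ) * ((Real.exp (t * mc ξ) : ℂ) * Φ ξ) := by
    intro ξ
    rw [hΦ]
    simp only
    rw [← Complex.ofReal_mul, ← Complex.ofReal_mul, ← Real.exp_add, ← Real.exp_add, D.psi_split ha, hmc]
    congr 2
    ring
  set P : ℕ → ℝ → ℂ := fun n ξ =>
    (ξ * Complex.I) ^ k * Complex.exp (x * (ξ * Complex.I)) * ((t * mc ξ : ℂ) ^ n / n.factorial * Φ ξ) with hP
  have hPi : ∀ n, ∫ ξ, P n ξ = (t:ℂ) ^ n / n.factorial * klG (fun ξ => (mc ξ : ℂ) ^ n * Φ ξ) k x := by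
    intro n
    rw [klG, ← integral_const_mul]
    congr 1; ext ξ
    rw [hP]; simp only; rw [mul_pow]; ring
  have hPn : ∀ n ξ, ‖P n ξ‖ ≤ (t * lam) ^ n / n.factorial * (|ξ| ^ k * ‖Φ ξ‖) := by
    intro n ξ
    have e2 : (x:ℂ) * (ξ * Complex.I) = ((x * ξ : ℝ) : ℂ) * Complex.I := by push_cast; ring
    have e3 : ‖P n ξ‖ = |ξ| ^ k * ((t * |mc ξ|) ^ n / n.factorial * ‖Φ ξ‖) := by
      rw [hP]
      simp only [norm_mul, norm_pow, norm_div, e2, Complex.norm_exp_ofReal_mul_I, Complex.norm_real,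
        Complex.norm_I, mul_one, Real.norm_eq_abs, abs_of_pos ht, Complex.norm_natCast]
    rw [e3]
    calc _ ≤ |ξ| ^ k * ((t * lam) ^ n / n.factorial * ‖Φ ξ‖) := by gcongr; exact hmcb ξ
      _ = _ := by ring
  have hPI : ∀ n, Integrable (P n) := fun n => by
    refine (hΦI.const_mul ((t * lam) ^ n / n.factorial)).mono' ?_ (ae_of_all _ (hPn n))
    apply Measurable.aestronglyMeasurable
    rw [hP]; fun_prop
  have hsum : Summable fun n => ∫ ξ, ‖P n ξ‖ := by
    refine Summable.of_nonneg_of_le (fun n => integral_nonneg fun ξ => norm_nonneg _)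
      (fun n => integral_mono (hPI n).norm (hΦI.const_mul _) (hPn n)) ?_
    simp only [integral_const_mul]
    exact (Real.summable_pow_div_factorial (t * lam)).mul_right _
  have hHS := MeasureTheory.hasSum_integral_of_summable_integral_norm hPI hsum
  have hfin : klG (fun ξ => (Real.exp (-t * klPsi (klmf μ) ξ) : ℂ)) k x =
      (Real.exp (-(t * lam)) : ℂ) * ∫ ξ, ∑' n, P n ξ := by
    rw [klG, ← integral_const_mul]
    congr 1; ext ξ
    rw [hexp ξ]
    have hs : HasSum (fun n => P n ξ) ((ξ * Complex.I) ^ k * Complex.exp (x * (ξ * Complex.I)) *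
        (Complex.exp (t * mc ξ) * Φ ξ)) := by
      have := NormedSpace.expSeries_div_hasSum_exp ((t:ℂ) * mc ξ)
      rw [← Complex.exp_eq_exp_ℂ] at this
      exact (this.mul_right (Φ ξ)).mul_left _
    rw [hs.tsum_eq]
    push_cast
    ring
  have hbd : ‖∑' n, ∫ ξ, P n ξ‖ ≤ A * klf h t a x * Real.exp K := by
    have hs : HasSum (fun n : ℕ => A * klf h t a x * (K ^ n / n.factorial))
        (A * klf h t a x * Real.exp K) := by
      have := NormedSpace.expSeries_div_hasSum_exp K
      rw [← Real.exp_eq_exp_ℝ] at this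
      exact this.mul_left _
    refine tsum_of_norm_bounded hs fun n => ?_
    rw [hPi n, norm_mul, norm_div, norm_pow, Complex.norm_real, Real.norm_of_nonneg ht.le, Complex.norm_natCast]
    calc _ ≤ t ^ n / n.factorial * (A * (K / t) ^ n * klf h t a x) := by gcongr; exact iter n x
      _ = _ := by rw [div_pow]; field_simp
  rw [hfin, ← hHS.tsum_eq, norm_mul, Complex.norm_real, Real.norm_of_nonneg (Real.exp_pos _).le]
  have h1 : Real.exp (-(t * lam)) ≤ 1 := by
    rw [Real.exp_le_one_iff, neg_nonpos]; positivity
  calc _ ≤ 1 * (A * klf h t a x * Real.exp K) := by gcongr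
    _ = _ := by rw [hA]; ring

end

lemma kl_G_deriv {Φ : ℝ → ℂ} (hΦ : Measurable Φ) {k : ℕ} (hI : Integrable fun ξ => |ξ| ^ k * ‖Φ ξ‖)
    (hI' : Integrable fun ξ => |ξ| ^ (k + 1) * ‖Φ ξ‖) (x : ℝ) :
    HasDerivAt (klG Φ k) (klG Φ (k + 1) x) x := by
  have hmeas : ∀ (j : ℕ) (x : ℝ), AEStronglyMeasurable
      (fun ξ : ℝ => (ξ * Complex.I) ^ j * Complex.exp (x * (ξ * Complex.I)) * Φ ξ) volume := by
    intro j x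
    apply Measurable.aestronglyMeasurable
    have : Continuous fun ξ : ℝ => (ξ * Complex.I) ^ j * Complex.exp (x * (ξ * Complex.I)) := by fun_prop
    exact this.measurable.mul hΦ
  have hn : ∀ (j : ℕ) (x ξ : ℝ), ‖(ξ * Complex.I) ^ j * Complex.exp (x * (ξ * Complex.I)) * Φ ξ‖
      = |ξ| ^ j * ‖Φ ξ‖ := by
    intro j x ξ
    rw [norm_mul, norm_mul, norm_pow, norm_mul, Complex.norm_I, mul_one, Complex.norm_real,
      show (x : ℂ) * (ξ * Complex.I) = ((x * ξ : ℝ) : ℂ) * Complex.I by push_cast; ring,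
      Complex.norm_exp_ofReal_mul_I, mul_one, Real.norm_eq_abs]
  unfold klG
  refine (hasDerivAt_integral_of_dominated_loc_of_deriv_le (bound := fun ξ => |ξ| ^ (k + 1) * ‖Φ ξ‖)
    (F' := fun x ξ => (ξ * Complex.I) ^ (k + 1) * Complex.exp (x * (ξ * Complex.I)) * Φ ξ)
    (Metric.ball_mem_nhds x one_pos) (Eventually.of_forall fun y => hmeas k y) ?_ (hmeas _ x)
    (ae_of_all _ fun ξ y _ => (hn _ y ξ).le) hI' (ae_of_all _ fun ξ y _ => ?_)).2
  · exact hI.mono' (hmeas k x) (ae_of_all _ fun ξ => (hn _ x ξ).le)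
  · have h1 : HasDerivAt (fun y : ℝ => (y : ℂ) * (ξ * Complex.I)) (1 * (ξ * Complex.I)) y :=
      (HasDerivAt.ofReal_comp (hasDerivAt_id y)).mul_const _
    have h2 := ((h1.cexp).const_mul ((ξ * Complex.I) ^ k)).mul_const (Φ ξ)
    exact h2.congr_deriv (by ring)

lemma kl_log_bd {s c δ : ℝ} (hs : 1 ≤ s) (hc : 0 < c) (hδ : 0 < δ) :
    1 + 1 / (8 * δ) * Real.log s ≤ (1 + 1 / (8 * δ * c)) * s ^ c := by
  have h1 : Real.log s ≤ s ^ c / c := Real.log_le_rpow_div (by linarith) hc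
  have h2 : 1 ≤ s ^ c := Real.one_le_rpow hs hc.le
  have h3 : 1 / (8 * δ) * Real.log s ≤ 1 / (8 * δ) * (s ^ c / c) := by gcongr
  have h4 : 1 / (8 * δ) * (s ^ c / c) = 1 / (8 * δ * c) * s ^ c := by field_simp
  nlinarith

section
variable {ν μ h : ℝ → ℝ} {α C₁ δ : ℝ}

lemma KlD.decay' (D : KlD ν μ h α C₁ δ) : ∃ D0 > 0, ∀ t a, 0 < t → 0 < a → a ≤ δ → 1 ≤ t * h a →
    ∀ ξ, Real.exp (-t * klPsi (klmf μ) ξ) ≤ D0 * (1 / (1 + a * |ξ|) ^ 6) := by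
  obtain ⟨D0, hD0, hd⟩ := D.decay
  refine ⟨D0, hD0, fun t a ht ha haδ hta ξ => le_trans ?_ (hd t a ht ha haδ hta ξ)⟩
  have := KlD.psi_nonneg (fun y => (D.ml_bd ha y).1) ξ
  rw [D.psi_split ha]
  apply Real.exp_le_exp.2
  nlinarith

lemma KlD.scale (D : KlD ν μ h α C₁ δ) {hinv : ℝ → ℝ} {τ : ℝ} (hτ : 0 < τ)
    (hinvpos : ∀ s : ℝ, 0 < s → 0 < hinv s)
    (hinvr : ∀ s : ℝ, 0 < s → h (hinv s) = s) :
    ∃ c0 > 0, c0 ≤ 1 ∧ ∃ Ca > 0, ∀ t, 0 < t → t ≤ τ → c0 * hinv (1 / t) ≤ δ ∧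
      1 ≤ t * h (c0 * hinv (1 / t)) ∧ t * h (c0 * hinv (1 / t)) ≤ (1 / c0) ^ 2 ∧
      1 / (c0 * hinv (1 / t)) ≤ Ca * (τ / t) ^ (1 / α) := by
  have hα := D.hα
  have hC₁ := D.hC₁
  have hδ := D.hδ
  set R0 := hinv (1 / τ) with hR0
  have hR0p : 0 < R0 := hinvpos _ (by positivity)
  have hR0h : h R0 = 1 / τ := hinvr _ (by positivity)
  refine ⟨min 1 (δ / R0), by positivity, min_le_left _ _, 1 / min 1 (δ / R0) * (1 / R0) * (1 / C₁) ^ (1 / α),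
    by positivity, fun t ht htτ => ?_⟩
  set c0 := min 1 (δ / R0) with hc0
  have hc0p : 0 < c0 := by positivity
  have hc01 : c0 ≤ 1 := min_le_left _ _
  set r := hinv (1 / t) with hr
  have hrp : 0 < r := hinvpos _ (by positivity)
  have hrh : h r = 1 / t := hinvr _ (by positivity)
  have hrR : r ≤ R0 := by
    by_contra hh
    push Not at hh
    have h1 := D.hanti R0 r hR0p hh.le
    rw [hrh, hR0h] at h1
    have h2 : t = τ := le_antisymm htτ ((one_div_le_one_div ht hτ).1 h1)
    rw [hr, hR0, h2] at hh
    exact lt_irrefl _ hh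
  refine ⟨?_, ?_, ?_, ?_⟩
  · calc c0 * r ≤ δ / R0 * R0 := by gcongr; exact min_le_right _ _
      _ = δ := by field_simp
  · have := D.hanti (c0 * r) r (by positivity) (by nlinarith)
    rw [hrh] at this
    calc (1:ℝ) = t * (1 / t) := by field_simp
      _ ≤ _ := by gcongr
  · have := D.h_scale (r := c0 * r) (l := 1 / c0) (by positivity) (by rw [le_div_iff₀ hc0p]; linarith)
    rw [show 1 / c0 * (c0 * r) = r by field_simp, hrh] at this
    calc t * h (c0 * r) ≤ t * ((1 / c0) ^ 2 * (1 / t)) := by gcongr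
      _ = _ := by field_simp
  · have h1 := D.lsc r hrp (R0 / r) (by rw [le_div_iff₀ hrp]; linarith)
    rw [show R0 / r * r = R0 by field_simp, hR0h, hrh] at h1
    have h2 : (R0 / r) ^ α ≤ 1 / C₁ * (τ / t) := by
      rw [show 1 / C₁ * (τ / t) = (1 / t) * (τ / C₁) by field_simp]
      calc (R0 / r) ^ α = (C₁ * (R0 / r) ^ α * (1 / τ)) * (τ / C₁) := by field_simp
        _ ≤ _ := by gcongr
    have h3 : R0 / r ≤ (1 / C₁) ^ (1 / α) * (τ / t) ^ (1 / α) := by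
      rw [← Real.mul_rpow (by positivity) (by positivity)]
      calc R0 / r = ((R0 / r) ^ α) ^ (1 / α) := by
            rw [← Real.rpow_mul (by positivity), mul_one_div_cancel hα.ne', Real.rpow_one]
        _ ≤ _ := Real.rpow_le_rpow (by positivity) h2 (by positivity)
    calc 1 / (c0 * r) = 1 / c0 * (1 / R0) * (R0 / r) := by field_simp
      _ ≤ 1 / c0 * (1 / R0) * ((1 / C₁) ^ (1 / α) * (τ / t) ^ (1 / α)) := by gcongr
      _ = _ := by ring

lemma KlD.far (D : KlD ν μ h α C₁ δ) {τ ε p Q : ℝ} (hτ : 0 < τ) (hQ : Q ≤ ε / (8 * δ))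
    (hQp : Q = p + 3 / α) {Ca : ℝ} (hCa : 0 < Ca) :
    ∃ C > 0, ∀ t a, 0 < t → t ≤ τ → 0 < a → a ≤ δ → 1 ≤ t * h a →
      1 / a ≤ Ca * (τ / t) ^ (1 / α) → ∀ k ≤ 2, ∀ x, ε ≤ |x| →
      ‖klG (fun ξ => (Real.exp (-t * klPsi (klmf μ) ξ) : ℂ)) k x‖ ≤
        C * ((τ / t) ^ (1 / α)) ^ k * ((τ / t) ^ (-p) * Real.exp (-|x|)) := by
  have hα := D.hα
  have hδ := D.hδ
  obtain ⟨D0, hD0, hdec⟩ := D.decay'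
  have hM := D.sq_int (R := 2 * δ) (by positivity) D.mf_meas D.mf_bd D.mf_supp
  set M := ∫ y, y ^ 2 * klmf μ y with hMdef
  have hM0 : 0 ≤ M := integral_nonneg fun y => mul_nonneg (sq_nonneg _) (D.mf_bd y).1
  set K4 := 1 + 1 / (8 * δ * (1 / 4)) with hK4
  set Ka := 1 + 1 / (8 * δ * (1 / α)) with hKa
  have hK4p : 0 < K4 := by positivity
  have hKap : 0 < Ka := by positivity
  set E := Real.exp (τ * (K4 ^ 2 * Real.exp (2 * δ) * M)) with hE
  refine ⟨E * (D0 * Real.pi * Ca * (1 + (Ca + Ka)) ^ 2), by positivity,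
    fun t a ht htτ ha haδ hta hCaa k hk x hx => ?_⟩
  set s := τ / t with hs
  have hs1 : 1 ≤ s := by rw [hs, le_div_iff₀ ht]; linarith
  have hs0 : 0 < s := by linarith
  have hl0 : 0 ≤ Real.log s := Real.log_nonneg hs1
  set κ := 1 + 1 / (8 * δ) * Real.log s with hκ
  have hκ1 : 1 ≤ κ := by
    have : 0 ≤ 1 / (8 * δ) * Real.log s := by positivity
    linarith
  have hκ4 : κ ≤ K4 * s ^ (1 / 4 : ℝ) := kl_log_bd hs1 (by norm_num) hδ
  have hκa : κ ≤ Ka * s ^ (1 / α) := kl_log_bd hs1 (by positivity) hδ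
  obtain ⟨κ', hκ'abs, hκ'x⟩ : ∃ κ' : ℝ, |κ'| = κ ∧ κ' * x = -(κ * |x|) := by
    rcases le_total 0 x with h0 | h0
    · exact ⟨-κ, by rw [abs_neg, abs_of_nonneg (by linarith)], by rw [abs_of_nonneg h0]; ring⟩
    · exact ⟨κ, by rw [abs_of_nonneg (by linarith)], by rw [abs_of_nonpos h0]; ring⟩
  have key := kl_esscher D.mf_meas (fun y => (D.mf_bd y).1) D.mf_supp (by positivity) hM.1 ht ha hD0.le
    (hdec t a ht ha haδ hta) κ' x hk
  rw [← hMdef, hκ'abs, hκ'x, ← sq_abs κ', hκ'abs] at key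
  refine key.trans ?_
  have hx0 : 0 ≤ |x| := abs_nonneg x
  have f1 : Real.exp (-(κ * |x|)) ≤ Real.exp (-|x|) * s ^ (-Q) := by
    rw [Real.rpow_def_of_pos hs0, ← Real.exp_add]
    apply Real.exp_le_exp.2
    have h1 : Q ≤ |x| / (8 * δ) := hQ.trans (by gcongr)
    have h2 : Real.log s * Q ≤ Real.log s * (|x| / (8 * δ)) := by gcongr
    have h3 : κ * |x| = |x| + Real.log s * (|x| / (8 * δ)) := by rw [hκ]; ring
    linarith
  have f2 : Real.exp (t * (κ ^ 2 * Real.exp (κ * (2 * δ)) * M)) ≤ E := by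
    apply Real.exp_le_exp.2
    have e1 : Real.exp (κ * (2 * δ)) = Real.exp (2 * δ) * s ^ (1 / 4 : ℝ) := by
      rw [Real.rpow_def_of_pos hs0, ← Real.exp_add]
      congr 1
      rw [hκ]; field_simp; ring
    have e2 : s ^ (1 / 4 : ℝ) * (s ^ (1 / 4 : ℝ)) ^ 2 ≤ s := by
      rw [← Real.rpow_natCast, ← Real.rpow_mul hs0.le, ← Real.rpow_add hs0]
      calc _ ≤ s ^ (1:ℝ) := Real.rpow_le_rpow_of_exponent_le hs1 (by norm_num)
        _ = s := Real.rpow_one s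
    have e3 : t * s = τ := by rw [hs]; field_simp
    rw [e1]
    calc t * (κ ^ 2 * (Real.exp (2 * δ) * s ^ (1 / 4 : ℝ)) * M)
        ≤ t * ((K4 * s ^ (1 / 4 : ℝ)) ^ 2 * (Real.exp (2 * δ) * s ^ (1 / 4 : ℝ)) * M) := by gcongr
      _ = (t * (s ^ (1 / 4 : ℝ) * (s ^ (1 / 4 : ℝ)) ^ 2)) * (K4 ^ 2 * Real.exp (2 * δ) * M) := by ring
      _ ≤ (t * s) * (K4 ^ 2 * Real.exp (2 * δ) * M) := by gcongr
      _ = _ := by rw [e3]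
  set w := s ^ (1 / α) with hw
  have hw1 : 1 ≤ w := Real.one_le_rpow hs1 (by positivity)
  have f3 : D0 * Real.pi * (1 / a) ^ (k + 1) * (1 + a * κ) ^ k ≤
      D0 * Real.pi * Ca * (1 + (Ca + Ka)) ^ 2 * (w ^ k * w) := by
    have e1 : (1 / a) ^ (k + 1) * (1 + a * κ) ^ k = 1 / a * (1 / a + κ) ^ k := by
      rw [pow_succ', mul_assoc, ← mul_pow]; congr 2; field_simp
    have hpi := Real.pi_pos
    calc _ = D0 * Real.pi * ((1 / a) ^ (k + 1) * (1 + a * κ) ^ k) := by ring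
      _ = D0 * Real.pi * (1 / a * (1 / a + κ) ^ k) := by rw [e1]
      _ ≤ D0 * Real.pi * ((Ca * w) * (Ca * w + Ka * w) ^ k) := by gcongr
      _ = D0 * Real.pi * Ca * (Ca + Ka) ^ k * (w ^ k * w) := by rw [← add_mul, mul_pow]; ring
      _ ≤ _ := by
        gcongr
        calc (Ca + Ka) ^ k ≤ (1 + (Ca + Ka)) ^ k := pow_le_pow_left₀ (by positivity) (by linarith) k
          _ ≤ _ := pow_le_pow_right₀ (by linarith) hk
  have f4 : s ^ (-Q) * w ≤ s ^ (-p) := by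
    rw [hw, ← Real.rpow_add hs0]
    apply Real.rpow_le_rpow_of_exponent_le hs1
    have : 0 < 1 / α := by positivity
    rw [hQp, show 3 / α = 3 * (1 / α) by ring]
    linarith
  have hpi := Real.pi_pos
  calc _ ≤ (Real.exp (-|x|) * s ^ (-Q)) * E * (D0 * Real.pi * Ca * (1 + (Ca + Ka)) ^ 2 * (w ^ k * w)) := by
        gcongr
    _ = E * (D0 * Real.pi * Ca * (1 + (Ca + Ka)) ^ 2) * w ^ k * ((s ^ (-Q) * w) * Real.exp (-|x|)) := by ring
    _ ≤ _ := by gcongr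

lemma KlD.tg_pos (D : KlD ν μ h α C₁ δ) {hinv : ℝ → ℝ} {τ ε p t : ℝ} (hτ : 0 < τ) (hε : 0 < ε)
    (hinvpos : ∀ s : ℝ, 0 < s → 0 < hinv s) (ht : 0 < t) (x : ℝ) : 0 ≤ tg h hinv τ ε p t x := by
  have h1 := hinvpos (1 / t) (by positivity)
  have h2 := hinvpos (1 / τ) (by positivity)
  have h3 := D.hpos ε hε
  unfold tg
  split_ifs with hx hx'
  · positivity
  · have := D.hpos |x| (abs_pos.2 hx); positivity
  · positivity

lemma KlD.tg_bdd (D : KlD ν μ h α C₁ δ) {hinv : ℝ → ℝ} {τ ε p t : ℝ} (hτ : 0 < τ) (hε : 0 < ε)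
    (hinvpos : ∀ s : ℝ, 0 < s → 0 < hinv s) (ht : 0 < t) : ∃ K, ∀ x, tg h hinv τ ε p t x ≤ K := by
  have h1 := hinvpos (1 / t) (by positivity)
  have h2 := hinvpos (1 / τ) (by positivity)
  have h3 := D.hpos ε hε
  refine ⟨1 / hinv (1 / t) + min (1 / hinv (1 / τ)) (τ * h ε / ε) * Real.exp ε / τ ^ p * (t ^ p * 1), fun x => ?_⟩
  have hA : 0 ≤ min (1 / hinv (1 / τ)) (τ * h ε / ε) * Real.exp ε / τ ^ p * (t ^ p * 1) := by positivity
  have hB : 0 ≤ 1 / hinv (1 / t) := by positivity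
  unfold tg
  split_ifs with hx hx'
  · linarith
  · exact (min_le_left _ _).trans (by linarith)
  · have : Real.exp (-|x|) ≤ 1 := by rw [Real.exp_le_one_iff]; linarith [abs_nonneg x]
    calc _ ≤ min (1 / hinv (1 / τ)) (τ * h ε / ε) * Real.exp ε / τ ^ p * (t ^ p * 1) := by gcongr
      _ ≤ _ := by linarith

lemma KlD.key (D : KlD ν μ h α C₁ δ) {hinv : ℝ → ℝ} {τ ε p : ℝ} (hτ : 0 < τ) (hε : 0 < ε)
    (hinvpos : ∀ s : ℝ, 0 < s → 0 < hinv s)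
    (hinvr : ∀ s : ℝ, 0 < s → h (hinv s) = s) (hQ : p + 3 / α ≤ ε / (8 * δ)) :
    ∃ C > 0, ∀ t, 0 < t → t ≤ τ →
      (∀ k ≤ 2, Integrable fun ξ : ℝ => |ξ| ^ k * ‖(Real.exp (-t * klPsi (klmf μ) ξ) : ℂ)‖) ∧
      ∀ k ≤ 2, ∀ x, ‖klG (fun ξ => (Real.exp (-t * klPsi (klmf μ) ξ) : ℂ)) k x‖ ≤
        C * ((τ / t) ^ (1 / α)) ^ k * tg h hinv τ ε p t x := by
  have hα := D.hα
  obtain ⟨c0, hc0, hc01, Ca, hCa, hsc⟩ := D.scale hτ hinvpos hinvr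
  obtain ⟨D0, hD0, hdec⟩ := D.decay'
  obtain ⟨C, hC, hfar⟩ := D.far hτ hQ rfl hCa
  obtain ⟨C', hC', hmid⟩ := D.middle (L := (1 / c0) ^ 2)
    (one_le_pow₀ (by rw [le_div_iff₀ hc0]; linarith))
  have h2 := hinvpos (1 / τ) (by positivity)
  have h3 := D.hpos ε hε
  set cc := min (1 / hinv (1 / τ)) (τ * h ε / ε) * Real.exp ε with hcc
  have hccp : 0 < cc := by positivity
  refine ⟨C / cc + C' * (1 + Ca) ^ 2 * (1 / c0), by positivity, fun t ht htτ => ?_⟩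
  obtain ⟨s1, s2, s3, s4⟩ := hsc t ht htτ
  have h1 := hinvpos (1 / t) (by positivity)
  set r := hinv (1 / t) with hr
  have hap : 0 < c0 * r := by positivity
  have hw0 : 0 < (τ / t) ^ (1 / α) := by positivity
  refine ⟨fun k hk => kl_phi_int D.mf_meas hap hD0.le (hdec t _ ht hap s1 s2) hk, fun k hk x => ?_⟩
  have htg := D.tg_pos (p := p) hτ hε hinvpos ht x
  by_cases hx : ε ≤ |x|
  · refine (hfar t _ ht htτ hap s1 s2 s4 k hk x hx).trans ?_
    have hx0 : x ≠ 0 := by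
      rintro rfl; rw [abs_zero] at hx; linarith
    have e : (τ / t) ^ (-p) * Real.exp (-|x|) = 1 / cc * tg h hinv τ ε p t x := by
      rw [tg, if_neg hx0, if_neg (not_lt.2 hx), ← hcc, Real.rpow_neg (by positivity),
        Real.div_rpow hτ.le ht.le]
      field_simp
    rw [e]
    calc _ = C / cc * ((τ / t) ^ (1 / α)) ^ k * tg h hinv τ ε p t x := by ring
      _ ≤ _ := by
        gcongr
        have : 0 < C' * (1 + Ca) ^ 2 * (1 / c0) := by positivity
        linarith
  · push Not at hx
    refine (hmid t _ ht hap s1 s2 s3 k hk x).trans ?_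
    have hf : klf h t (c0 * r) x ≤ 1 / c0 * tg h hinv τ ε p t x := by
      have hc1 : 1 ≤ 1 / c0 := by rw [le_div_iff₀ hc0]; linarith
      unfold klf tg
      split_ifs with h0
      · rw [← hr]; apply le_of_eq; field_simp
      · have hh := D.hpos |x| (abs_pos.2 h0)
        have hh' := abs_pos.2 h0
        rw [mul_min_of_nonneg _ _ (by positivity), ← hr]
        refine min_le_min (le_of_eq (by field_simp)) (le_mul_of_one_le_left (by positivity) hc1)
    have hf0 := D.f_nonneg ht hap x
    calc C' * (1 / (c0 * r)) ^ k * klf h t (c0 * r) x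
        ≤ C' * (Ca * (τ / t) ^ (1 / α)) ^ k * (1 / c0 * tg h hinv τ ε p t x) := by gcongr
      _ = (C' * Ca ^ k * (1 / c0)) * ((τ / t) ^ (1 / α)) ^ k * tg h hinv τ ε p t x := by
        rw [mul_pow]; ring
      _ ≤ _ := by
        gcongr
        have e1 : Ca ^ k ≤ (1 + Ca) ^ 2 := calc
          Ca ^ k ≤ (1 + Ca) ^ k := by gcongr; linarith
          _ ≤ _ := pow_le_pow_right₀ (by linarith) hk
        have : 0 < C / cc := by positivity
        have : C' * Ca ^ k * (1 / c0) ≤ C' * (1 + Ca) ^ 2 * (1 / c0) := by gcongr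
        linarith

lemma KlD.key' (D : KlD ν μ h α C₁ δ) {hinv ψ : ℝ → ℝ} {g : ℝ → ℝ → ℝ} {τ ε p : ℝ} (hτ : 0 < τ) (hε : 0 < ε)
    (hinvpos : ∀ s : ℝ, 0 < s → 0 < hinv s)
    (hinvr : ∀ s : ℝ, 0 < s → h (hinv s) = s) (hQ : p + 3 / α ≤ ε / (8 * δ))
    (hψ : ∀ ξ : ℝ, ψ ξ = ∫ x : ℝ, (1 - Real.cos (ξ * x)) * μ x)
    (hg : ∀ t : ℝ, 0 < t → ∀ x : ℝ,
      g t x = (2 * Real.pi)⁻¹ * ∫ ξ : ℝ, Real.cos (x * ξ) * Real.exp (-t * ψ ξ)) :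
    ∃ C > 0, ∀ t, 0 < t → t ≤ τ → ∃ g' g'' : ℝ → ℝ, ∀ x,
      HasDerivAt (g t) (g' x) x ∧ HasDerivAt g' (g'' x) x ∧
      |g t x| ≤ C * tg h hinv τ ε p t x ∧
      |g' x| ≤ C * (τ / t) ^ (1 / α) * tg h hinv τ ε p t x ∧
      |g'' x| ≤ C * ((τ / t) ^ (1 / α)) ^ 2 * tg h hinv τ ε p t x := by
  obtain ⟨C, hC, hk⟩ := D.key hτ hε hinvpos hinvr hQ
  refine ⟨C, hC, fun t ht htτ => ?_⟩
  obtain ⟨hI, hb⟩ := hk t ht htτ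
  set Φ : ℝ → ℂ := fun ξ => (Real.exp (-t * klPsi (klmf μ) ξ) : ℂ) with hΦ
  have hΦm : Measurable Φ := by
    have := kl_psi_meas D.mf_meas
    exact Complex.measurable_ofReal.comp (Real.measurable_exp.comp (this.const_mul (-t)))
  have hψ' : ∀ ξ, ψ ξ = klPsi (klmf μ) ξ := by
    intro ξ
    rw [hψ, klPsi]
    congr 1; ext y
    unfold klmf
    split_ifs with hy
    · rfl
    · have : y = 0 := abs_eq_zero.1 (le_antisymm (not_lt.1 hy) (abs_nonneg _))
      simp [this]
  have hge : ∀ x, g t x = (2 * Real.pi)⁻¹ * (klG Φ 0 x).re := by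
    intro x
    rw [hg t ht x]
    congr 1
    have hint : Integrable fun ξ : ℝ => ((ξ : ℂ) * Complex.I) ^ 0 * Complex.exp (x * (ξ * Complex.I)) * Φ ξ := by
      refine (hI 0 (by norm_num)).mono' ?_ (ae_of_all _ fun ξ => ?_)
      · apply Measurable.aestronglyMeasurable
        have : Continuous fun ξ : ℝ => ((ξ : ℂ) * Complex.I) ^ 0 * Complex.exp (x * (ξ * Complex.I)) := by fun_prop
        exact this.measurable.mul hΦm
      · rw [norm_mul, norm_mul, pow_zero, pow_zero, norm_one, one_mul,
          show (x : ℂ) * (ξ * Complex.I) = ((x * ξ : ℝ) : ℂ) * Complex.I by push_cast; ring,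
          Complex.norm_exp_ofReal_mul_I]
    have := integral_re hint
    unfold klG
    rw [show (∫ ξ : ℝ, ((ξ : ℂ) * Complex.I) ^ 0 * Complex.exp (x * (ξ * Complex.I)) * Φ ξ).re
      = RCLike.re (∫ ξ : ℝ, ((ξ : ℂ) * Complex.I) ^ 0 * Complex.exp (x * (ξ * Complex.I)) * Φ ξ) from rfl, ← this]
    congr 1; ext ξ
    show _ = (((ξ : ℂ) * Complex.I) ^ 0 * Complex.exp (x * (ξ * Complex.I)) * Φ ξ).re
    rw [pow_zero, one_mul, hΦ, show (x : ℂ) * (ξ * Complex.I) = ((x * ξ : ℝ) : ℂ) * Complex.I by push_cast; ring,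
      Complex.re_mul_ofReal, Complex.exp_ofReal_mul_I_re, hψ']
  have hpi : (2 * Real.pi)⁻¹ ≤ 1 := inv_le_one_of_one_le₀ (by linarith [Real.pi_gt_three])
  have hpi0 : 0 < (2 * Real.pi)⁻¹ := by have := Real.pi_pos; positivity
  have hbd : ∀ k x, |(2 * Real.pi)⁻¹ * (klG Φ k x).re| ≤ ‖klG Φ k x‖ := by
    intro k x
    rw [abs_mul, abs_of_pos hpi0]
    calc _ ≤ 1 * ‖klG Φ k x‖ := by gcongr; exact Complex.abs_re_le_norm _
      _ = _ := one_mul _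
  have hder : ∀ k, k + 1 ≤ 2 → ∀ x, HasDerivAt (fun x => (2 * Real.pi)⁻¹ * (klG Φ k x).re)
      ((2 * Real.pi)⁻¹ * (klG Φ (k + 1) x).re) x := by
    intro k hk x
    have h1 := kl_G_deriv hΦm (hI k (by omega)) (hI (k + 1) hk) x
    have h2 := Complex.reCLM.hasFDerivAt.comp_hasDerivAt x h1
    exact h2.const_mul _
  refine ⟨fun x => (2 * Real.pi)⁻¹ * (klG Φ 1 x).re, fun x => (2 * Real.pi)⁻¹ * (klG Φ 2 x).re, fun x =>
    ⟨?_, hder 1 (by norm_num) x, ?_, ?_, ?_⟩⟩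
  · rw [show g t = fun x => (2 * Real.pi)⁻¹ * (klG Φ 0 x).re from funext hge]
    exact hder 0 (by norm_num) x
  · rw [hge]
    exact (hbd 0 x).trans ((hb 0 (by norm_num) x).trans (by rw [pow_zero, mul_one]))
  · exact (hbd 1 x).trans ((hb 1 (by norm_num) x).trans (by rw [pow_one]))
  · exact (hbd 2 x).trans (hb 2 (by norm_num) x)

end

lemma kl_prod {ι : Type*} [DecidableEq ι] (S : Finset ι) (u u' u'' f : ι → ℝ → ℝ) {A W : ℝ} (hA : 1 ≤ A) (hW : 0 ≤ W)
    (hf : ∀ i s, 0 ≤ f i s)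
    (h1 : ∀ i s, HasDerivAt (u i) (u' i s) s) (h2 : ∀ i s, HasDerivAt (u' i) (u'' i s) s)
    (b0 : ∀ i s, |u i s| ≤ A * f i s) (b1 : ∀ i s, |u' i s| ≤ A * W * f i s)
    (b2 : ∀ i s, |u'' i s| ≤ A * W ^ 2 * f i s) :
    ∃ P' P'' : ℝ → ℝ, ∀ s, HasDerivAt (fun s => ∏ i ∈ S, u i s) (P' s) s ∧ HasDerivAt P' (P'' s) s ∧
      |∏ i ∈ S, u i s| ≤ (4 * A) ^ S.card * ∏ i ∈ S, f i s ∧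
      |P' s| ≤ (4 * A) ^ S.card * W * ∏ i ∈ S, f i s ∧
      |P'' s| ≤ (4 * A) ^ S.card * W ^ 2 * ∏ i ∈ S, f i s := by
  induction S using Finset.induction_on with
  | empty =>
    refine ⟨fun _ => 0, fun _ => 0, fun s => ⟨?_, hasDerivAt_const _ _, ?_, ?_, ?_⟩⟩
    · simpa using hasDerivAt_const s (1:ℝ)
    · simp
    · simpa using hW
    · simp; positivity
  | insert i S hi ih =>
    obtain ⟨P', P'', hP⟩ := ih
    set P : ℝ → ℝ := fun s => ∏ j ∈ S, u j s with hPdef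
    have hPe : (fun s => ∏ j ∈ insert i S, u j s) = fun s => u i s * P s := by
      ext s; rw [Finset.prod_insert hi]
    refine ⟨fun s => u' i s * P s + u i s * P' s,
      fun s => (u'' i s * P s + u' i s * P' s) + (u' i s * P' s + u i s * P'' s), fun s => ?_⟩
    obtain ⟨d1, d2, c0, c1, c2⟩ := hP s
    rw [hPe, Finset.prod_insert hi, Finset.prod_insert hi, Finset.card_insert_of_notMem hi]
    have hf0 := hf i s
    have hF0 : 0 ≤ ∏ j ∈ S, f j s := Finset.prod_nonneg fun j _ => hf j s
    set F := ∏ j ∈ S, f j s with hF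
    set B := (4 * A) ^ S.card with hB
    have hB0 : 0 ≤ B := by positivity
    have hA0 : 0 ≤ A := by linarith
    have e0 := b0 i s
    have e1 := b1 i s
    have e2 := b2 i s
    change |P s| ≤ _ at c0
    refine ⟨(h1 i s).mul d1, ((h2 i s).mul d1).add ((h1 i s).mul d2), ?_, ?_, ?_⟩
    · change |u i s * P s| ≤ _
      rw [abs_mul]
      calc |u i s| * |P s| ≤ (A * f i s) * (B * F) := by gcongr
        _ = 1 * (A * B * (f i s * F)) := by ring
        _ ≤ 4 * (A * B * (f i s * F)) := by gcongr; norm_num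
        _ = _ := by ring
    · calc |u' i s * P s + u i s * P' s| ≤ |u' i s| * |P s| + |u i s| * |P' s| := by
            rw [← abs_mul, ← abs_mul]; exact abs_add_le _ _
        _ ≤ (A * W * f i s) * (B * F) + (A * f i s) * (B * W * F) := by gcongr
        _ = 2 * (A * B * W * (f i s * F)) := by ring
        _ ≤ 4 * (A * B * W * (f i s * F)) := by gcongr; norm_num
        _ = _ := by ring
    · calc |(u'' i s * P s + u' i s * P' s) + (u' i s * P' s + u i s * P'' s)|
          ≤ (|u'' i s| * |P s| + |u' i s| * |P' s|) + (|u' i s| * |P' s| + |u i s| * |P'' s|) := by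
            rw [← abs_mul, ← abs_mul, ← abs_mul]
            refine (abs_add_le _ _).trans (add_le_add (abs_add_le _ _) ((abs_add_le _ _).trans (le_of_eq ?_)))
            rw [abs_mul (u i s)]
        _ ≤ ((A * W ^ 2 * f i s) * (B * F) + (A * W * f i s) * (B * W * F)) +
            ((A * W * f i s) * (B * W * F) + (A * f i s) * (B * W ^ 2 * F)) := by gcongr
        _ = _ := by ring

lemma kl_second {P P' P'' : ℝ → ℝ} (h1 : ∀ s, HasDerivAt P (P' s) s) (h2 : ∀ s, HasDerivAt P' (P'' s) s)
    {K : ℝ} (hK : ∀ s, |s| ≤ 1 → |P'' s| ≤ K) : |P 1 + P (-1) - 2 * P 0| ≤ 2 * K := by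
  obtain ⟨c1, hc1, e1⟩ := exists_hasDerivAt_eq_slope P P' (a := 0) (b := 1) (by norm_num)
    (fun s _ => (h1 s).continuousAt.continuousWithinAt) (fun s _ => h1 s)
  obtain ⟨c2, hc2, e2⟩ := exists_hasDerivAt_eq_slope P P' (a := -1) (b := 0) (by norm_num)
    (fun s _ => (h1 s).continuousAt.continuousWithinAt) (fun s _ => h1 s)
  have h12 : c2 < c1 := hc2.2.trans hc1.1
  obtain ⟨c3, hc3, e3⟩ := exists_hasDerivAt_eq_slope P' P'' (a := c2) (b := c1) h12
    (fun s _ => (h2 s).continuousAt.continuousWithinAt) (fun s _ => h2 s)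
  have hb := hK c3 (abs_le.2 ⟨by linarith [hc2.1, hc3.1], by linarith [hc1.2, hc3.2]⟩)
  rw [eq_div_iff (by linarith)] at e3
  norm_num at e1 e2
  have : P 1 + P (-1) - 2 * P 0 = P'' c3 * (c1 - c2) := by rw [e3, e1, e2]; ring
  rw [this, abs_mul, abs_of_pos (by linarith : 0 < c1 - c2)]
  have : c1 - c2 ≤ 2 := by linarith [hc1.2, hc2.1]
  have h0 := abs_nonneg (P'' c3)
  nlinarith

lemma kl_sup {X : Type*} {D : Set X} {F : X → ℝ} (hF : ∀ ξ, 0 ≤ F ξ) {K : ℝ} (hK : ∀ ξ, F ξ ≤ K) {ξ : X} (hξ : ξ ∈ D) :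
    F ξ ≤ ⨆ ξ ∈ D, F ξ := by
  have hK0 : 0 ≤ K := (hF ξ).trans (hK ξ)
  have hb : BddAbove (Set.range fun ξ => ⨆ _ : ξ ∈ D, F ξ) := by
    refine ⟨K, ?_⟩
    rintro _ ⟨z, rfl⟩
    exact Real.iSup_le (fun _ => hK z) hK0
  refine le_trans ?_ (le_ciSup hb ξ)
  simp [hξ]

lemma kl_core {d : ℕ} (G G' G'' T : Fin d → ℝ → ℝ) {A w η₁ : ℝ} (hA : 1 ≤ A) (hw : 0 ≤ w) (hη : 0 ≤ η₁)
    (hT : ∀ i z, 0 ≤ T i z) (hTb : ∀ i, ∃ K, ∀ z, T i z ≤ K)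
    (h1 : ∀ i z, HasDerivAt (G i) (G' i z) z) (h2 : ∀ i z, HasDerivAt (G' i) (G'' i z) z)
    (b0 : ∀ i z, |G i z| ≤ A * T i z) (b1 : ∀ i z, |G' i z| ≤ A * w * T i z)
    (b2 : ∀ i z, |G'' i z| ≤ A * w ^ 2 * T i z)
    (B : Matrix (Fin d) (Fin d) ℝ) (hB : ∀ i j, |B i j| ≤ η₁) (x v : EuclideanSpace ℝ (Fin d)) :
    |(∏ i, G i (∑ j, B i j * (x + v) j)) + (∏ i, G i (∑ j, B i j * (x - v) j))
      - 2 * ∏ i, G i (∑ j, B i j * x j)| ≤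
      (4 * A) ^ d * min 4 (2 * (w * (d * η₁ * ‖v‖)) ^ 2) *
        ⨆ ξ ∈ {ξ : EuclideanSpace ℝ (Fin d) | ∀ i, ξ i ∈ Set.Icc (x i - |v i|) (x i + |v i|)},
          ∏ i, T i (∑ j, B i j * ξ j) := by
  set S := ⨆ ξ ∈ {ξ : EuclideanSpace ℝ (Fin d) | ∀ i, ξ i ∈ Set.Icc (x i - |v i|) (x i + |v i|)},
          ∏ i, T i (∑ j, B i j * ξ j) with hS
  set l : Fin d → ℝ := fun i => ∑ j, B i j * x j with hl
  set m : Fin d → ℝ := fun i => ∑ j, B i j * v j with hm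
  have hmb : ∀ i, |m i| ≤ d * η₁ * ‖v‖ := by
    intro i
    calc |m i| ≤ ∑ j, |B i j * v j| := Finset.abs_sum_le_sum_abs _ _
      _ ≤ ∑ j : Fin d, η₁ * ‖v‖ := by
        refine Finset.sum_le_sum fun j _ => ?_
        rw [abs_mul]
        have := PiLp.norm_apply_le v j
        rw [Real.norm_eq_abs] at this
        have := hB i j
        gcongr
      _ = _ := by simp; ring
  set W := w * (d * η₁ * ‖v‖) with hW
  have hW0 : 0 ≤ W := by positivity
  have hls : ∀ i s, ∑ j, B i j * (x + s • v) j = l i + s * m i := by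
    intro i s
    simp only [hl, hm, PiLp.add_apply, PiLp.smul_apply, smul_eq_mul, mul_add, Finset.sum_add_distrib,
      Finset.mul_sum]
    congr 1
    refine Finset.sum_congr rfl fun j _ => by ring
  have hlin : ∀ i s, HasDerivAt (fun s => l i + s * m i) (m i) s := by
    intro i s
    simpa using ((hasDerivAt_id s).mul_const (m i)).const_add (l i)
  obtain ⟨P', P'', hP⟩ := kl_prod Finset.univ (fun i s => G i (l i + s * m i))
    (fun i s => G' i (l i + s * m i) * m i) (fun i s => G'' i (l i + s * m i) * m i * m i)
    (fun i s => T i (l i + s * m i)) hA hW0 (fun i s => hT i _)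
    (fun i s => (h1 i _).comp s (hlin i s))
    (fun i s => ((h2 i _).comp s (hlin i s)).mul_const _) (fun i s => b0 i _)
    (fun i s => by
      rw [abs_mul]
      have := hT i (l i + s * m i)
      calc _ ≤ (A * w * T i (l i + s * m i)) * (d * η₁ * ‖v‖) := by
            gcongr
            · exact b1 i _
            · exact hmb i
        _ = _ := by rw [hW]; ring)
    (fun i s => by
      rw [abs_mul, abs_mul]
      have := hT i (l i + s * m i)
      have h3 := hmb i
      calc _ ≤ (A * w ^ 2 * T i (l i + s * m i)) * (d * η₁ * ‖v‖) * (d * η₁ * ‖v‖) := by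
            gcongr
            exact b2 i _
        _ = _ := by rw [hW]; ring)
  rw [Finset.card_univ, Fintype.card_fin] at hP
  choose K hK using hTb
  have hSb : ∀ s, |s| ≤ 1 → ∏ i, T i (l i + s * m i) ≤ S := by
    intro s hs
    have := kl_sup (D := {ξ : EuclideanSpace ℝ (Fin d) | ∀ i, ξ i ∈ Set.Icc (x i - |v i|) (x i + |v i|)})
      (F := fun ξ => ∏ i, T i (∑ j, B i j * ξ j)) (fun ξ => Finset.prod_nonneg fun i _ => hT i _)
      (K := ∏ i, K i) (fun ξ => Finset.prod_le_prod (fun i _ => hT i _) fun i _ => hK i _)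
      (ξ := x + s • v) (by
        intro i
        have h3 : |s * v i| ≤ |v i| := by
          rw [abs_mul]; exact mul_le_of_le_one_left (abs_nonneg _) hs
        have h4 := abs_le.1 h3
        simp only [PiLp.add_apply, PiLp.smul_apply, smul_eq_mul]
        exact ⟨by linarith [h4.1], by linarith [h4.2]⟩)
    simp only [hls] at this
    exact this
  have hS0 : 0 ≤ S := le_trans (Finset.prod_nonneg fun i _ => hT i _) (hSb 0 (by simp))
  have hA4 : 0 ≤ (4 * A) ^ d := by positivity
  have q1 := kl_second (fun s => (hP s).1) (fun s => (hP s).2.1) (K := (4 * A) ^ d * W ^ 2 * S)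
    (fun s hs => (hP s).2.2.2.2.trans (by gcongr; exact hSb s hs))
  have q2 : ∀ s, |s| ≤ 1 → |∏ i, G i (l i + s * m i)| ≤ (4 * A) ^ d * S := fun s hs =>
    (hP s).2.2.1.trans (by gcongr; exact hSb s hs)
  have r1 := q2 1 (by simp)
  have r2 := q2 (-1) (by simp)
  have r3 := q2 0 (by simp)
  have t1 : ∀ i, ∑ j, B i j * (x + v) j = l i + 1 * m i := fun i => by rw [← hls i 1, one_smul]
  have t2 : ∀ i, ∑ j, B i j * (x - v) j = l i + (-1) * m i := fun i => by
    rw [← hls i (-1), neg_one_smul, sub_eq_add_neg]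
  have t3 : ∀ i, ∑ j, B i j * x j = l i + 0 * m i := fun i => by rw [zero_mul, add_zero]
  simp only [t1, t2, t3]
  rw [mul_min_of_nonneg _ _ hA4, min_mul_of_nonneg _ _ hS0]
  refine le_min ?_ (q1.trans (le_of_eq (by ring)))
  rw [abs_le] at r1 r2 r3 ⊢
  constructor <;> linarith [r1.1, r1.2, r2.1, r2.2, r3.1, r3.2]


/-- second-difference estimate for the frozen kernel
`p_y(t,x) = det(B(y)) ∏ᵢ g_{i,t}^{(δ)}(bᵢ(y)·x)` in terms of
`r_y(t,ξ) = ∏ᵢ tilde-g_{i,t}^{(ε)}(bᵢ(y)·ξ)` maximized over the box `D(x,v)`. -/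
theorem stmt_16 (d : ℕ) (hd : 2 ≤ d)
    (ν ν' μ μ' h hinv ψδ : Fin d → ℝ → ℝ) (g : Fin d → ℝ → ℝ → ℝ)
    (α β C₁ C₂ η₁ η₂ η₃ η₄ τ ε δ0 δ : ℝ)
    (hα : 0 < α) (hαβ : α ≤ β) (hβ : β < 2) (hC₁ : 0 < C₁) (hC₂ : 0 < C₂)
    (hη₁ : 1 ≤ η₁) (hη₂ : 0 < η₂) (hη₃ : 1 ≤ η₃) (hη₄ : 0 < η₄) (hτ : 0 < τ) (hε0 : 0 < ε) (hε1 : ε ≤ 1)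
    (hδ0 : 0 < δ0) (hδ0' : δ0 ≤ 1 / 24)
    (hδdef : δ = min δ0 (min (ε * α / (8 * (d + β + 2))) (ε / (d * η₁ ^ 2))))
    -- each ν i is the density of a symmetric infinite Lévy measure on ℝ
    (hνmeas : ∀ i, Measurable (ν i))
    (hνnonneg : ∀ i, ∀ x : ℝ, 0 ≤ ν i x)
    (hνsymm : ∀ i, ∀ x : ℝ, ν i (-x) = ν i x)
    (hνint : ∀ i, Integrable (fun x : ℝ => min (x ^ 2) 1 * ν i x))
    (hνinf : ∀ i, ¬ Integrable (ν i))
    -- regularity of ν i near 0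
    (hν'deriv : ∀ i, ∀ x ∈ Set.Ioo (0:ℝ) η₄, HasDerivAt (ν i) (ν' i x) x)
    (hν'neg : ∀ i, ∀ x ∈ Set.Ioo (0:ℝ) η₄, ν' i x < 0)
    (hν'dec : ∀ i, ∀ x y : ℝ, 0 < x → x < y → y < η₄ → -ν' i y / y ≤ -ν' i x / x)
    -- h i and its inverse
    (hdef : ∀ i, ∀ r : ℝ, 0 < r → h i r = ∫ x : ℝ, min 1 (x ^ 2 / r ^ 2) * ν i x)
    (hcont : ∀ i, ContinuousOn (h i) (Set.Ioi 0))
    (hanti : ∀ i, StrictAntiOn (h i) (Set.Ioi 0))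
    (hlim0 : ∀ i, Tendsto (h i) (nhdsWithin 0 (Set.Ioi 0)) atTop)
    (hlimtop : ∀ i, Tendsto (h i) atTop (nhds 0))
    (hinvpos : ∀ i, ∀ s : ℝ, 0 < s → 0 < hinv i s)
    (hinvr : ∀ i, ∀ s : ℝ, 0 < s → h i (hinv i s) = s)
    (hinvl : ∀ i, ∀ r : ℝ, 0 < r → hinv i (h i r) = r)
    -- scaling conditions
    (hlsc : ∀ i, ∀ θ : ℝ, 0 < θ → ∀ l : ℝ, 1 ≤ l → C₁ * l ^ α * h i (l * θ) ≤ h i θ)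
    (husc : ∀ i, ∀ θ : ℝ, 0 < θ → θ ≤ 1 → ∀ l : ℝ, 0 < l → l ≤ 1 →
      h i (l * θ) ≤ C₂ * l ^ (-β) * h i θ)
    -- μ i = μ_i^{(δ)} is a symmetric truncation of ν i
    (hμmeas : ∀ i, Measurable (μ i))
    (hμeq : ∀ i, ∀ x : ℝ, 0 < x → x ≤ δ → μ i x = ν i x)
    (hμbound : ∀ i, ∀ x : ℝ, 0 < x → 0 ≤ μ i x ∧ μ i x ≤ ν i x)
    (hμzero : ∀ i, ∀ x : ℝ, 2 * δ ≤ x → μ i x = 0)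
    (hμsymm : ∀ i, ∀ x : ℝ, μ i (-x) = μ i x)
    (hμ'deriv : ∀ i, ∀ x : ℝ, 0 < x → HasDerivAt (μ i) (μ' i x) x)
    (hμ'nonpos : ∀ i, ∀ x : ℝ, 0 < x → μ' i x ≤ 0)
    (hμ'dec : ∀ i, ∀ x y : ℝ, 0 < x → x ≤ y → -μ' i y / y ≤ -μ' i x / x)
    -- ψδ i and the heat kernels g_{i,t}^{(δ)}
    (hψδdef : ∀ i, ∀ ξ : ℝ, ψδ i ξ = ∫ x : ℝ, (1 - Real.cos (ξ * x)) * μ i x)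
    (hgdef : ∀ i, ∀ t : ℝ, 0 < t → ∀ x : ℝ,
      g i t x = (2 * Real.pi)⁻¹ * ∫ ξ : ℝ, Real.cos (x * ξ) * Real.exp (-t * ψδ i ξ))
    -- the matrix A and its inverse B = A⁻¹
    (A : EuclideanSpace ℝ (Fin d) → Matrix (Fin d) (Fin d) ℝ)
    (hAbd : ∀ x i j, |A x i j| ≤ η₁)
    (hAdet : ∀ x, η₂ ≤ (A x).det)
    (hALip : ∀ x y i j, |A x i j - A y i j| ≤ η₃ * ‖x - y‖)
    (hBbd : ∀ x i j, |(A x)⁻¹ i j| ≤ η₁)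
    (hBLip : ∀ x y i j, |(A x)⁻¹ i j - (A y)⁻¹ i j| ≤ η₃ * ‖x - y‖) :
    ∃ c : ℝ, 0 < c ∧ ∀ t : ℝ, 0 < t → t ≤ τ → ∀ x y v : EuclideanSpace ℝ (Fin d),
      |(A y)⁻¹.det * (∏ i, g i t (∑ j, (A y)⁻¹ i j * (x + v) j))
        + (A y)⁻¹.det * (∏ i, g i t (∑ j, (A y)⁻¹ i j * (x - v) j))
        - 2 * ((A y)⁻¹.det * ∏ i, g i t (∑ j, (A y)⁻¹ i j * x j))| ≤
      c * min 1 (t ^ (-(2 / α)) * ‖v‖ ^ 2) *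
        ⨆ ξ ∈ {ξ : EuclideanSpace ℝ (Fin d) |
            ∀ i, ξ i ∈ Set.Icc (x i - |v i|) (x i + |v i|)},
          ∏ i, tg (h i) (hinv i) τ ε ((d + β - 1) / α) t
            (∑ j, (A y)⁻¹ i j * ξ j) := by
  classical
  have hd0 : (0:ℝ) < d := by exact_mod_cast (by omega : 0 < d)
  have hβ0 : 0 < β := by linarith
  have hη₁0 : 0 < η₁ := by linarith
  have hδ : 0 < δ := by rw [hδdef]; positivity
  have hδle : δ ≤ ε * α / (8 * (d + β + 2)) := by
    rw [hδdef]; exact (min_le_right _ _).trans (min_le_left _ _)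
  have hQ : ((d:ℝ) + β - 1) / α + 3 / α ≤ ε / (8 * δ) := by
    rw [← add_div, div_le_div_iff₀ hα (by positivity)]
    rw [le_div_iff₀ (by positivity)] at hδle
    nlinarith
  have D : ∀ i, KlD (ν i) (μ i) (h i) α C₁ δ := by
    intro i
    have hle : ∀ r s : ℝ, 0 < r → r ≤ s → h i s ≤ h i r := fun r s hr hrs =>
      (hanti i).antitoneOn hr (lt_of_lt_of_le hr hrs) hrs
    refine ⟨hα, hC₁, hδ, hνmeas i, hνnonneg i, hνsymm i, hνint i, hdef i, ?_, hle, hlsc i, hμmeas i,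
      hμsymm i, hμeq i, hμbound i, hμzero i, ?_⟩
    · intro r hr
      have h1 : h i (r + 1) < h i r := hanti i (Set.mem_Ioi.2 hr) (Set.mem_Ioi.2 (by linarith)) (by linarith)
      have h2 : 0 ≤ h i (r + 1) := by
        rw [hdef i _ (by linarith)]
        exact integral_nonneg fun y => mul_nonneg (by positivity) (hνnonneg i y)
      linarith
    · intro x y hx hxy
      have := antitoneOn_of_deriv_nonpos (convex_Ioi (0:ℝ)) (f := μ i)
        (fun z hz => (hμ'deriv i z hz).continuousAt.continuousWithinAt)
        (fun z hz => (hμ'deriv i z (interior_subset hz)).differentiableAt.differentiableWithinAt)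
        (fun z hz => by rw [(hμ'deriv i z (interior_subset hz)).deriv]; exact hμ'nonpos i z (interior_subset hz))
      exact this hx (lt_of_lt_of_le hx hxy) hxy
  have key := fun i => (D i).key' hτ hε0 (hinvpos i) (hinvr i) hQ (hψδdef i) (hgdef i)
  choose C hC hkey using key
  set A0 := 1 + ∑ i, C i with hA0
  have hCA : ∀ i, C i ≤ A0 := fun i => by
    have := Finset.single_le_sum (f := C) (fun j _ => (hC j).le) (Finset.mem_univ i)
    linarith
  have hA1 : 1 ≤ A0 := by
    have : 0 ≤ ∑ i, C i := Finset.sum_nonneg fun j _ => (hC j).le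
    linarith
  refine ⟨1 / η₂ * (4 * A0) ^ d * (4 + 2 * (τ ^ (2 / α) * (d * η₁) ^ 2)), by positivity,
    fun t ht htτ x y v => ?_⟩
  choose G' G'' hG using fun i => hkey i t ht htτ
  have hw0 : 0 ≤ (τ / t) ^ (1 / α) := by positivity
  have hT := fun i => (D i).tg_pos (hinv := hinv i) (p := ((d:ℝ) + β - 1) / α) hτ hε0 (hinvpos i) ht
  have core := kl_core (fun i => g i t) G' G'' (fun i => tg (h i) (hinv i) τ ε ((d + β - 1) / α) t)
    hA1 hw0 hη₁0.le hT (fun i => (D i).tg_bdd hτ hε0 (hinvpos i) ht)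
    (fun i z => (hG i z).1) (fun i z => (hG i z).2.1)
    (fun i z => (hG i z).2.2.1.trans (by have := hT i z; have := hCA i; gcongr))
    (fun i z => (hG i z).2.2.2.1.trans (by have := hT i z; have := hCA i; gcongr))
    (fun i z => (hG i z).2.2.2.2.trans (by have := hT i z; have := hCA i; gcongr))
    (A y)⁻¹ (hBbd y) x v
  set S := ⨆ ξ ∈ {ξ : EuclideanSpace ℝ (Fin d) |
            ∀ i, ξ i ∈ Set.Icc (x i - |v i|) (x i + |v i|)},
          ∏ i, tg (h i) (hinv i) τ ε ((d + β - 1) / α) t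
            (∑ j, (A y)⁻¹ i j * ξ j) with hS
  have hS0 : 0 ≤ S := Real.iSup_nonneg fun ξ => Real.iSup_nonneg fun _ =>
    Finset.prod_nonneg fun i _ => hT i _
  have hdet : |(A y)⁻¹.det| ≤ 1 / η₂ := by
    rw [Matrix.det_nonsing_inv, Ring.inverse_eq_inv', abs_inv, one_div]
    have := hAdet y
    rw [abs_of_pos (by linarith)]
    gcongr
  have hmin : min 4 (2 * ((τ / t) ^ (1 / α) * (d * η₁ * ‖v‖)) ^ 2) ≤
      (4 + 2 * (τ ^ (2 / α) * (d * η₁) ^ 2)) * min 1 (t ^ (-(2 / α)) * ‖v‖ ^ 2) := by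
    have e : ((τ / t) ^ (1 / α)) ^ 2 = τ ^ (2 / α) * t ^ (-(2 / α)) := by
      rw [← Real.rpow_natCast, ← Real.rpow_mul (by positivity), Real.div_rpow hτ.le ht.le,
        Real.rpow_neg ht.le, div_eq_mul_inv]
      norm_num [div_eq_mul_inv, mul_comm]
    have hp : 0 ≤ 2 * (τ ^ (2 / α) * (d * η₁) ^ 2) := by positivity
    have hq : 0 ≤ t ^ (-(2 / α)) * ‖v‖ ^ 2 := by positivity
    rw [mul_min_of_nonneg _ _ (by positivity)]
    refine min_le_min (by linarith) ?_
    rw [mul_pow, e]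
    calc _ = 2 * (τ ^ (2 / α) * (d * η₁) ^ 2) * (t ^ (-(2 / α)) * ‖v‖ ^ 2) := by ring
      _ ≤ _ := by gcongr; linarith
  calc _ = |(A y)⁻¹.det| * |(∏ i, g i t (∑ j, (A y)⁻¹ i j * (x + v) j))
        + (∏ i, g i t (∑ j, (A y)⁻¹ i j * (x - v) j))
        - 2 * (∏ i, g i t (∑ j, (A y)⁻¹ i j * x j))| := by
        rw [← abs_mul]; congr 1; ring
    _ ≤ 1 / η₂ * ((4 * A0) ^ d * min 4 (2 * ((τ / t) ^ (1 / α) * (d * η₁ * ‖v‖)) ^ 2) * S) := by gcongr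
    _ ≤ 1 / η₂ * ((4 * A0) ^ d * ((4 + 2 * (τ ^ (2 / α) * (d * η₁) ^ 2)) * min 1 (t ^ (-(2 / α)) * ‖v‖ ^ 2)) * S) := by
        gcongr
    _ = _ := by ring
end

section
/- Under the hypotheses on q₀ of the previous statement (measurable q₀ on (0,τ]×ℝ^d×ℝ^d with |q₀(t,x,y)| ≤ c*t^{−(d+β)/α}, |q₀(t,x,y)| ≤ c*e^{−λ|x−y|} for |x−y|≥1, ∫|q₀(t,x,u)|du ≤ c*t^{−σ}, ∫|q₀(t,u,x)|du ≤ c*t^{−σ}), define q_n by the recursion q_n(t,x,y)=∫₀ᵗ∫_{ℝ^d}q₀(t−s,x,z)q_{n−1}(s,z,y)dzds and q(t,x,y)=Σ_{n=0}^∞ q_n(t,x,y). Then q(t,x,y) is well defined for all t∈(0,τ], x,y∈ℝ^d, and there exist constants c,c₃>0 and a>0 such that: |q(t,x,y)| ≤ c·t^{−(d+β)/α}·e^{−c₃√(|x−y|)}; |q(t,x,y)| ≤ c·e^{−c₃√(|x−y|)} whenever |x−y|≥a; ∫_{ℝ^d}|q(t,x,y)|dy ≤ c·t^{−σ}; and ∫_{ℝ^d}|q(t,y,x)|dy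 ≤ c·t^{−σ}. -/
open MeasureTheory

theorem aux_time (σ δ η : ℝ) (hσ : σ < 1) (hδ : 0 < δ) (hσδ : 1 - σ = 2 * δ) (hη : 0 < η) :
    ∃ M : ℝ, 0 < M ∧ ∀ t : ℝ, 0 < t →
      ∫⁻ s in Set.Ioo 0 t, ENNReal.ofReal ((t - s) ^ (-σ) * Real.exp (-M * (t - s))
        + s ^ (-σ) * Real.exp (-M * s)) ≤ ENNReal.ofReal (η * t ^ δ) := by
  have hlim : Filter.Tendsto (fun M : ℝ => 2 * ((1 / M) ^ δ * Real.Gamma δ)) Filter.atTop (nhds 0) := by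
    have h := (tendsto_rpow_neg_atTop hδ).mul_const (Real.Gamma δ) |>.const_mul 2
    simp only [zero_mul, mul_zero] at h
    refine h.congr' ?_
    filter_upwards [Filter.eventually_gt_atTop 0] with M hM
    rw [one_div, Real.inv_rpow hM.le, Real.rpow_neg hM.le]
  obtain ⟨M, hMη, hM⟩ := ((hlim.eventually (gt_mem_nhds hη)).and (Filter.eventually_gt_atTop 0)).exists
  refine ⟨M, hM, fun t ht => ?_⟩
  have hG : ∫⁻ s in Set.Ioo 0 t, ENNReal.ofReal (s ^ (-σ) * Real.exp (-M * s)) ≤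
      ENNReal.ofReal (t ^ δ * ((1 / M) ^ δ * Real.Gamma δ)) := by
    have hI := Real.integral_rpow_mul_exp_neg_mul_Ioi hδ hM
    have hpos : 0 < (1 / M) ^ δ * Real.Gamma δ := by
      have := Real.Gamma_pos_of_pos hδ
      positivity
    have hint : IntegrableOn (fun s : ℝ => s ^ (δ - 1) * Real.exp (-(M * s))) (Set.Ioi 0) := by
      by_contra h
      rw [integral_undef h] at hI
      linarith
    have : ∫⁻ s in Set.Ioi (0:ℝ), ENNReal.ofReal (s ^ (δ - 1) * Real.exp (-(M * s))) =
        ENNReal.ofReal ((1 / M) ^ δ * Real.Gamma δ) := by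
      rw [← hI, ofReal_integral_eq_lintegral_ofReal hint]
      filter_upwards [ae_restrict_mem measurableSet_Ioi] with s hs
      have : (0:ℝ) < s := hs
      simp only [Pi.zero_apply]
      positivity
    rw [ENNReal.ofReal_mul (by positivity), ← this, ← lintegral_const_mul' _ _ ENNReal.ofReal_ne_top]
    refine le_trans ?_ (lintegral_mono_set (Set.Ioo_subset_Ioi_self : Set.Ioo 0 t ⊆ Set.Ioi 0))
    refine setLIntegral_mono' measurableSet_Ioo fun s hs => ?_
    have h0 : 0 < s := hs.1
    rw [← ENNReal.ofReal_mul (by positivity)]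
    apply ENNReal.ofReal_le_ofReal
    have e1 : s ^ (-σ) = s ^ δ * s ^ (δ - 1) := by
      rw [← Real.rpow_add h0]; congr 1; linarith
    have e2 : s ^ δ ≤ t ^ δ := Real.rpow_le_rpow h0.le hs.2.le hδ.le
    rw [e1, neg_mul, mul_assoc]
    gcongr
  have hG' : ∫⁻ s in Set.Ioo 0 t, ENNReal.ofReal ((t - s) ^ (-σ) * Real.exp (-M * (t - s))) =
      ∫⁻ s in Set.Ioo 0 t, ENNReal.ofReal (s ^ (-σ) * Real.exp (-M * s)) := by
    rw [← lintegral_indicator measurableSet_Ioo, ← lintegral_indicator measurableSet_Ioo,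
      ← lintegral_sub_left_eq_self _ t]
    congr 1
    ext s
    by_cases hs : s ∈ Set.Ioo 0 t
    · have : t - s ∈ Set.Ioo 0 t := ⟨by linarith [hs.2], by linarith [hs.1]⟩
      simp [hs, this]
    · have : t - s ∉ Set.Ioo 0 t := fun h => hs ⟨by linarith [h.2], by linarith [h.1]⟩
      simp [hs, this]
  calc _ ≤ ∫⁻ s in Set.Ioo 0 t, (ENNReal.ofReal ((t - s) ^ (-σ) * Real.exp (-M * (t - s)))
        + ENNReal.ofReal (s ^ (-σ) * Real.exp (-M * s))) := by
          apply lintegral_mono; intro s; exact ENNReal.ofReal_add_le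
    _ = _ := lintegral_add_left (by fun_prop) _
    _ ≤ _ := by
      rw [hG']
      refine (add_le_add hG hG).trans ?_
      have := Real.Gamma_pos_of_pos hδ
      rw [← ENNReal.ofReal_add (by positivity) (by positivity)]
      apply ENNReal.ofReal_le_ofReal
      have : 0 < t ^ δ := by positivity
      nlinarith

theorem step_time (σ δ η M : ℝ) (hσ : 0 < σ) (hη : 0 < η) (hM0 : 0 < M)
    (hM : ∀ t : ℝ, 0 < t →
      ∫⁻ s in Set.Ioo 0 t, ENNReal.ofReal ((t - s) ^ (-σ) * Real.exp (-M * (t - s))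
        + s ^ (-σ) * Real.exp (-M * s)) ≤ ENNReal.ofReal (η * t ^ δ))
    (t p m A B : ℝ) (ht : 0 < t) (hp : 0 ≤ p) (hm : 0 ≤ m) (hA : 0 ≤ A) (hB : 0 ≤ B)
    (F : ℝ → ENNReal)
    (h1 : ∀ s ∈ Set.Ioo 0 t, s < t / 2 → F s ≤
      ENNReal.ofReal (A * (t - s) ^ (-p) * (B * (s ^ (-σ + m) * Real.exp (M * s)))))
    (h2 : ∀ s ∈ Set.Ioo 0 t, t / 2 ≤ s → F s ≤
      ENNReal.ofReal (A * (t - s) ^ (-σ) * (B * (s ^ (-p + m) * Real.exp (M * s))))) :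
    ∫⁻ s in Set.Ioo 0 t, F s ≤
      ENNReal.ofReal (A * B * 2 ^ p * η * (t ^ (-p + m + δ) * Real.exp (M * t))) := by
  have key : ∀ s ∈ Set.Ioo 0 t, F s ≤ ENNReal.ofReal (A * B * 2 ^ p * t ^ (-p + m) * Real.exp (M * t)) *
      ENNReal.ofReal ((t - s) ^ (-σ) * Real.exp (-M * (t - s)) + s ^ (-σ) * Real.exp (-M * s)) := by
    intro s hs
    have h0 : 0 < s := hs.1
    have h0' : 0 < t - s := by linarith [hs.2]
    have em : s ^ m ≤ t ^ m := Real.rpow_le_rpow h0.le hs.2.le hm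
    have hhalf : ∀ r, t / 2 ≤ r → r ^ (-p) ≤ 2 ^ p * t ^ (-p) := by
      intro r hr
      have := Real.rpow_le_rpow_of_nonpos (by positivity : 0 < t / 2) hr (neg_nonpos.2 hp)
      refine this.trans_eq ?_
      rw [Real.div_rpow ht.le (by norm_num), Real.rpow_neg (by norm_num : (0:ℝ) ≤ 2)]
      field_simp
    rw [← ENNReal.ofReal_mul (by positivity)]
    rcases lt_or_ge s (t / 2) with hlt | hge
    · refine (h1 s hs hlt).trans (ENNReal.ofReal_le_ofReal ?_)
      have ee : Real.exp (M * s) ≤ Real.exp (M * t) * Real.exp (-M * s) := by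
        rw [← Real.exp_add]; apply Real.exp_le_exp.2; nlinarith
      have h3 := hhalf (t - s) (by linarith)
      rw [Real.rpow_add h0, Real.rpow_add ht]
      calc A * (t - s) ^ (-p) * (B * (s ^ (-σ) * s ^ m * Real.exp (M * s)))
          ≤ A * (2 ^ p * t ^ (-p)) * (B * (s ^ (-σ) * t ^ m * (Real.exp (M * t) * Real.exp (-M * s)))) := by
            gcongr
        _ = A * B * 2 ^ p * (t ^ (-p) * t ^ m) * Real.exp (M * t) * (0 + s ^ (-σ) * Real.exp (-M * s)) := by ring
        _ ≤ _ := by gcongr; positivity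
    · refine (h2 s hs hge).trans (ENNReal.ofReal_le_ofReal ?_)
      have ee : Real.exp (M * s) = Real.exp (M * t) * Real.exp (-M * (t - s)) := by
        rw [← Real.exp_add]; congr 1; ring
      have h3 := hhalf s hge
      rw [Real.rpow_add h0, Real.rpow_add ht, ee]
      calc A * (t - s) ^ (-σ) * (B * (s ^ (-p) * s ^ m * (Real.exp (M * t) * Real.exp (-M * (t - s)))))
          ≤ A * (t - s) ^ (-σ) * (B * ((2 ^ p * t ^ (-p)) * t ^ m * (Real.exp (M * t) * Real.exp (-M * (t - s))))) := by
            gcongr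
        _ = A * B * 2 ^ p * (t ^ (-p) * t ^ m) * Real.exp (M * t) * ((t - s) ^ (-σ) * Real.exp (-M * (t - s)) + 0) := by ring
        _ ≤ _ := by gcongr; positivity
  refine (setLIntegral_mono' measurableSet_Ioo key).trans ?_
  rw [lintegral_const_mul' _ _ ENNReal.ofReal_ne_top]
  refine (mul_le_mul_right (hM t ht) _).trans ?_
  rw [← ENNReal.ofReal_mul (by positivity)]
  apply ENNReal.ofReal_le_ofReal
  rw [Real.rpow_add ht (-p + m)]
  apply le_of_eq; ring

theorem kernel_bounds {X : Type*} [MeasurableSpace X] (μ : Measure X) [SFinite μ]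
    (σ γ τ c1 δ : ℝ) (hσ : 0 < σ) (hσγ : σ ≤ γ) (hδ : 0 < δ) (hσδ : 1 - σ = 2 * δ)
    (hc1 : 0 ≤ c1)
    (k : ℕ → ℝ → X → X → ENNReal)
    (hk : ∀ n, Measurable fun p : ℝ × X × X => k n p.1 p.2.1 p.2.2)
    (hrec : ∀ n t x y, k (n + 1) t x y ≤
      ∫⁻ s in Set.Ioo 0 t, ∫⁻ z, k 0 (t - s) x z * k n s z y ∂μ)
    (h0s : ∀ t, 0 < t → t ≤ τ → ∀ x y, k 0 t x y ≤ ENNReal.ofReal (c1 * t ^ (-γ)))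
    (h0l : ∀ t, 0 < t → t ≤ τ → ∀ x, ∫⁻ u, k 0 t x u ∂μ ≤ ENNReal.ofReal (c1 * t ^ (-σ)))
    (h0r : ∀ t, 0 < t → t ≤ τ → ∀ x, ∫⁻ u, k 0 t u x ∂μ ≤ ENNReal.ofReal (c1 * t ^ (-σ))) :
    ∃ M : ℝ, 0 < M ∧ ∀ (n : ℕ) (t : ℝ), 0 < t → t ≤ τ →
      (∀ x y, k n t x y ≤ ENNReal.ofReal
        (c1 * (1 / 2) ^ n * (t ^ (-γ + min (n * δ) γ) * Real.exp (M * t)))) ∧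
      (∀ x, ∫⁻ u, k n t x u ∂μ ≤ ENNReal.ofReal
        (c1 * (1 / 2) ^ n * (t ^ (-σ + min (n * δ) γ) * Real.exp (M * t)))) ∧
      (∀ x, ∫⁻ u, k n t u x ∂μ ≤ ENNReal.ofReal
        (c1 * (1 / 2) ^ n * (t ^ (-σ + min (n * δ) γ) * Real.exp (M * t)))) := by
  have hγ : 0 < γ := by linarith
  set T : ℝ := max 1 τ with hT
  have hT1 : 1 ≤ T := le_max_left _ _
  have hT0 : 0 < T := by linarith
  set η : ℝ := 1 / (2 * (c1 + 1) * 2 ^ γ * T ^ δ) with hη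
  have hη0 : 0 < η := by positivity
  have hηle : c1 * 2 ^ γ * η * T ^ δ ≤ 1 / 2 := by
    have : c1 * 2 ^ γ * η * T ^ δ = c1 / (c1 + 1) * (1 / 2) := by
      rw [hη]; field_simp
    rw [this]
    have : c1 / (c1 + 1) ≤ 1 := by rw [div_le_one (by positivity)]; linarith
    linarith
  obtain ⟨M, hM0, hM⟩ := aux_time σ δ η (by linarith) hδ hσδ hη0
  refine ⟨M, hM0, ?_⟩
  -- closing the induction step
  have close : ∀ (n : ℕ) (p t : ℝ), p ≤ γ → 0 < t → t ≤ τ →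
      c1 * (c1 * (1 / 2) ^ n) * 2 ^ p * η * (t ^ (-p + min (n * δ) γ + δ) * Real.exp (M * t)) ≤
      c1 * (1 / 2) ^ (n + 1) * (t ^ (-p + min (((n + 1 : ℕ) : ℝ) * δ) γ) * Real.exp (M * t)) := by
    intro n p t hp ht htτ
    set m := min (n * δ) γ
    set m' := min (((n + 1 : ℕ) : ℝ) * δ) γ
    have a1 : m' ≤ m + δ := by
      simp only [m, m']; push_cast
      rcases le_total (n * δ) γ with h | h
      · rw [min_eq_left h]; exact (min_le_left _ _).trans (by linarith)
      · rw [min_eq_right h]; exact (min_le_right _ _).trans (by linarith)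
    have a2 : m ≤ m' := by
      simp only [m, m']; push_cast
      exact min_le_min_right _ (by nlinarith)
    have e1 : t ^ (-p + m + δ) = t ^ (-p + m') * t ^ (m + δ - m') := by
      rw [← Real.rpow_add ht]; congr 1; ring
    have e2 : t ^ (m + δ - m') ≤ T ^ δ := by
      calc t ^ (m + δ - m') ≤ T ^ (m + δ - m') :=
            Real.rpow_le_rpow ht.le (htτ.trans (le_max_right _ _)) (by linarith)
        _ ≤ T ^ δ := Real.rpow_le_rpow_of_exponent_le hT1 (by linarith)
    have e3 : (2:ℝ) ^ p ≤ 2 ^ γ := Real.rpow_le_rpow_of_exponent_le (by norm_num) hp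
    rw [e1]
    calc c1 * (c1 * (1 / 2) ^ n) * 2 ^ p * η * (t ^ (-p + m') * t ^ (m + δ - m') * Real.exp (M * t))
        ≤ c1 * (c1 * (1 / 2) ^ n) * 2 ^ γ * η * (t ^ (-p + m') * T ^ δ * Real.exp (M * t)) := by
          gcongr
      _ = c1 * (1 / 2) ^ n * (t ^ (-p + m') * Real.exp (M * t)) * (c1 * 2 ^ γ * η * T ^ δ) := by ring
      _ ≤ c1 * (1 / 2) ^ n * (t ^ (-p + m') * Real.exp (M * t)) * (1 / 2) := by gcongr
      _ = _ := by ring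
  intro n
  induction n with
  | zero =>
    intro t ht htτ
    have e : ∀ p : ℝ, c1 * t ^ (-p) ≤ c1 * (1 / 2) ^ 0 *
        (t ^ (-p + min (((0 : ℕ) : ℝ) * δ) γ) * Real.exp (M * t)) := by
      intro p
      have : min (((0 : ℕ) : ℝ) * δ) γ = 0 := by simp [hγ.le]
      rw [this, add_zero, pow_zero, mul_one]
      have : 1 ≤ Real.exp (M * t) := Real.one_le_exp (by positivity)
      gcongr
      exact le_mul_of_one_le_right (by positivity) this
    exact ⟨fun x y => (h0s t ht htτ x y).trans (ENNReal.ofReal_le_ofReal (e γ)),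
      fun x => (h0l t ht htτ x).trans (ENNReal.ofReal_le_ofReal (e σ)),
      fun x => (h0r t ht htτ x).trans (ENNReal.ofReal_le_ofReal (e σ))⟩
  | succ n ih =>
    intro t ht htτ
    have hm : 0 ≤ min (n * δ) γ := le_min (by positivity) hγ.le
    have hB : 0 ≤ c1 * (1 / 2) ^ n := by positivity
    have mk0 : ∀ t x, Measurable fun z => k 0 t x z := fun t x =>
      (hk 0).comp (measurable_const.prodMk (measurable_const.prodMk measurable_id))
    have mk0' : ∀ t y, Measurable fun z => k 0 t z y := fun t y =>
      (hk 0).comp (measurable_const.prodMk (measurable_id.prodMk measurable_const))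
    have mkn : ∀ t x, Measurable fun z => k n t x z := fun t x =>
      (hk n).comp (measurable_const.prodMk (measurable_const.prodMk measurable_id))
    have mkn' : ∀ t y, Measurable fun z => k n t z y := fun t y =>
      (hk n).comp (measurable_const.prodMk (measurable_id.prodMk measurable_const))
    refine ⟨fun x y => ?_, fun x => ?_, fun y => ?_⟩
    · refine (hrec n t x y).trans ((step_time σ δ η M hσ hη0 hM0 hM t γ _ c1 _ ht hγ.le hm hc1 hB _
        ?_ ?_).trans (ENNReal.ofReal_le_ofReal (close n γ t le_rfl ht htτ)))
      · intro s hs _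
        have hs' : 0 < t - s := by linarith [hs.2]
        calc ∫⁻ z, k 0 (t - s) x z * k n s z y ∂μ
            ≤ ∫⁻ z, ENNReal.ofReal (c1 * (t - s) ^ (-γ)) * k n s z y ∂μ := by
              refine lintegral_mono fun z => ?_
              gcongr
              exact h0s _ hs' (by linarith [hs.1]) x z
          _ = ENNReal.ofReal (c1 * (t - s) ^ (-γ)) * ∫⁻ z, k n s z y ∂μ :=
              lintegral_const_mul' _ _ ENNReal.ofReal_ne_top
          _ ≤ _ := by
              refine (mul_le_mul' le_rfl ((ih s hs.1 (by linarith [hs.2])).2.2 y)).trans_eq (ENNReal.ofReal_mul (by positivity)).symm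
      · intro s hs _
        have hs' : 0 < t - s := by linarith [hs.2]
        calc ∫⁻ z, k 0 (t - s) x z * k n s z y ∂μ
            ≤ ∫⁻ z, k 0 (t - s) x z * ENNReal.ofReal (c1 * (1 / 2) ^ n *
                (s ^ (-γ + min (n * δ) γ) * Real.exp (M * s))) ∂μ := by
              refine lintegral_mono fun z => ?_
              gcongr
              exact (ih s hs.1 (by linarith [hs.2])).1 z y
          _ = (∫⁻ z, k 0 (t - s) x z ∂μ) * _ :=
              lintegral_mul_const' _ _ ENNReal.ofReal_ne_top
          _ ≤ _ := by
              refine (mul_le_mul' (h0l _ hs' (by linarith [hs.1]) x) le_rfl).trans_eq (ENNReal.ofReal_mul (by positivity)).symm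
    · have hF : ∀ s ∈ Set.Ioo 0 t, ∫⁻ z, k 0 (t - s) x z * ∫⁻ u, k n s z u ∂μ ∂μ ≤
          ENNReal.ofReal (c1 * (t - s) ^ (-σ) * (c1 * (1 / 2) ^ n *
                (s ^ (-σ + min (n * δ) γ) * Real.exp (M * s)))) := by
        intro s hs
        have hs' : 0 < t - s := by linarith [hs.2]
        calc _ ≤ ∫⁻ z, k 0 (t - s) x z * ENNReal.ofReal (c1 * (1 / 2) ^ n *
                (s ^ (-σ + min (n * δ) γ) * Real.exp (M * s))) ∂μ := by
              refine lintegral_mono fun z => ?_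
              gcongr
              exact (ih s hs.1 (by linarith [hs.2])).2.1 z
          _ = (∫⁻ z, k 0 (t - s) x z ∂μ) * _ :=
              lintegral_mul_const' _ _ ENNReal.ofReal_ne_top
          _ ≤ _ := by
              refine (mul_le_mul' (h0l _ hs' (by linarith [hs.1]) x) le_rfl).trans_eq (ENNReal.ofReal_mul (by positivity)).symm
      calc ∫⁻ u, k (n + 1) t x u ∂μ
          ≤ ∫⁻ u, (∫⁻ s in Set.Ioo 0 t, ∫⁻ z, k 0 (t - s) x z * k n s z u ∂μ) ∂μ :=
            lintegral_mono fun u => hrec n t x u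
        _ = ∫⁻ s in Set.Ioo 0 t, ∫⁻ u, ∫⁻ z, k 0 (t - s) x z * k n s z u ∂μ ∂μ := by
            apply lintegral_lintegral_swap
            apply Measurable.aemeasurable
            refine Measurable.lintegral_prod_right' (f := fun p : (X × ℝ) × X =>
              k 0 (t - p.1.2) x p.2 * k n p.1.2 p.2 p.1.1) ?_
            exact ((hk 0).comp (by fun_prop : Measurable fun p : (X × ℝ) × X =>
              (t - p.1.2, x, p.2))).mul ((hk n).comp (by fun_prop : Measurable fun p : (X × ℝ) × X =>
              (p.1.2, p.2, p.1.1)))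
        _ = ∫⁻ s in Set.Ioo 0 t, ∫⁻ z, k 0 (t - s) x z * ∫⁻ u, k n s z u ∂μ ∂μ := by
            refine lintegral_congr fun s => ?_
            rw [lintegral_lintegral_swap]
            · refine lintegral_congr fun z => ?_
              exact lintegral_const_mul _ (mkn s z)
            · apply Measurable.aemeasurable
              exact ((hk 0).comp (by fun_prop : Measurable fun p : X × X =>
                (t - s, x, p.2))).mul ((hk n).comp (by fun_prop : Measurable fun p : X × X =>
                (s, p.2, p.1)))
        _ ≤ _ := step_time σ δ η M hσ hη0 hM0 hM t σ _ c1 _ ht hσ.le hm hc1 hB _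
            (fun s hs _ => hF s hs) (fun s hs _ => hF s hs)
        _ ≤ _ := ENNReal.ofReal_le_ofReal (close n σ t hσγ ht htτ)
    · have hF : ∀ s ∈ Set.Ioo 0 t, ∫⁻ z, (∫⁻ u, k 0 (t - s) u z ∂μ) * k n s z y ∂μ ≤
          ENNReal.ofReal (c1 * (t - s) ^ (-σ) * (c1 * (1 / 2) ^ n *
                (s ^ (-σ + min (n * δ) γ) * Real.exp (M * s)))) := by
        intro s hs
        have hs' : 0 < t - s := by linarith [hs.2]
        calc _ ≤ ∫⁻ z, ENNReal.ofReal (c1 * (t - s) ^ (-σ)) * k n s z y ∂μ := by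
              refine lintegral_mono fun z => ?_
              gcongr
              exact h0r _ hs' (by linarith [hs.1]) z
          _ = _ * ∫⁻ z, k n s z y ∂μ :=
              lintegral_const_mul' _ _ ENNReal.ofReal_ne_top
          _ ≤ _ := by
              refine (mul_le_mul' le_rfl ((ih s hs.1 (by linarith [hs.2])).2.2 y)).trans_eq (ENNReal.ofReal_mul (by positivity)).symm
      calc ∫⁻ u, k (n + 1) t u y ∂μ
          ≤ ∫⁻ u, (∫⁻ s in Set.Ioo 0 t, ∫⁻ z, k 0 (t - s) u z * k n s z y ∂μ) ∂μ :=
            lintegral_mono fun u => hrec n t u y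
        _ = ∫⁻ s in Set.Ioo 0 t, ∫⁻ u, ∫⁻ z, k 0 (t - s) u z * k n s z y ∂μ ∂μ := by
            apply lintegral_lintegral_swap
            apply Measurable.aemeasurable
            refine Measurable.lintegral_prod_right' (f := fun p : (X × ℝ) × X =>
              k 0 (t - p.1.2) p.1.1 p.2 * k n p.1.2 p.2 y) ?_
            exact ((hk 0).comp (by fun_prop : Measurable fun p : (X × ℝ) × X =>
              (t - p.1.2, p.1.1, p.2))).mul ((hk n).comp (by fun_prop : Measurable fun p : (X × ℝ) × X =>
              (p.1.2, p.2, y)))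
        _ = ∫⁻ s in Set.Ioo 0 t, ∫⁻ z, (∫⁻ u, k 0 (t - s) u z ∂μ) * k n s z y ∂μ := by
            refine lintegral_congr fun s => ?_
            rw [lintegral_lintegral_swap]
            · refine lintegral_congr fun z => ?_
              exact lintegral_mul_const _ (mk0' (t - s) z)
            · apply Measurable.aemeasurable
              exact ((hk 0).comp (by fun_prop : Measurable fun p : X × X =>
                (t - s, p.1, p.2))).mul ((hk n).comp (by fun_prop : Measurable fun p : X × X =>
                (s, p.2, y)))
        _ ≤ _ := step_time σ δ η M hσ hη0 hM0 hM t σ _ c1 _ ht hσ.le hm hc1 hB _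
            (fun s hs _ => hF s hs) (fun s hs _ => hF s hs)
        _ ≤ _ := ENNReal.ofReal_le_ofReal (close n σ t hσγ ht htτ)

/-- off-diagonal bounds -/
theorem off_diag {X : Type*} [NormedAddCommGroup X] [MeasurableSpace X] (μ : Measure X)
    (σ τ c1 c2 : ℝ) (hσ1 : σ < 1) (hc2 : 0 ≤ c2) (hc1 : 0 ≤ c1)
    (k : ℕ → ℝ → X → X → ENNReal)
    (hk : ∀ n, Measurable fun p : ℝ × X × X => k n p.1 p.2.1 p.2.2)
    (hrec : ∀ n t x y, k (n + 1) t x y ≤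
      ∫⁻ s in Set.Ioo 0 t, ∫⁻ z, k 0 (t - s) x z * k n s z y ∂μ)
    (h0o : ∀ t, 0 < t → t ≤ τ → ∀ x y, 1 ≤ ‖x - y‖ → k 0 t x y ≤ ENNReal.ofReal c1)
    (hl : ∀ t, 0 < t → t ≤ τ → ∀ x, ∫⁻ u, k 0 t x u ∂μ ≤ ENNReal.ofReal (c2 * t ^ (-σ)))
    (hr : ∀ n t, 0 < t → t ≤ τ → ∀ x, ∫⁻ u, k n t u x ∂μ ≤ ENNReal.ofReal (c2 * t ^ (-σ)))
    (n : ℕ) : ∃ D : ℝ, 0 ≤ D ∧ ∀ t, 0 < t → t ≤ τ → ∀ x y, (n : ℝ) + 1 ≤ ‖x - y‖ →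
      k n t x y ≤ ENNReal.ofReal D := by
  induction n with
  | zero => exact ⟨c1, hc1, fun t ht htτ x y h => h0o t ht htτ x y (by simpa using h)⟩
  | succ n ih =>
    obtain ⟨D, hD, hDb⟩ := ih
    have mk0 : ∀ t x, Measurable fun z => k 0 t x z := fun t x =>
      (hk 0).comp (measurable_const.prodMk (measurable_const.prodMk measurable_id))
    have hint : ∫⁻ s in Set.Ioo 0 τ, ENNReal.ofReal (s ^ (-σ)) ≠ ⊤ := by
      have h : IntegrableOn (fun s : ℝ => s ^ (-σ)) (Set.Ioo 0 τ) := by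
        rcases le_or_gt τ 0 with h | h
        · simp [Set.Ioo_eq_empty_of_le h]
        · exact (intervalIntegral.integrableOn_Ioo_rpow_iff h).2 (by linarith)
      exact h.lintegral_lt_top.ne
    set I := ∫⁻ s in Set.Ioo 0 τ, ENNReal.ofReal (s ^ (-σ)) with hI
    have hfin : ENNReal.ofReal (D * c2) * I + ENNReal.ofReal (c1 * c2) * I ≠ ⊤ :=
      ENNReal.add_ne_top.2 ⟨ENNReal.mul_ne_top ENNReal.ofReal_ne_top hint,
        ENNReal.mul_ne_top ENNReal.ofReal_ne_top hint⟩
    refine ⟨(ENNReal.ofReal (D * c2) * I + ENNReal.ofReal (c1 * c2) * I).toReal,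
      ENNReal.toReal_nonneg, fun t ht htτ x y hxy => ?_⟩
    rw [ENNReal.ofReal_toReal hfin]
    have hIt : ∫⁻ s in Set.Ioo 0 t, ENNReal.ofReal (s ^ (-σ)) ≤ I :=
      lintegral_mono_set (Set.Ioo_subset_Ioo_right htτ)
    have hIt' : ∫⁻ s in Set.Ioo 0 t, ENNReal.ofReal ((t - s) ^ (-σ)) =
        ∫⁻ s in Set.Ioo 0 t, ENNReal.ofReal (s ^ (-σ)) := by
      rw [← lintegral_indicator measurableSet_Ioo, ← lintegral_indicator measurableSet_Ioo,
        ← lintegral_sub_left_eq_self _ t]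
      congr 1
      ext s
      by_cases hs : s ∈ Set.Ioo 0 t
      · have : t - s ∈ Set.Ioo 0 t := ⟨by linarith [hs.2], by linarith [hs.1]⟩
        simp [hs, this]
      · have : t - s ∉ Set.Ioo 0 t := fun h => hs ⟨by linarith [h.2], by linarith [h.1]⟩
        simp [hs, this]
    refine (hrec n t x y).trans ?_
    calc ∫⁻ s in Set.Ioo 0 t, ∫⁻ z, k 0 (t - s) x z * k n s z y ∂μ
        ≤ ∫⁻ s in Set.Ioo 0 t, (ENNReal.ofReal (D * c2) * ENNReal.ofReal ((t - s) ^ (-σ)) +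
          ENNReal.ofReal (c1 * c2) * ENNReal.ofReal (s ^ (-σ))) := by
          refine setLIntegral_mono' measurableSet_Ioo fun s hs => ?_
          have h0 : 0 < s := hs.1
          have hs' : 0 < t - s := by linarith [hs.2]
          calc _ ≤ ∫⁻ z, (ENNReal.ofReal D * k 0 (t - s) x z + ENNReal.ofReal c1 * k n s z y) ∂μ := by
                refine lintegral_mono fun z => ?_
                rcases le_or_gt 1 ‖x - z‖ with h | h
                · refine le_trans ?_ le_add_self
                  gcongr
                  exact h0o _ hs' (by linarith) x z h
                · refine le_trans ?_ le_self_add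
                  rw [mul_comm]
                  gcongr
                  refine hDb s h0 (by linarith [hs.2]) z y ?_
                  have := norm_sub_le_norm_sub_add_norm_sub x z y
                  push_cast at hxy
                  linarith
            _ = ENNReal.ofReal D * ∫⁻ z, k 0 (t - s) x z ∂μ + ENNReal.ofReal c1 * ∫⁻ z, k n s z y ∂μ := by
                rw [lintegral_add_left ((mk0 _ x).const_mul _),
                  lintegral_const_mul' _ _ ENNReal.ofReal_ne_top,
                  lintegral_const_mul' _ _ ENNReal.ofReal_ne_top]
            _ ≤ _ := by
                rw [ENNReal.ofReal_mul hD, ENNReal.ofReal_mul hc1, mul_assoc, mul_assoc,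
                  ← ENNReal.ofReal_mul hc2, ← ENNReal.ofReal_mul hc2]
                gcongr
                · exact hl _ hs' (by linarith) x
                · exact hr n s h0 (by linarith [hs.2]) y
      _ = ENNReal.ofReal (D * c2) * (∫⁻ s in Set.Ioo 0 t, ENNReal.ofReal ((t - s) ^ (-σ))) +
          ENNReal.ofReal (c1 * c2) * (∫⁻ s in Set.Ioo 0 t, ENNReal.ofReal (s ^ (-σ))) := by
          rw [lintegral_add_left (by fun_prop), lintegral_const_mul' _ _ ENNReal.ofReal_ne_top,
            lintegral_const_mul' _ _ ENNReal.ofReal_ne_top]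
      _ ≤ _ := by
          rw [hIt']
          gcongr

theorem integrable_exp_norm {d : ℕ} (c : ℝ) (hc : 0 < c) (x : EuclideanSpace ℝ (Fin d)) :
    Integrable (fun u : EuclideanSpace ℝ (Fin d) => Real.exp (-c * ‖x - u‖)) := by
  have base : Integrable (fun u : EuclideanSpace ℝ (Fin d) => Real.exp (-c * ‖u‖)) := by
    have h1 := integrable_one_add_norm (μ := (volume : Measure (EuclideanSpace ℝ (Fin d))))
      (r := (d + 1 : ℕ)) (by simp)
    obtain ⟨K, hK⟩ : ∃ K : ℝ, ∀ r : ℝ, 0 ≤ r → Real.exp (-c * r) ≤ K * (1 + r) ^ (-((d + 1 : ℕ) : ℝ)) := by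
      refine ⟨(d + 1).factorial / c ^ (d + 1) * Real.exp c, fun r hr => ?_⟩
      have h2 := Real.pow_div_factorial_le_exp (c * (1 + r)) (by positivity) (d + 1)
      rw [Real.rpow_neg (by positivity), Real.rpow_natCast]
      have e : Real.exp (-c * r) = Real.exp c * (Real.exp (c * (1 + r)))⁻¹ := by
        rw [← Real.exp_neg, ← Real.exp_add]; congr 1; ring
      rw [e]
      have h3 : (Real.exp (c * (1 + r)))⁻¹ ≤ ((c * (1 + r)) ^ (d + 1) / (d + 1).factorial)⁻¹ :=
        inv_anti₀ (by positivity) h2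
      calc _ ≤ Real.exp c * ((c * (1 + r)) ^ (d + 1) / (d + 1).factorial)⁻¹ := by gcongr
        _ = _ := by rw [mul_pow]; field_simp
    refine (h1.const_mul K).mono' (by fun_prop) (Filter.Eventually.of_forall fun u => ?_)
    rw [Real.norm_eq_abs, abs_of_pos (Real.exp_pos _)]
    exact hK _ (norm_nonneg u)
  exact base.comp_sub_left x

theorem sum_bound (f : ℕ → ℝ) (B : ℝ) (h : ∀ n, |f n| ≤ B * (1 / 2) ^ n) :
    Summable f ∧ |∑' n, f n| ≤ 2 * B := by
  have hs : HasSum (fun n : ℕ => B * (1 / 2 : ℝ) ^ n) (B * 2) := hasSum_geometric_two.mul_left B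
  refine ⟨Summable.of_norm_bounded hs.summable h, ?_⟩
  have := tsum_of_norm_bounded (f := f) hs h
  rw [Real.norm_eq_abs] at this
  linarith

theorem l1_sum {X : Type*} [MeasurableSpace X] (μ : Measure X) (f : ℕ → X → ℝ)
    (hf : ∀ n, Measurable (f n)) (B : ℝ) (hB : 0 ≤ B)
    (h : ∀ n, ∫⁻ u, ‖f n u‖ₑ ∂μ ≤ ENNReal.ofReal (B * (1 / 2) ^ n)) :
    ∫ u, |∑' n, f n u| ∂μ ≤ 2 * B := by
  by_cases hi : Integrable (fun u => ∑' n, f n u) μ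
  · have h1 := ofReal_integral_norm_eq_lintegral_enorm hi
    have h2 : ∫⁻ u, ‖∑' n, f n u‖ₑ ∂μ ≤ ENNReal.ofReal (2 * B) := by
      calc _ ≤ ∫⁻ u, ∑' n, ‖f n u‖ₑ ∂μ := lintegral_mono fun u => enorm_tsum_le_tsum_enorm
        _ = ∑' n, ∫⁻ u, ‖f n u‖ₑ ∂μ := lintegral_tsum fun n => (hf n).enorm.aemeasurable
        _ ≤ ∑' n, ENNReal.ofReal (B * (1 / 2) ^ n) := ENNReal.tsum_le_tsum h
        _ = ENNReal.ofReal (∑' n, B * (1 / 2 : ℝ) ^ n) :=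
            (ENNReal.ofReal_tsum_of_nonneg (fun n => by positivity)
              (hasSum_geometric_two.mul_left B).summable).symm
        _ = _ := by rw [(hasSum_geometric_two.mul_left B).tsum_eq, mul_comm]
    rw [← h1] at h2
    exact (ENNReal.ofReal_le_ofReal_iff (by positivity)).1 h2
  · have : ¬ Integrable (fun u => |∑' n, f n u|) μ ∨ ∫ u, |∑' n, f n u| ∂μ ≤ 2 * B := by
      by_cases h3 : Integrable (fun u => |∑' n, f n u|) μ
      · exfalso
        apply hi
        have hm : AEStronglyMeasurable (fun u => ∑' n, f n u) μ :=
          (Measurable.tsum hf).aestronglyMeasurable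
        exact (integrable_norm_iff hm).1 h3
      · exact Or.inl h3
    rcases this with h4 | h4
    · rw [integral_undef h4]; positivity
    · exact h4

set_option maxHeartbeats 2000000

theorem stmt_18 (d : ℕ) (τ α β σ lam cstar : ℝ)
    (hτ : 0 < τ) (hα : 0 < α) (hαβ : α ≤ β) (hβ : β < 2)
    (hσ0 : 0 < σ) (hσ1 : σ < 1) (hlam : 0 < lam) (hcstar : 1 ≤ cstar)
    (q₀ : ℝ → EuclideanSpace ℝ (Fin d) → EuclideanSpace ℝ (Fin d) → ℝ)
    (hq₀meas : Measurable
      (fun p : ℝ × EuclideanSpace ℝ (Fin d) × EuclideanSpace ℝ (Fin d) =>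
        q₀ p.1 p.2.1 p.2.2))
    (hb1 : ∀ t : ℝ, 0 < t → t ≤ τ → ∀ x y, |q₀ t x y| ≤ cstar * t ^ (-((d + β) / α)))
    (hb2 : ∀ t : ℝ, 0 < t → t ≤ τ → ∀ x y, 1 ≤ ‖x - y‖ →
      |q₀ t x y| ≤ cstar * Real.exp (-lam * ‖x - y‖))
    (hb3 : ∀ t : ℝ, 0 < t → t ≤ τ → ∀ x,
      (∫ u, |q₀ t x u|) ≤ cstar * t ^ (-σ))
    (hb4 : ∀ t : ℝ, 0 < t → t ≤ τ → ∀ x,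
      (∫ u, |q₀ t u x|) ≤ cstar * t ^ (-σ))
    (Q : ℕ → ℝ → EuclideanSpace ℝ (Fin d) → EuclideanSpace ℝ (Fin d) → ℝ)
    (hQmeas : ∀ n, Measurable
      (fun p : ℝ × EuclideanSpace ℝ (Fin d) × EuclideanSpace ℝ (Fin d) =>
        Q n p.1 p.2.1 p.2.2))
    (hQ0 : ∀ t x y, Q 0 t x y = q₀ t x y)
    (hQn : ∀ n : ℕ, ∀ t x y, Q (n + 1) t x y =
      ∫ s in Set.Ioc (0:ℝ) t, ∫ z, q₀ (t - s) x z * Q n s z y) :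
    ∃ c c₃ a : ℝ, 0 < c ∧ 0 < c₃ ∧ 0 < a ∧
      ∀ t : ℝ, 0 < t → t ≤ τ → ∀ x y,
        -- q(t,x,y) = Σₙ qₙ(t,x,y) is well defined
        Summable (fun n : ℕ => Q n t x y) ∧
        |∑' n : ℕ, Q n t x y| ≤
          c * t ^ (-((d + β) / α)) * Real.exp (-c₃ * Real.sqrt ‖x - y‖) ∧
        (a ≤ ‖x - y‖ →
          |∑' n : ℕ, Q n t x y| ≤ c * Real.exp (-c₃ * Real.sqrt ‖x - y‖)) ∧
        (∫ u, |∑' n : ℕ, Q n t x u|) ≤ c * t ^ (-σ) ∧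
        (∫ u, |∑' n : ℕ, Q n t u y|) ≤ c * t ^ (-σ) := by
  set γ : ℝ := (d + β) / α with hγdef
  have hγ1 : 1 ≤ γ := by
    rw [hγdef, le_div_iff₀ hα]
    have : (0:ℝ) ≤ d := Nat.cast_nonneg d
    linarith
  have hγ0 : 0 < γ := by linarith
  obtain ⟨κ, hκ⟩ : ∃ κ : ℝ, κ = lam / 2 := ⟨_, rfl⟩
  have hκ0 : 0 < κ := by linarith
  obtain ⟨δ, hδ⟩ : ∃ δ : ℝ, δ = (1 - σ) / 2 := ⟨_, rfl⟩
  have hδ0 : 0 < δ := by linarith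
  set T : ℝ := max 1 τ with hT
  have hT1 : 1 ≤ T := le_max_left _ _
  have hτT : τ ≤ T := le_max_right _ _
  have hT0 : 0 < T := by linarith
  have hc0 : 0 < cstar := by linarith
  set J : ℝ := ∫ u : EuclideanSpace ℝ (Fin d), Real.exp (-κ * ‖u‖) with hJ
  have hJ0 : 0 ≤ J := integral_nonneg fun u => (Real.exp_pos _).le
  have hJx : ∀ x : EuclideanSpace ℝ (Fin d), ∫ u, Real.exp (-κ * ‖x - u‖) = J := fun x =>
    integral_sub_left_eq_self (fun u => Real.exp (-κ * ‖u‖)) volume x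
  -- time comparison
  have hTp : ∀ p t : ℝ, 0 ≤ p → 0 < t → t ≤ τ → 1 ≤ T ^ p * t ^ (-p) := by
    intro p t hp ht htτ
    rw [Real.rpow_neg ht.le, ← div_eq_mul_inv, one_le_div (by positivity)]
    exact Real.rpow_le_rpow ht.le (htτ.trans hτT) hp
  obtain ⟨c1, hc1def⟩ : ∃ c1 : ℝ, c1 = cstar * Real.exp κ + cstar * T ^ γ + cstar * J * T ^ σ :=
    ⟨_, rfl⟩
  have hc1 : cstar * Real.exp κ + cstar * T ^ γ ≤ c1 := by
    rw [hc1def]; have : 0 ≤ cstar * J * T ^ σ := by positivity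
    linarith
  have hc1' : cstar * Real.exp κ + cstar * J * T ^ σ ≤ c1 := by
    rw [hc1def]; have : 0 ≤ cstar * T ^ γ := by positivity
    linarith
  have hc1pos : 0 < c1 := lt_of_lt_of_le (by positivity) hc1
  -- weighted pointwise bounds for q₀
  have hw1 : ∀ t : ℝ, 0 < t → t ≤ τ → ∀ x y, 1 ≤ ‖x - y‖ →
      |q₀ t x y| * Real.exp (κ * ‖x - y‖) ≤ cstar * Real.exp (-κ * ‖x - y‖) := by
    intro t ht htτ x y h
    calc _ ≤ cstar * Real.exp (-lam * ‖x - y‖) * Real.exp (κ * ‖x - y‖) := by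
          gcongr; exact hb2 t ht htτ x y h
      _ = _ := by
          rw [mul_assoc, ← Real.exp_add]; congr 2; rw [hκ]; ring
  have hw2 : ∀ t : ℝ, ∀ x y : EuclideanSpace ℝ (Fin d), ‖x - y‖ < 1 →
      |q₀ t x y| * Real.exp (κ * ‖x - y‖) ≤ |q₀ t x y| * Real.exp κ := by
    intro t x y h
    gcongr
    nlinarith
  have hw3 : ∀ t : ℝ, 0 < t → t ≤ τ → ∀ x y,
      |q₀ t x y| * Real.exp (κ * ‖x - y‖) ≤
        Real.exp κ * |q₀ t x y| + cstar * Real.exp (-κ * ‖x - y‖) := by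
    intro t ht htτ x y
    rcases le_or_gt 1 ‖x - y‖ with h | h
    · refine (hw1 t ht htτ x y h).trans ?_
      have : 0 ≤ Real.exp κ * |q₀ t x y| := by positivity
      linarith
    · refine (hw2 t x y h).trans ?_
      have : 0 ≤ cstar * Real.exp (-κ * ‖x - y‖) := by positivity
      linarith
  have hw4 : ∀ t : ℝ, 0 < t → t ≤ τ → ∀ x y, 1 ≤ ‖x - y‖ →
      |q₀ t x y| * Real.exp (κ * ‖x - y‖) ≤ cstar := by
    intro t ht htτ x y h
    refine (hw1 t ht htτ x y h).trans (mul_le_of_le_one_right hc0.le ?_)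
    apply Real.exp_le_one_iff.2
    nlinarith
  have hw5 : ∀ t : ℝ, 0 < t → t ≤ τ → ∀ x y,
      |q₀ t x y| * Real.exp (κ * ‖x - y‖) ≤ c1 * t ^ (-γ) := by
    intro t ht htτ x y
    have ht0 : 0 < t ^ (-γ) := by positivity
    rcases le_or_gt 1 ‖x - y‖ with h | h
    · have h1 := hw4 t ht htτ x y h
      have h2 := hTp γ t hγ0.le ht htτ
      calc _ ≤ cstar * 1 := by linarith
        _ ≤ cstar * (T ^ γ * t ^ (-γ)) := by gcongr
        _ = cstar * T ^ γ * t ^ (-γ) := by ring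
        _ ≤ c1 * t ^ (-γ) := by
          gcongr
          have : 0 < cstar * Real.exp κ := by positivity
          linarith
    · have h1 := hw2 t x y h
      have h2 := hb1 t ht htτ x y
      calc _ ≤ cstar * t ^ (-γ) * Real.exp κ := h1.trans (by gcongr)
        _ = cstar * Real.exp κ * t ^ (-γ) := by ring
        _ ≤ c1 * t ^ (-γ) := by
          gcongr
          have : 0 < cstar * T ^ γ := by positivity
          linarith
  have hdom : ∀ t : ℝ, 0 < t → t ≤ τ → ∀ x y,
      |q₀ t x y| ≤ c1 * t ^ (-γ) * Real.exp (-κ * ‖x - y‖) := by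
    intro t ht htτ x y
    have h := hw5 t ht htτ x y
    have e : Real.exp (-κ * ‖x - y‖) = (Real.exp (κ * ‖x - y‖))⁻¹ := by
      rw [← Real.exp_neg]; congr 1; ring
    rw [e, ← div_eq_mul_inv, le_div_iff₀ (Real.exp_pos _)]
    exact h
  have hml : ∀ n t x, Measurable fun u => Q n t x u := fun n t x =>
    (hQmeas n).comp (measurable_const.prodMk (measurable_const.prodMk measurable_id))
  have hmr : ∀ n t y, Measurable fun u => Q n t u y := fun n t x =>
    (hQmeas n).comp (measurable_const.prodMk (measurable_id.prodMk measurable_const))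
  have hml0 : ∀ t x, Measurable fun u => q₀ t x u := fun t x =>
    hq₀meas.comp (measurable_const.prodMk (measurable_const.prodMk measurable_id))
  have hmr0 : ∀ t y, Measurable fun u => q₀ t u y := fun t x =>
    hq₀meas.comp (measurable_const.prodMk (measurable_id.prodMk measurable_const))
  have hil : ∀ t : ℝ, 0 < t → t ≤ τ → ∀ x, Integrable fun u => |q₀ t x u| := by
    intro t ht htτ x
    refine ((integrable_exp_norm κ hκ0 x).const_mul (c1 * t ^ (-γ))).mono'
      (hml0 t x).abs.aestronglyMeasurable (Filter.Eventually.of_forall fun u => ?_)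
    rw [Real.norm_eq_abs, abs_abs]
    exact hdom t ht htτ x u
  have hir : ∀ t : ℝ, 0 < t → t ≤ τ → ∀ x, Integrable fun u => |q₀ t u x| := by
    intro t ht htτ x
    refine ((integrable_exp_norm κ hκ0 x).const_mul (c1 * t ^ (-γ))).mono'
      (hmr0 t x).abs.aestronglyMeasurable (Filter.Eventually.of_forall fun u => ?_)
    rw [Real.norm_eq_abs, abs_abs, norm_sub_rev]
    exact hdom t ht htτ u x
  obtain ⟨k, hkdef⟩ : ∃ k : ℕ → ℝ → EuclideanSpace ℝ (Fin d) → EuclideanSpace ℝ (Fin d) → ENNReal,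
      ∀ n t x y, k n t x y = ‖Q n t x y‖ₑ * ENNReal.ofReal (Real.exp (κ * ‖x - y‖)) :=
    ⟨_, fun _ _ _ _ => rfl⟩
  have hkreal : ∀ n t x y, k n t x y = ENNReal.ofReal (|Q n t x y| * Real.exp (κ * ‖x - y‖)) := by
    intro n t x y
    rw [hkdef, ENNReal.ofReal_mul (abs_nonneg _), Real.enorm_eq_ofReal_abs]
  have hk : ∀ n, Measurable fun p : ℝ × EuclideanSpace ℝ (Fin d) × EuclideanSpace ℝ (Fin d) =>
      k n p.1 p.2.1 p.2.2 := by
    intro n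
    simp only [hkdef]
    exact (hQmeas n).enorm.mul (by fun_prop)
  have hrec : ∀ n t x y, k (n + 1) t x y ≤
      ∫⁻ s in Set.Ioo 0 t, ∫⁻ z, k 0 (t - s) x z * k n s z y := by
    intro n t x y
    rw [hkdef, hQn]
    calc _ ≤ (∫⁻ s in Set.Ioc 0 t, ∫⁻ z, ‖q₀ (t - s) x z * Q n s z y‖ₑ) *
          ENNReal.ofReal (Real.exp (κ * ‖x - y‖)) := by
          gcongr
          refine (enorm_integral_le_lintegral_enorm _).trans (lintegral_mono fun s => ?_)
          exact enorm_integral_le_lintegral_enorm _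
      _ = ∫⁻ s in Set.Ioo 0 t, ∫⁻ z, ‖q₀ (t - s) x z * Q n s z y‖ₑ *
          ENNReal.ofReal (Real.exp (κ * ‖x - y‖)) := by
          rw [setLIntegral_congr Ioo_ae_eq_Ioc.symm, ← lintegral_mul_const' _ _ ENNReal.ofReal_ne_top]
          refine lintegral_congr fun s => ?_
          rw [← lintegral_mul_const' _ _ ENNReal.ofReal_ne_top]
      _ ≤ _ := by
          refine lintegral_mono fun s => lintegral_mono fun z => ?_
          rw [hkdef, hkdef, hQ0, enorm_mul, mul_mul_mul_comm]
          gcongr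
          rw [← ENNReal.ofReal_mul (Real.exp_pos _).le, ← Real.exp_add]
          apply ENNReal.ofReal_le_ofReal
          apply Real.exp_le_exp.2
          have := norm_sub_le_norm_sub_add_norm_sub x z y
          nlinarith
  have h0s : ∀ t, 0 < t → t ≤ τ → ∀ x y, k 0 t x y ≤ ENNReal.ofReal (c1 * t ^ (-γ)) := by
    intro t ht htτ x y
    rw [hkreal, hQ0]
    exact ENNReal.ofReal_le_ofReal (hw5 t ht htτ x y)
  have hfin : ∀ t : ℝ, 0 < t → t ≤ τ →
      Real.exp κ * (cstar * t ^ (-σ)) + cstar * J ≤ c1 * t ^ (-σ) := by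
    intro t ht htτ
    have h2 := hTp σ t hσ0.le ht htτ
    have : cstar * J * 1 ≤ cstar * J * (T ^ σ * t ^ (-σ)) := by gcongr
    have h3 : (cstar * Real.exp κ + cstar * J * T ^ σ) * t ^ (-σ) ≤ c1 * t ^ (-σ) := by gcongr
    linarith
  have h0l : ∀ t, 0 < t → t ≤ τ → ∀ x, ∫⁻ u, k 0 t x u ≤ ENNReal.ofReal (c1 * t ^ (-σ)) := by
    intro t ht htτ x
    have hI := ((hil t ht htτ x).const_mul (Real.exp κ)).add
      ((integrable_exp_norm κ hκ0 x).const_mul cstar)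
    calc _ ≤ ∫⁻ u, ENNReal.ofReal (Real.exp κ * |q₀ t x u| + cstar * Real.exp (-κ * ‖x - u‖)) := by
          refine lintegral_mono fun u => ?_
          rw [hkreal, hQ0]
          exact ENNReal.ofReal_le_ofReal (hw3 t ht htτ x u)
      _ = ENNReal.ofReal (∫ u, (Real.exp κ * |q₀ t x u| + cstar * Real.exp (-κ * ‖x - u‖))) :=
          (ofReal_integral_eq_lintegral_ofReal hI (Filter.Eventually.of_forall fun u => by
            simp only [Pi.zero_apply, Pi.add_apply]; positivity)).symm
      _ ≤ _ := by
          apply ENNReal.ofReal_le_ofReal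
          rw [integral_add ((hil t ht htτ x).const_mul (Real.exp κ))
            ((integrable_exp_norm κ hκ0 x).const_mul cstar), integral_const_mul, integral_const_mul,
            hJx]
          refine le_trans ?_ (hfin t ht htτ)
          gcongr
          exact hb3 t ht htτ x
  have h0r : ∀ t, 0 < t → t ≤ τ → ∀ x, ∫⁻ u, k 0 t u x ≤ ENNReal.ofReal (c1 * t ^ (-σ)) := by
    intro t ht htτ x
    have hI := ((hir t ht htτ x).const_mul (Real.exp κ)).add
      ((integrable_exp_norm κ hκ0 x).const_mul cstar)
    calc _ ≤ ∫⁻ u, ENNReal.ofReal (Real.exp κ * |q₀ t u x| + cstar * Real.exp (-κ * ‖x - u‖)) := by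
          refine lintegral_mono fun u => ?_
          rw [hkreal, hQ0, norm_sub_rev x u]
          exact ENNReal.ofReal_le_ofReal (hw3 t ht htτ u x)
      _ = ENNReal.ofReal (∫ u, (Real.exp κ * |q₀ t u x| + cstar * Real.exp (-κ * ‖x - u‖))) :=
          (ofReal_integral_eq_lintegral_ofReal hI (Filter.Eventually.of_forall fun u => by
            simp only [Pi.zero_apply, Pi.add_apply]; positivity)).symm
      _ ≤ _ := by
          apply ENNReal.ofReal_le_ofReal
          rw [integral_add ((hir t ht htτ x).const_mul (Real.exp κ))
            ((integrable_exp_norm κ hκ0 x).const_mul cstar), integral_const_mul, integral_const_mul,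
            hJx]
          refine le_trans ?_ (hfin t ht htτ)
          gcongr
          exact hb4 t ht htτ x
  obtain ⟨M, hM0, hM⟩ := kernel_bounds volume σ γ τ c1 δ hσ0 (by linarith) hδ0 (by linarith)
    hc1pos.le k hk hrec h0s h0l h0r
  obtain ⟨K, hKdef⟩ : ∃ K : ℝ, K = c1 * Real.exp (M * τ) * T ^ γ := ⟨_, rfl⟩
  have hK0 : 0 < K := by rw [hKdef]; positivity
  have hbd : ∀ (n : ℕ) (p t : ℝ), 0 < t → t ≤ τ →
      c1 * (1 / 2) ^ n * (t ^ (-p + min (n * δ) γ) * Real.exp (M * t)) ≤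
        K * t ^ (-p) * (1 / 2) ^ n := by
    intro n p t ht htτ
    have hm : 0 ≤ min (n * δ) γ := le_min (by positivity) hγ0.le
    have e1 : t ^ (min (n * δ) γ) ≤ T ^ γ :=
      (Real.rpow_le_rpow ht.le (htτ.trans hτT) hm).trans
        (Real.rpow_le_rpow_of_exponent_le hT1 (min_le_right _ _))
    have e2 : Real.exp (M * t) ≤ Real.exp (M * τ) := by gcongr
    rw [Real.rpow_add ht, hKdef]
    calc _ ≤ c1 * (1 / 2) ^ n * (t ^ (-p) * T ^ γ * Real.exp (M * τ)) := by gcongr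
      _ = _ := by ring
  have hS : ∀ (n : ℕ) (t : ℝ), 0 < t → t ≤ τ → ∀ x y, k n t x y ≤
      ENNReal.ofReal (K * t ^ (-γ) * (1 / 2) ^ n) := fun n t ht htτ x y =>
    ((hM n t ht htτ).1 x y).trans (ENNReal.ofReal_le_ofReal (hbd n γ t ht htτ))
  have hL : ∀ (n : ℕ) (t : ℝ), 0 < t → t ≤ τ → ∀ x, ∫⁻ u, k n t x u ≤
      ENNReal.ofReal (K * t ^ (-σ) * (1 / 2) ^ n) := fun n t ht htτ x =>
    ((hM n t ht htτ).2.1 x).trans (ENNReal.ofReal_le_ofReal (hbd n σ t ht htτ))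
  have hR : ∀ (n : ℕ) (t : ℝ), 0 < t → t ≤ τ → ∀ x, ∫⁻ u, k n t u x ≤
      ENNReal.ofReal (K * t ^ (-σ) * (1 / 2) ^ n) := fun n t ht htτ x =>
    ((hM n t ht htτ).2.2 x).trans (ENNReal.ofReal_le_ofReal (hbd n σ t ht htτ))
  have hR' : ∀ (n : ℕ) (t : ℝ), 0 < t → t ≤ τ → ∀ x, ∫⁻ u, k n t u x ≤
      ENNReal.ofReal (K * t ^ (-σ)) := by
    intro n t ht htτ x
    refine (hR n t ht htτ x).trans (ENNReal.ofReal_le_ofReal ?_)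
    exact mul_le_of_le_one_right (by positivity) (pow_le_one₀ (by norm_num) (by norm_num))
  have hoff := off_diag volume σ τ cstar K hσ1 hK0.le hc0.le k hk hrec
    (fun t ht htτ x y h => by
      rw [hkreal, hQ0]; exact ENNReal.ofReal_le_ofReal (hw4 t ht htτ x y h))
    (fun t ht htτ x => by simpa using hL 0 t ht htτ x) hR'
  choose D hD0 hD using hoff
  obtain ⟨N, hN⟩ := exists_nat_ge (γ / δ)
  have hNδ : γ ≤ N * δ := (div_le_iff₀ hδ0).1 hN
  obtain ⟨D', hD'def⟩ : ∃ D' : ℝ, D' = ∑ n ∈ Finset.range N, D n * 2 ^ n + c1 * Real.exp (M * τ) :=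
    ⟨_, rfl⟩
  have hsum0 : 0 ≤ ∑ n ∈ Finset.range N, D n * 2 ^ n :=
    Finset.sum_nonneg fun n _ => mul_nonneg (hD0 n) (by positivity)
  have hD'0 : 0 < D' := by
    rw [hD'def]; have : 0 < c1 * Real.exp (M * τ) := by positivity
    linarith
  have hO : ∀ (n : ℕ) (t : ℝ), 0 < t → t ≤ τ → ∀ x y, (N : ℝ) + 1 ≤ ‖x - y‖ → k n t x y ≤
      ENNReal.ofReal (D' * (1 / 2) ^ n) := by
    intro n t ht htτ x y hxy
    rcases lt_or_ge n N with h | h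
    · have hn : (n : ℝ) ≤ N := by exact_mod_cast h.le
      refine (hD n t ht htτ x y (by linarith)).trans (ENNReal.ofReal_le_ofReal ?_)
      have h1 : D n * 2 ^ n ≤ D' := by
        have := Finset.single_le_sum (f := fun n => D n * 2 ^ n) (s := Finset.range N)
          (fun n _ => mul_nonneg (hD0 n) (by positivity)) (Finset.mem_range.2 h)
        have h2 : 0 < c1 * Real.exp (M * τ) := by positivity
        rw [hD'def]; linarith
      calc D n = D n * 2 ^ n * (1 / 2) ^ n := by
            rw [mul_assoc, ← mul_pow]; norm_num
        _ ≤ _ := by gcongr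
    · refine ((hM n t ht htτ).1 x y).trans (ENNReal.ofReal_le_ofReal ?_)
      have hn : (N : ℝ) ≤ n := by exact_mod_cast h
      have : min (n * δ) γ = γ := min_eq_right (hNδ.trans (by gcongr))
      rw [this, neg_add_cancel, Real.rpow_zero, one_mul]
      have e2 : Real.exp (M * t) ≤ Real.exp (M * τ) := by gcongr
      have h1 : c1 * Real.exp (M * τ) ≤ D' := by rw [hD'def]; linarith
      calc c1 * (1 / 2) ^ n * Real.exp (M * t) ≤ c1 * (1 / 2) ^ n * Real.exp (M * τ) := by gcongr
        _ = c1 * Real.exp (M * τ) * (1 / 2) ^ n := by ring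
        _ ≤ _ := by gcongr
  -- from weighted bounds to bounds on Q
  have hconv : ∀ (n : ℕ) (t : ℝ) (x y : EuclideanSpace ℝ (Fin d)) (B : ℝ), 0 ≤ B →
      k n t x y ≤ ENNReal.ofReal (B * (1 / 2) ^ n) →
      |Q n t x y| ≤ B * Real.exp κ * Real.exp (-κ * Real.sqrt ‖x - y‖) * (1 / 2) ^ n := by
    intro n t x y B hB h
    rw [hkreal] at h
    have h1 := (ENNReal.ofReal_le_ofReal_iff (by positivity)).1 h
    have h2 : 1 ≤ Real.exp (κ * ‖x - y‖) * (Real.exp κ * Real.exp (-κ * Real.sqrt ‖x - y‖)) := by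
      rw [← Real.exp_add, ← Real.exp_add]
      apply Real.one_le_exp
      have h3 := Real.sq_sqrt (norm_nonneg (x - y))
      have h4 : Real.sqrt ‖x - y‖ ≤ ‖x - y‖ + 1 := by
        nlinarith [sq_nonneg (Real.sqrt ‖x - y‖ - 1 / 2)]
      nlinarith
    calc |Q n t x y| = |Q n t x y| * 1 := by ring
      _ ≤ |Q n t x y| * (Real.exp (κ * ‖x - y‖) * (Real.exp κ * Real.exp (-κ * Real.sqrt ‖x - y‖))) := by
          gcongr
      _ = |Q n t x y| * Real.exp (κ * ‖x - y‖) * (Real.exp κ * Real.exp (-κ * Real.sqrt ‖x - y‖)) := by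
          ring
      _ ≤ B * (1 / 2) ^ n * (Real.exp κ * Real.exp (-κ * Real.sqrt ‖x - y‖)) := by gcongr
      _ = _ := by ring
  have hQk : ∀ n t x y, ‖Q n t x y‖ₑ ≤ k n t x y := by
    intro n t x y
    rw [hkdef]
    refine le_mul_of_one_le_right' ?_
    rw [← ENNReal.ofReal_one]
    apply ENNReal.ofReal_le_ofReal
    apply Real.one_le_exp
    positivity
  have hek : 1 ≤ Real.exp κ := Real.one_le_exp hκ0.le
  refine ⟨2 * (K + D') * Real.exp κ, κ, N + 1, by positivity, hκ0, by positivity, ?_⟩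
  intro t ht htτ x y
  have hA := sum_bound (fun n => Q n t x y) _ fun n =>
    hconv n t x y (K * t ^ (-γ)) (by positivity) (hS n t ht htτ x y)
  have hKc : 2 * K ≤ 2 * (K + D') * Real.exp κ := by
    calc 2 * K ≤ 2 * (K + D') * 1 := by linarith
      _ ≤ _ := by gcongr
  refine ⟨hA.1, hA.2.trans ?_, fun hxy => ?_, ?_, ?_⟩
  · calc 2 * (K * t ^ (-γ) * Real.exp κ * Real.exp (-κ * √‖x - y‖))
        = 2 * K * Real.exp κ * t ^ (-γ) * Real.exp (-κ * √‖x - y‖) := by ring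
      _ ≤ _ := by gcongr; linarith
  · have hB := sum_bound (fun n => Q n t x y) _ fun n =>
      hconv n t x y D' hD'0.le (hO n t ht htτ x y hxy)
    refine hB.2.trans ?_
    calc 2 * (D' * Real.exp κ * Real.exp (-κ * √‖x - y‖))
        = 2 * D' * Real.exp κ * Real.exp (-κ * √‖x - y‖) := by ring
      _ ≤ _ := by gcongr; linarith
  · refine (l1_sum volume (fun n u => Q n t x u) (fun n => hml n t x) (K * t ^ (-σ)) (by positivity)
      fun n => (lintegral_mono fun u => hQk n t x u).trans (hL n t ht htτ x)).trans ?_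
    rw [← mul_assoc]
    gcongr
  · refine (l1_sum volume (fun n u => Q n t u y) (fun n => hmr n t y) (K * t ^ (-σ)) (by positivity)
      fun n => (lintegral_mono fun u => hQk n t u y).trans (hR n t ht htτ y)).trans ?_
    rw [← mul_assoc]
    gcongr
end
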